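/- arXiv:1703.08854 — 2 statements merged into one kernel-verified Lean document; each statement's English description precedes it below -/
import Mathlib

section
/- Let (A₁,B₁) and (A₂,B₂) be pairs of ternary quadratic forms over ℚ (symmetric 3×3 rational matrices) such that for each i = 1,2: (a) Aᵢ and Bᵢ are linearly independent over ℚ; (b') the pair (Aᵢ,Bᵢ) is non-singular and anisotropic over ℚ; (c') the sets of simultaneous rational representations coincide, q_ℚ(A₁,B₁) = q_ℚ(A₂,B₂). Then for any nonzero integers r₁, r₂ satisfying r₂·det(A₁·X − B₁) = r₁·det(A₂·X − B₂) as polynomials in X, there exists w ∈ GL₃(ℚ) such that wᵀ(r₁A₁)w = r₂A₂ and wᵀ(r₁B₁)w = r₂B₂ (i.e., (r₁A₁, r₁B₁) and (r₂A₂, r₂B₂) are equivalent under the action of GL₃(ℚ) × {1}). -/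
open Matrix

/-- The set of simultaneous representations of a pair of ternary quadratic forms
(symmetric 3×3 matrices) over `ℚ`. -/
def simRepQ (A B : Matrix (Fin 3) (Fin 3) ℚ) : Set (ℚ × ℚ) :=
  {p : ℚ × ℚ | ∃ x : Fin 3 → ℚ, x ≠ 0 ∧ x ⬝ᵥ (A *ᵥ x) = p.1 ∧ x ⬝ᵥ (B *ᵥ x) = p.2}

/-- The two-variable polynomial `det (A·X − B·Y)`. -/
noncomputable def detPolyXY (A B : Matrix (Fin 3) (Fin 3) ℚ) : MvPolynomial (Fin 2) ℚ :=
  (((MvPolynomial.X 0 : MvPolynomial (Fin 2) ℚ) • A.map MvPolynomial.C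
    - (MvPolynomial.X 1 : MvPolynomial (Fin 2) ℚ) • B.map MvPolynomial.C :
      Matrix (Fin 3) (Fin 3) (MvPolynomial (Fin 2) ℚ))).det

/-- The one-variable polynomial `det (A·X − B)`. -/
noncomputable def detPolyX (A B : Matrix (Fin 3) (Fin 3) ℚ) : Polynomial ℚ :=
  (((Polynomial.X : Polynomial ℚ) • A.map Polynomial.C - B.map Polynomial.C :
      Matrix (Fin 3) (Fin 3) (Polynomial ℚ))).det

section

open scoped ENNReal
open NumberField IsDedekindDomain Filter Topology

/-- The generating sum `∑ ∏ g x` over all finite multisets, i.e. the formal Euler product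
`∏ (1 - g x)⁻¹`. -/
noncomputable def multisetSum {X : Type*} (g : X → ℝ≥0∞) : ℝ≥0∞ :=
  ∑' m : Multiset X, (m.map g).prod

lemma multisetSum_le_of_injective {X Y : Type*} {g : X → ℝ≥0∞} {h : Y → ℝ≥0∞} (f : X → Y)
    (hf : Function.Injective f) (hg : ∀ x, g x = h (f x)) : multisetSum g ≤ multisetSum h := by
  have := ENNReal.tsum_comp_le_tsum_of_injective (Multiset.map_injective hf)
    (fun m : Multiset Y => (m.map h).prod)
  refine le_trans (le_of_eq ?_) this
  simp only [multisetSum, Multiset.map_map, Function.comp_def, ← hg]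

lemma multisetSum_mono {X : Type*} {g h : X → ℝ≥0∞} (hg : ∀ x, g x ≤ h x) :
    multisetSum g ≤ multisetSum h := by
  refine ENNReal.tsum_le_tsum fun m => ?_
  induction m using Multiset.induction_on with
  | empty => simp
  | cons a m ih => simpa using mul_le_mul' (hg a) ih

lemma bijective_map_inl_add_map_inr (X Y : Type*) :
    Function.Bijective (fun m : Multiset X × Multiset Y =>
      (m.1.map Sum.inl + m.2.map Sum.inr : Multiset (X ⊕ Y))) := by
  constructor
  · rintro ⟨a, b⟩ ⟨c, d⟩ h
    have h1 := congrArg (Multiset.filterMap (Sum.getLeft? (α := X) (β := Y))) h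
    have h2 := congrArg (Multiset.filterMap (Sum.getRight? (α := X) (β := Y))) h
    simp only [Multiset.filterMap_add, Multiset.filterMap_map, Function.comp_def,
      Sum.getLeft?_inl, Sum.getLeft?_inr, Sum.getRight?_inl, Sum.getRight?_inr] at h1 h2
    have e1 : ∀ s : Multiset X, Multiset.filterMap (fun x => some x) s = s :=
      Multiset.filterMap_some
    have e2 : ∀ s : Multiset Y, Multiset.filterMap (fun x => some x) s = s :=
      Multiset.filterMap_some
    have e3 : ∀ s : Multiset Y, Multiset.filterMap (fun _ => (none : Option X)) s = 0 := by
      intro s; induction s using Multiset.induction_on <;> simp_all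
    have e4 : ∀ s : Multiset X, Multiset.filterMap (fun _ => (none : Option Y)) s = 0 := by
      intro s; induction s using Multiset.induction_on <;> simp_all
    simp only [e1, e2, e3, e4, add_zero, zero_add] at h1 h2
    rw [h1, h2]
  · intro m
    induction m using Multiset.induction_on with
    | empty => exact ⟨(0, 0), by simp⟩
    | cons a m ih =>
      obtain ⟨⟨b, c⟩, rfl⟩ := ih
      rcases a with a | a
      · exact ⟨(a ::ₘ b, c), by simp⟩
      · exact ⟨(b, a ::ₘ c), by simp⟩

lemma multisetSum_sum {X Y : Type*} (g : X ⊕ Y → ℝ≥0∞) :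
    multisetSum g = multisetSum (g ∘ Sum.inl) * multisetSum (g ∘ Sum.inr) := by
  rw [multisetSum, ← (Equiv.ofBijective _ (bijective_map_inl_add_map_inr X Y)).tsum_eq]
  simp only [Equiv.ofBijective_apply, Multiset.map_add, Multiset.prod_add, Multiset.map_map]
  rw [ENNReal.tsum_prod (f := fun (a : Multiset X) (b : Multiset Y) =>
    (a.map ((fun x => g x) ∘ Sum.inl)).prod * (b.map ((fun x => g x) ∘ Sum.inr)).prod)]
  simp only [ENNReal.tsum_mul_left, ENNReal.tsum_mul_right]
  rfl

lemma multisetSum_eq_mul_compl {X : Type*} (g : X → ℝ≥0∞) (S : Set X) :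
    multisetSum g = multisetSum (fun x : S => g x) * multisetSum (fun x : ↥Sᶜ => g x) := by
  classical
  have := multisetSum_sum (fun x : S ⊕ ↥Sᶜ => g (Equiv.Set.sumCompl S x))
  refine le_antisymm ?_ ?_
  · refine le_trans (multisetSum_le_of_injective (Equiv.Set.sumCompl S).symm
      (Equiv.injective _) ?_) this.le
    simp
  · refine le_trans this.ge (multisetSum_le_of_injective (Equiv.Set.sumCompl S)
      (Equiv.injective _) ?_)
    simp

lemma multisetSum_le_tsum_pow {X : Type*} (g : X → ℝ≥0∞) :
    multisetSum g ≤ ∑' n : ℕ, (∑' x, g x) ^ n := by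
  have h1 : multisetSum g ≤ ∑' l : List X, (l.map g).prod := by
    have hinj : Function.Injective (Multiset.toList : Multiset X → List X) := fun a b h => by
      simpa using congrArg (fun l : List X => (l : Multiset X)) h
    refine le_trans (le_of_eq (tsum_congr fun m => ?_))
      (ENNReal.tsum_comp_le_tsum_of_injective hinj (fun l : List X => (l.map g).prod))
    conv_lhs => rw [← Multiset.coe_toList m]
    rw [Multiset.map_coe, Multiset.prod_coe]
  have h2 : ∀ n : ℕ, ∑' v : List.Vector X n, (v.toList.map g).prod = (∑' x, g x) ^ n := by
    intro n
    induction n with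
    | zero =>
      rw [tsum_eq_single List.Vector.nil (fun b hb => absurd (Subsingleton.elim _ _) hb)]
      simp [List.Vector.nil]
    | succ n ih =>
      let e : X × List.Vector X n ≃ List.Vector X (n + 1) :=
        { toFun := fun p => p.1 ::ᵥ p.2
          invFun := fun v => (v.head, v.tail)
          left_inv := fun p => by simp
          right_inv := fun v => by simp }
      have he : ∀ p : X × List.Vector X n,
          ((e p).toList.map g).prod = g p.1 * (p.2.toList.map g).prod := fun p => by simp [e]
      rw [← e.tsum_eq, tsum_congr he, pow_succ', ← ih, ENNReal.tsum_prod
        (f := fun (a : X) (b : List.Vector X n) => g a * (b.toList.map g).prod)]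
      simp only [ENNReal.tsum_mul_left, ENNReal.tsum_mul_right]
  refine h1.trans (le_of_eq ?_)
  simp only [← h2]
  rw [← ENNReal.tsum_sigma, ← (Equiv.sigmaFiberEquiv (List.length (α := X))).tsum_eq]
  rfl

lemma multisetSum_ne_top_of_tsum_lt_one {X : Type*} {g : X → ℝ≥0∞} (h : ∑' x, g x < 1) :
    multisetSum g ≠ ⊤ := by
  refine ne_top_of_le_ne_top ?_ (multisetSum_le_tsum_pow g)
  rw [ENNReal.tsum_geometric]
  exact ENNReal.inv_ne_top.2 (tsub_pos_of_lt h).ne'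

lemma multisetSum_ne_top_of_finite {X : Type*} [Finite X] {g : X → ℝ≥0∞} (h : ∀ x, g x < 1) :
    multisetSum g ≠ ⊤ := by
  induction X using Finite.induction_empty_option with
  | of_equiv e ih =>
    refine ne_top_of_le_ne_top (ih (g := fun x => g (e x)) fun x => h _)
      (multisetSum_le_of_injective e.symm e.symm.injective (by simp))
  | h_empty => exact multisetSum_ne_top_of_tsum_lt_one (by simp)
  | h_option ih =>
    rename_i Y _
    have := multisetSum_sum (fun x : Y ⊕ PUnit.{1} => g ((Equiv.optionEquivSumPUnit Y).symm x))
    refine ne_top_of_le_ne_top ?_ ((multisetSum_le_of_injective (Equiv.optionEquivSumPUnit Y)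
      (Equiv.injective _) (by simp)).trans this.le)
    refine ENNReal.mul_ne_top (ih fun x => h _) (multisetSum_ne_top_of_tsum_lt_one ?_)
    simpa using h _

/-- An Euler product with summable terms, each less than one, is finite. -/
lemma multisetSum_ne_top {X : Type*} {g : X → ℝ≥0∞} (h1 : ∀ x, g x < 1) (h : ∑' x, g x ≠ ⊤) :
    multisetSum g ≠ ⊤ := by
  have ht := ENNReal.tendsto_tsum_compl_atTop_zero h
  obtain ⟨s, hs⟩ := (ht.eventually (gt_mem_nhds (zero_lt_one))).exists
  rw [multisetSum_eq_mul_compl g (s : Set X)]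
  exact ENNReal.mul_ne_top (multisetSum_ne_top_of_finite fun x => h1 _)
    (multisetSum_ne_top_of_tsum_lt_one hs)
/-- The term `N(I) ^ (-s)` of the Dedekind zeta series, as an extended nonnegative real. -/
noncomputable def normTerm (F : Type*) [Field F] [NumberField F] (s : ℝ) (I : Ideal (𝓞 F)) :
    ℝ≥0∞ :=
  ENNReal.ofReal ((Ideal.absNorm I : ℝ) ^ (-s))

lemma normTerm_mul {F : Type*} [Field F] [NumberField F] (s : ℝ) (I J : Ideal (𝓞 F)) :
    normTerm F s (I * J) = normTerm F s I * normTerm F s J := by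
  rw [normTerm, normTerm, normTerm, ← ENNReal.ofReal_mul (by positivity), map_mul, Nat.cast_mul,
    Real.mul_rpow (by positivity) (by positivity)]

lemma normTerm_one {F : Type*} [Field F] [NumberField F] (s : ℝ) :
    normTerm F s (1 : Ideal (𝓞 F)) = 1 := by
  simp [normTerm]

lemma normTerm_bot {F : Type*} [Field F] [NumberField F] {s : ℝ} (hs : s ≠ 0) :
    normTerm F s (⊥ : Ideal (𝓞 F)) = 0 := by
  simp [normTerm, Real.zero_rpow (neg_ne_zero.2 hs)]

lemma normTerm_multiset_prod {F : Type*} [Field F] [NumberField F] (s : ℝ)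
    (m : Multiset (HeightOneSpectrum (𝓞 F))) :
    (m.map fun P => normTerm F s P.asIdeal).prod =
      normTerm F s (m.map HeightOneSpectrum.asIdeal).prod := by
  induction m using Multiset.induction_on with
  | empty => simpa using (normTerm_one s).symm
  | cons a m ih => simp [normTerm_mul, ih]

lemma prod_asIdeal_ne_bot {R : Type*} [CommRing R] [IsDedekindDomain R]
    (m : Multiset (HeightOneSpectrum R)) : (m.map HeightOneSpectrum.asIdeal).prod ≠ ⊥ := by
  intro h
  have h' := Multiset.prod_eq_zero_iff.1 h
  obtain ⟨P, -, hP⟩ := Multiset.mem_map.1 h'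
  exact P.ne_bot hP

lemma prod_asIdeal_bijective (R : Type*) [CommRing R] [IsDedekindDomain R] :
    Function.Bijective (fun m : Multiset (HeightOneSpectrum R) =>
      (⟨(m.map HeightOneSpectrum.asIdeal).prod, prod_asIdeal_ne_bot m⟩ : {I : Ideal R // I ≠ ⊥})) := by
  constructor
  · intro a b h
    have h := congrArg Subtype.val h
    simp only at h
    have key : ∀ c : Multiset (HeightOneSpectrum R), UniqueFactorizationMonoid.normalizedFactors
        (c.map HeightOneSpectrum.asIdeal).prod = c.map HeightOneSpectrum.asIdeal := fun c =>
      UniqueFactorizationMonoid.normalizedFactors_prod_of_prime (by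
        intro p hp
        obtain ⟨P, -, rfl⟩ := Multiset.mem_map.1 hp
        exact P.prime)
    have := key a
    rw [h, key b] at this
    exact (Multiset.map_injective (fun _ _ => HeightOneSpectrum.ext) this).symm
  · rintro ⟨I, hI⟩
    refine ⟨(UniqueFactorizationMonoid.normalizedFactors I).pmap
      (fun p (hp : p.IsPrime ∧ p ≠ ⊥) => (⟨p, hp.1, hp.2⟩ : HeightOneSpectrum R)) ?_, ?_⟩
    · intro p hp
      have := UniqueFactorizationMonoid.prime_of_normalized_factor p hp
      exact ⟨Ideal.isPrime_of_prime this, this.ne_zero⟩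
    · ext1
      simp only [Multiset.map_pmap, Multiset.pmap_eq_map, Multiset.map_id']
      exact Ideal.prod_normalizedFactors_eq_self hI

/-- The Euler product of the Dedekind zeta function, as an extended nonnegative real. -/
noncomputable def eulerZeta (F : Type*) [Field F] [NumberField F] (s : ℝ) : ℝ≥0∞ :=
  multisetSum fun P : HeightOneSpectrum (𝓞 F) => normTerm F s P.asIdeal

lemma eulerZeta_eq_tsum_ideal (F : Type*) [Field F] [NumberField F] {s : ℝ} (hs : s ≠ 0) :
    eulerZeta F s = ∑' I : Ideal (𝓞 F), normTerm F s I := by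
  have h1 : eulerZeta F s = ∑' I : {I : Ideal (𝓞 F) // I ≠ ⊥}, normTerm F s I := by
    rw [← (Equiv.ofBijective _ (prod_asIdeal_bijective (𝓞 F))).tsum_eq]
    exact tsum_congr fun m => normTerm_multiset_prod s m
  rw [h1]
  refine tsum_subtype_eq_of_support_subset (s := {I : Ideal (𝓞 F) | I ≠ ⊥}) ?_
  intro I hI hI'
  exact hI (by rw [hI']; exact normTerm_bot hs)

lemma eulerZeta_eq_tsum_nat (F : Type*) [Field F] [NumberField F] {s : ℝ} (hs : s ≠ 0) :
    eulerZeta F s = ∑' n : ℕ, ENNReal.ofReal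
      (Nat.card {I : Ideal (𝓞 F) // Ideal.absNorm I = n} * (n : ℝ) ^ (-s)) := by
  rw [eulerZeta_eq_tsum_ideal F hs, ← (Equiv.sigmaFiberEquiv
    (fun I : Ideal (𝓞 F) => Ideal.absNorm I)).tsum_eq, ENNReal.tsum_sigma']
  refine tsum_congr fun n => ?_
  have : Finite {I : Ideal (𝓞 F) // Ideal.absNorm I = n} :=
    Ideal.finite_setOfPred_absNorm_eq n
  have := Fintype.ofFinite {I : Ideal (𝓞 F) // Ideal.absNorm I = n}
  rw [tsum_congr (g := fun _ => ENNReal.ofReal ((n : ℝ) ^ (-s)))]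
  · rw [tsum_fintype, Finset.sum_const, Finset.card_univ, Nat.card_eq_fintype_card, nsmul_eq_mul,
      ENNReal.ofReal_mul (by positivity), ENNReal.ofReal_natCast]
  · rintro ⟨I, hI⟩
    simp [normTerm, hI]

lemma dedekindZeta_ofReal (F : Type*) [Field F] [NumberField F] {s : ℝ} (hs : s ≠ 0) :
    dedekindZeta F s = ((∑' n : ℕ,
      (Nat.card {I : Ideal (𝓞 F) // Ideal.absNorm I = n} * (n : ℝ) ^ (-s)) : ℝ) : ℂ) := by
  rw [dedekindZeta, LSeries, Complex.ofReal_tsum]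
  refine tsum_congr fun n => ?_
  rcases eq_or_ne n 0 with rfl | hn
  · simp [Real.zero_rpow (neg_ne_zero.2 hs)]
  · rw [LSeries.term_of_ne_zero hn, Real.rpow_neg (by positivity), Complex.ofReal_mul,
      Complex.ofReal_inv, Complex.ofReal_cpow (by positivity), div_eq_mul_inv]
    simp

lemma exists_tendsto_eulerZeta (F : Type*) [Field F] [NumberField F] :
    ∃ ρ : ℝ, 0 < ρ ∧ Tendsto (fun s : ℝ => ENNReal.ofReal (s - 1) * eulerZeta F s) (𝓝[>] 1)
      (𝓝 (ENNReal.ofReal ρ)) := by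
  refine ⟨dedekindZeta_residue F, dedekindZeta_residue_pos F, ?_⟩
  set z : ℝ → ℝ := fun s => ∑' n : ℕ,
      (Nat.card {I : Ideal (𝓞 F) // Ideal.absNorm I = n} * (n : ℝ) ^ (-s)) with hz
  have hpos : ∀ᶠ s : ℝ in 𝓝[>] 1, 1 < s := self_mem_nhdsWithin
  have ht : Tendsto (fun s : ℝ => (s - 1) * z s) (𝓝[>] 1) (𝓝 (dedekindZeta_residue F)) := by
    have := (Complex.continuous_re.tendsto _).comp (tendsto_sub_one_mul_dedekindZeta_nhdsGT F)
    rw [Complex.ofReal_re] at this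
    refine this.congr' ?_
    filter_upwards [hpos] with s hs
    rw [Function.comp_apply, dedekindZeta_ofReal F (by linarith), ← Complex.ofReal_one,
      ← Complex.ofReal_sub, ← Complex.ofReal_mul, Complex.ofReal_re]
  have hev := ht.eventually (lt_mem_nhds (dedekindZeta_residue_pos F))
  refine (ENNReal.tendsto_ofReal ht).congr' ?_
  filter_upwards [hev, hpos] with s h1 h2
  rw [ENNReal.ofReal_mul (by linarith), eulerZeta_eq_tsum_nat F (by linarith),
    ENNReal.ofReal_tsum_of_nonneg (fun n => by positivity)]
  by_contra h
  rw [hz] at h1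
  simp only [tsum_eq_zero_of_not_summable h, mul_zero, lt_irrefl] at h1

lemma normTerm_one_lt_one {F : Type*} [Field F] [NumberField F] (P : HeightOneSpectrum (𝓞 F)) :
    normTerm F 1 P.asIdeal < 1 := by
  rw [normTerm, ENNReal.ofReal_lt_one, Real.rpow_neg (by positivity), Real.rpow_one]
  exact inv_lt_one_of_one_lt₀ (by exact_mod_cast NumberField.HeightOneSpectrum.one_lt_absNorm P)

lemma normTerm_anti {F : Type*} [Field F] [NumberField F] (P : HeightOneSpectrum (𝓞 F)) {s t : ℝ}
    (h : s ≤ t) : normTerm F t P.asIdeal ≤ normTerm F s P.asIdeal := by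
  refine ENNReal.ofReal_le_ofReal (Real.rpow_le_rpow_of_exponent_le ?_ (by linarith))
  exact_mod_cast (NumberField.HeightOneSpectrum.one_lt_absNorm P).le

lemma normTerm_congr {F F' : Type*} [Field F] [NumberField F] [Field F'] [NumberField F'] (s : ℝ)
    {I : Ideal (𝓞 F)} {J : Ideal (𝓞 F')} (h : Ideal.absNorm I = Ideal.absNorm J) :
    normTerm F s I = normTerm F' s J := by
  rw [normTerm, normTerm, h]

/-- Two disjoint norm-preserving copies of almost all primes of `L` cannot be embedded in the set
of primes of a number field `M`. -/
lemma not_exists_two_copies {L M : Type*} [Field L] [NumberField L] [Field M] [NumberField M]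
    (G : Set (HeightOneSpectrum (𝓞 L)))
    (hG : ∑' P : ↥Gᶜ, normTerm L 1 (P : HeightOneSpectrum (𝓞 L)).asIdeal ≠ ⊤)
    (f : G ⊕ G → HeightOneSpectrum (𝓞 M)) (hf : Function.Injective f)
    (hN : ∀ x, Ideal.absNorm (f x).asIdeal =
      Ideal.absNorm (Sum.elim Subtype.val Subtype.val x : HeightOneSpectrum (𝓞 L)).asIdeal) : False := by
  set C := multisetSum fun P : ↥Gᶜ => normTerm L 1 (P : HeightOneSpectrum (𝓞 L)).asIdeal with hC
  have hCtop : C ≠ ⊤ := multisetSum_ne_top (fun P => normTerm_one_lt_one _) hG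
  have key : ∀ s : ℝ, 1 < s → eulerZeta L s ^ 2 ≤ C ^ 2 * eulerZeta M s := by
    intro s hs
    have h1 : eulerZeta L s ≤
        (multisetSum fun P : G => normTerm L s (P : HeightOneSpectrum (𝓞 L)).asIdeal) * C := by
      rw [eulerZeta, multisetSum_eq_mul_compl _ G]
      exact mul_le_mul' le_rfl (multisetSum_mono fun P => normTerm_anti _ hs.le)
    have h2 : (multisetSum fun P : G => normTerm L s (P : HeightOneSpectrum (𝓞 L)).asIdeal) ^ 2 ≤
        eulerZeta M s := by
      have h3 := multisetSum_sum (fun x : G ⊕ G =>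
        normTerm L s (Sum.elim Subtype.val Subtype.val x : HeightOneSpectrum (𝓞 L)).asIdeal)
      rw [sq]
      refine h3.symm.le.trans (multisetSum_le_of_injective f hf fun x => ?_)
      exact normTerm_congr s (hN x).symm
    calc eulerZeta L s ^ 2 ≤ (_ * C) ^ 2 := pow_le_pow_left' h1 2
      _ = C ^ 2 * _ ^ 2 := by rw [mul_pow, mul_comm]
      _ ≤ _ := mul_le_mul' le_rfl h2
  obtain ⟨ρ, hρ, hL⟩ := exists_tendsto_eulerZeta L
  obtain ⟨ρ', hρ', hM⟩ := exists_tendsto_eulerZeta M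
  have hs0 : Tendsto (fun s : ℝ => ENNReal.ofReal (s - 1)) (𝓝[>] 1) (𝓝 0) := by
    have : Tendsto (fun s : ℝ => s - 1) (𝓝[>] 1) (𝓝 (1 - 1)) :=
      ((continuous_id.sub continuous_const).tendsto 1).mono_left nhdsWithin_le_nhds
    simpa using ENNReal.tendsto_ofReal this
  have hl : Tendsto (fun s : ℝ => (ENNReal.ofReal (s - 1) * eulerZeta L s) ^ 2) (𝓝[>] 1)
      (𝓝 (ENNReal.ofReal ρ ^ 2)) := ((ENNReal.continuous_pow 2).tendsto _).comp hL
  have hr : Tendsto (fun s : ℝ => C ^ 2 * (ENNReal.ofReal (s - 1) *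
      (ENNReal.ofReal (s - 1) * eulerZeta M s))) (𝓝[>] 1)
      (𝓝 (C ^ 2 * (0 * ENNReal.ofReal ρ'))) := by
    refine ENNReal.Tendsto.const_mul (ENNReal.Tendsto.mul hs0 ?_ hM ?_) ?_
    · exact Or.inr ENNReal.ofReal_ne_top
    · exact Or.inr ENNReal.zero_ne_top
    · exact Or.inr (ENNReal.pow_ne_top hCtop)
  have := le_of_tendsto_of_tendsto hl hr (by
    filter_upwards [self_mem_nhdsWithin] with s hs
    calc _ = ENNReal.ofReal (s - 1) ^ 2 * eulerZeta L s ^ 2 := mul_pow _ _ _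
      _ ≤ ENNReal.ofReal (s - 1) ^ 2 * (C ^ 2 * eulerZeta M s) := mul_le_mul' le_rfl (key s hs)
      _ = _ := by ring)
  simp only [zero_mul, mul_zero, nonpos_iff_eq_zero] at this
  simp [not_le.2 hρ] at this

lemma card_le_finrank_of_natCast_mem {F : Type*} [Field F] [NumberField F] {p : ℕ} (hp : p.Prime)
    (s : Finset (HeightOneSpectrum (𝓞 F))) (hs : ∀ P ∈ s, (p : 𝓞 F) ∈ P.asIdeal) :
    s.card ≤ Module.finrank ℤ (𝓞 F) := by
  classical
  have h1 : ∏ P ∈ s, P.asIdeal ∣ Ideal.span {(p : 𝓞 F)} := by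
    rw [← Finset.prod_image (f := fun I => I) (g := HeightOneSpectrum.asIdeal)
      fun P _ Q _ h => HeightOneSpectrum.ext h]
    refine Finset.prod_primes_dvd _ ?_ ?_
    · intro I hI
      obtain ⟨P, -, rfl⟩ := Finset.mem_image.1 hI
      exact P.prime
    · intro I hI
      obtain ⟨P, hP, rfl⟩ := Finset.mem_image.1 hI
      exact Ideal.dvd_span_singleton.2 (hs P hP)
  have h2 := Ideal.absNorm_dvd_absNorm_of_le (Ideal.dvd_iff_le.1 h1)
  rw [Ideal.absNorm_span_natCast, map_prod] at h2
  have h3 : p ^ s.card ∣ ∏ P ∈ s, Ideal.absNorm P.asIdeal := by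
    rw [← Finset.prod_const]
    refine Finset.prod_dvd_prod_of_dvd _ _ fun P hP => ?_
    have h4 := Ideal.absNorm_dvd_absNorm_of_le
      (Ideal.dvd_iff_le.1 (Ideal.dvd_span_singleton.2 (hs P hP)))
    rw [Ideal.absNorm_span_natCast] at h4
    obtain ⟨k, -, hk⟩ := (Nat.dvd_prime_pow hp).1 h4
    rw [hk]
    refine dvd_pow_self p ?_
    rintro rfl
    exact (NumberField.HeightOneSpectrum.one_lt_absNorm P).ne' hk
  exact (Nat.pow_dvd_pow_iff_le_right hp.one_lt).1 (h3.trans h2)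

lemma tsum_normTerm_ne_top {F : Type*} [Field F] [NumberField F]
    (S : Set (HeightOneSpectrum (𝓞 F))) (hS : ∀ P ∈ S, ¬ (Ideal.absNorm P.asIdeal).Prime) :
    ∑' P : S, normTerm F 1 (P : HeightOneSpectrum (𝓞 F)).asIdeal ≠ ⊤ := by
  set d := Module.finrank ℤ (𝓞 F)
  rw [← (Equiv.sigmaFiberEquiv (fun P : S =>
    (Ideal.absNorm (P : HeightOneSpectrum (𝓞 F)).asIdeal).minFac)).tsum_eq, ENNReal.tsum_sigma']
  have key : ∀ n : ℕ, ∑' P : {P : S // (Ideal.absNorm (P : HeightOneSpectrum (𝓞 F)).asIdeal).minFac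
      = n}, normTerm F 1 (P : HeightOneSpectrum (𝓞 F)).asIdeal ≤
      d * ENNReal.ofReal (1 / (n : ℝ) ^ 2) := by
    intro n
    rw [ENNReal.tsum_eq_iSup_sum]
    refine iSup_le fun s => ?_
    have hmem : ∀ P : {P : S // (Ideal.absNorm (P : HeightOneSpectrum (𝓞 F)).asIdeal).minFac
      = n}, n.Prime ∧ (n : 𝓞 F) ∈ (P : HeightOneSpectrum (𝓞 F)).asIdeal ∧
        normTerm F 1 (P : HeightOneSpectrum (𝓞 F)).asIdeal ≤ ENNReal.ofReal (1 / (n : ℝ) ^ 2) := by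
      rintro ⟨⟨P, hP⟩, hn⟩
      have := P.isMaximal
      obtain ⟨p, k, hk, hpP, hp, hN⟩ := Ideal.exists_prime_and_absNorm_eq_pow P.asIdeal
      simp only [hN, hp.pow_minFac hk.ne'] at hn
      subst hn
      refine ⟨hp, hpP, ENNReal.ofReal_le_ofReal ?_⟩
      have hk2 : 2 ≤ k := by
        by_contra h
        obtain rfl : k = 1 := by omega
        exact hS P hP (by rw [hN, pow_one]; exact hp)
      rw [hN, Real.rpow_neg (by positivity), Real.rpow_one, one_div]
      refine inv_anti₀ (by have := hp.pos; positivity) ?_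
      exact_mod_cast Nat.pow_le_pow_right hp.pos hk2
    rcases s.eq_empty_or_nonempty with rfl | ⟨P₀, hP₀⟩
    · simp
    refine (Finset.sum_le_card_nsmul _ _ _ fun P _ => (hmem P).2.2).trans ?_
    rw [nsmul_eq_mul]
    refine mul_le_mul' ?_ le_rfl
    have := card_le_finrank_of_natCast_mem (F := F) (hmem P₀).1
      (s.map ⟨fun P => P.1.1,
        Subtype.val_injective.comp Subtype.val_injective⟩) (by
          intro P hP
          obtain ⟨Q, -, rfl⟩ := Finset.mem_map.1 hP
          exact (hmem Q).2.1)
    rw [Finset.card_map] at this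
    exact_mod_cast this
  refine ne_top_of_le_ne_top ?_ (ENNReal.tsum_le_tsum key)
  rw [ENNReal.tsum_mul_left, ← ENNReal.ofReal_tsum_of_nonneg (fun n => by positivity)
    (Real.summable_one_div_nat_pow.2 (by norm_num))]
  exact ENNReal.mul_ne_top (ENNReal.natCast_ne_top _) ENNReal.ofReal_ne_top

lemma tsum_normTerm_compl_ne_top {F : Type*} [Field F] [NumberField F] (N : ℕ)
    (G : Set (HeightOneSpectrum (𝓞 F)))
    (hG : ∀ P : HeightOneSpectrum (𝓞 F), (Ideal.absNorm P.asIdeal).Prime →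
      N < Ideal.absNorm P.asIdeal → P ∈ G) :
    ∑' P : ↥Gᶜ, normTerm F 1 (P : HeightOneSpectrum (𝓞 F)).asIdeal ≠ ⊤ := by
  set S := {P : HeightOneSpectrum (𝓞 F) | ¬ (Ideal.absNorm P.asIdeal).Prime}
  set T := {P : HeightOneSpectrum (𝓞 F) | Ideal.absNorm P.asIdeal ≤ N}
  have hT : T.Finite := Ring.HasFiniteQuotients.finite_absNorm_heightOneSpectrum_le N
  have := hT.fintype
  have hsub : Gᶜ ⊆ S ∪ T := by
    intro P hP
    by_contra h
    simp only [Set.mem_union, not_or, S, T, Set.mem_ofPred_eq, not_not, not_le] at h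
    exact hP (hG P h.1 h.2)
  refine ne_top_of_le_ne_top ?_ (ENNReal.tsum_mono_subtype
    (fun P : HeightOneSpectrum (𝓞 F) => normTerm F 1 P.asIdeal) hsub)
  refine ne_top_of_le_ne_top ?_ (ENNReal.tsum_union_le
    (fun P : HeightOneSpectrum (𝓞 F) => normTerm F 1 P.asIdeal) S T)
  refine ENNReal.add_ne_top.2 ⟨tsum_normTerm_ne_top S fun P hP => hP, ?_⟩
  rw [tsum_fintype]
  exact ENNReal.sum_ne_top.2 fun P _ => ENNReal.ofReal_ne_top

lemma norm_le_one_of_isIntegral {p : ℕ} [Fact p.Prime] {x : ℚ_[p]} (hx : IsIntegral ℤ x) :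
    ‖x‖ ≤ 1 := by
  have h : IsIntegral ℤ_[p] x := hx.tower_top
  obtain ⟨y, rfl⟩ := IsIntegrallyClosed.isIntegral_iff.1 h
  exact y.2

lemma norm_map_le_one {F : Type*} [Field F] {p : ℕ} [Fact p.Prime] (σ : F →+* ℚ_[p]) (x : 𝓞 F) :
    ‖σ x‖ ≤ 1 :=
  norm_le_one_of_isIntegral (map_isIntegral_int σ x.2)

lemma norm_intCast_eq_one {p : ℕ} [hp : Fact p.Prime] {n : ℤ} (hn : n ≠ 0) (h : n.natAbs < p) :
    ‖(n : ℚ_[p])‖ = 1 := by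
  refine le_antisymm (Padic.norm_int_le_one n) (not_lt.1 fun hlt => ?_)
  rw [Padic.norm_intCast_lt_one_iff] at hlt
  exact absurd (Nat.le_of_dvd (Int.natAbs_pos.2 hn) (Int.natCast_dvd.1 hlt)) (not_le.2 h)

lemma exists_norm_map_le_one {F : Type*} [Field F] [NumberField F] (x : F) :
    ∃ N : ℕ, ∀ (p : ℕ) (_ : Fact p.Prime) (σ : F →+* ℚ_[p]), N < p → ‖σ x‖ ≤ 1 := by
  obtain ⟨n, hn, hx⟩ := IsAlgebraic.exists_integral_multiple
    ((IsFractionRing.isAlgebraic_iff ℤ ℚ F).2 (.of_finite ℚ x))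
  refine ⟨n.natAbs, fun p _ σ hp => ?_⟩
  have h1 := norm_map_le_one σ ⟨n • x, hx⟩
  simpa [norm_intCast_eq_one hn hp] using h1

lemma exists_norm_map_eq_one {F : Type*} [Field F] [NumberField F] {x : F} (hx : x ≠ 0) :
    ∃ N : ℕ, ∀ (p : ℕ) (_ : Fact p.Prime) (σ : F →+* ℚ_[p]), N < p → ‖σ x‖ = 1 := by
  obtain ⟨N, hN⟩ := exists_norm_map_le_one x
  obtain ⟨N', hN'⟩ := exists_norm_map_le_one x⁻¹
  refine ⟨max N N', fun p _ σ hp => le_antisymm (hN p _ σ ((le_max_left _ _).trans_lt hp)) ?_⟩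
  have h := hN' p _ σ ((le_max_right _ _).trans_lt hp)
  rw [map_inv₀, norm_inv] at h
  exact (inv_le_one₀ (norm_pos_iff.2 ((map_ne_zero σ).2 hx))).1 h

/-- The restriction of an embedding into the `p`-adic numbers to the ring of integers. -/
noncomputable def padicIntHom {F : Type*} [Field F] {p : ℕ} [Fact p.Prime] (σ : F →+* ℚ_[p]) :
    𝓞 F →+* ℤ_[p] :=
  (σ.comp (algebraMap (𝓞 F) F)).codRestrict (PadicInt.subring p) (norm_map_le_one σ)

lemma coe_padicIntHom {F : Type*} [Field F] {p : ℕ} [Fact p.Prime] (σ : F →+* ℚ_[p]) (x : 𝓞 F) :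
    (padicIntHom σ x : ℚ_[p]) = σ x := rfl

lemma mem_ker_toZMod_comp {F : Type*} [Field F] {p : ℕ} [Fact p.Prime] (σ : F →+* ℚ_[p])
    (x : 𝓞 F) : x ∈ RingHom.ker (PadicInt.toZMod.comp (padicIntHom σ)) ↔ ‖σ x‖ < 1 := by
  rw [RingHom.mem_ker, RingHom.comp_apply, ← RingHom.mem_ker, PadicInt.ker_toZMod,
    IsLocalRing.mem_maximalIdeal, PadicInt.mem_nonunits, PadicInt.norm_def, coe_padicIntHom]

/-- The prime of the ring of integers cut out by an embedding into the `p`-adic numbers. -/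
noncomputable def primeOfHom {F : Type*} [Field F] [NumberField F] {p : ℕ} [hp : Fact p.Prime]
    (σ : F →+* ℚ_[p]) : HeightOneSpectrum (𝓞 F) where
  asIdeal := RingHom.ker (PadicInt.toZMod.comp (padicIntHom σ))
  isPrime := RingHom.ker_isPrime _
  ne_bot := by
    intro h
    have h1 : ((p : ℕ) : 𝓞 F) ∈ RingHom.ker (PadicInt.toZMod.comp (padicIntHom σ)) := by
      simp [RingHom.mem_ker]
    rw [h, Ideal.mem_bot] at h1
    exact hp.1.ne_zero (by exact_mod_cast h1)

lemma mem_primeOfHom {F : Type*} [Field F] [NumberField F] {p : ℕ} [Fact p.Prime]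
    (σ : F →+* ℚ_[p]) (x : 𝓞 F) : x ∈ (primeOfHom σ).asIdeal ↔ ‖σ x‖ < 1 :=
  mem_ker_toZMod_comp σ x

lemma absNorm_primeOfHom {F : Type*} [Field F] [NumberField F] {p : ℕ} [Fact p.Prime]
    (σ : F →+* ℚ_[p]) : Ideal.absNorm (primeOfHom σ).asIdeal = p := by
  have e := RingHom.quotientKerEquivOfSurjective
    (f := (PadicInt.toZMod (p := p)).comp (padicIntHom σ)) (ZMod.ringHom_surjective _)
  rw [Ideal.absNorm_apply, Submodule.cardQuot_apply]
  exact (Nat.card_congr e.toEquiv).trans (Nat.card_zmod p)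

lemma exists_powerBasis_isIntegral (F : Type*) [Field F] [NumberField F] :
    ∃ B : PowerBasis ℚ F, IsIntegral ℤ B.gen := by
  obtain ⟨α, hα⟩ := Field.exists_primitive_element ℚ F
  obtain ⟨n, hn, hβ⟩ := IsAlgebraic.exists_integral_multiple
    ((IsFractionRing.isAlgebraic_iff ℤ ℚ F).2 (.of_finite ℚ α))
  have h_int : IsIntegral ℚ (n • α) := hβ.tower_top
  have htop : Algebra.adjoin ℚ ({n • α} : Set F) = ⊤ := by
    rw [eq_top_iff]
    have h1 : Algebra.adjoin ℚ ({α} : Set F) = ⊤ := by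
      rw [← IntermediateField.adjoin_simple_toSubalgebra_of_isAlgebraic
        (Algebra.IsAlgebraic.isAlgebraic (R := ℚ) α), hα]
      rfl
    rw [← h1]
    refine Algebra.adjoin_le (Set.singleton_subset_iff.2 ?_)
    have h2 : α = (n : ℚ)⁻¹ • n • α := by
      rw [← Int.cast_smul_eq_zsmul ℚ n α, smul_smul, inv_mul_cancel₀ (by exact_mod_cast hn),
        one_smul]
    have h3 : (n : ℚ)⁻¹ • n • α ∈ Algebra.adjoin ℚ ({n • α} : Set F) :=
      Subalgebra.smul_mem _ (Algebra.self_mem_adjoin_singleton ℚ _) _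
    rwa [← h2] at h3
  exact ⟨PowerBasis.ofAdjoinEqTop h_int htop, by rwa [PowerBasis.ofAdjoinEqTop_gen]⟩

lemma exists_intCast_sub_mem {F : Type*} [Field F] [NumberField F] (P : HeightOneSpectrum (𝓞 F))
    (hP : (Ideal.absNorm P.asIdeal).Prime) (x : 𝓞 F) : ∃ m : ℤ, x - m ∈ P.asIdeal := by
  have hcard : Nat.card (𝓞 F ⧸ P.asIdeal) = Ideal.absNorm P.asIdeal := rfl
  have : Finite (𝓞 F ⧸ P.asIdeal) := Nat.finite_of_card_ne_zero (by rw [hcard]; exact hP.ne_zero)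
  have := Fintype.ofFinite (𝓞 F ⧸ P.asIdeal)
  let e := ZMod.ringEquivOfPrime (𝓞 F ⧸ P.asIdeal) hP (by rw [← hcard, Nat.card_eq_fintype_card])
  obtain ⟨m, hm⟩ := ZMod.intCast_surjective (e.symm (Ideal.Quotient.mk _ x))
  refine ⟨m, ?_⟩
  rw [← Ideal.Quotient.eq, ← e.apply_symm_apply (Ideal.Quotient.mk _ x), ← hm]
  simp

lemma aeval_intCast_eq {R : Type*} [CommRing R] (m : ℤ) (h : Polynomial ℤ) :
    Polynomial.aeval (m : R) h = ((h.eval m : ℤ) : R) := by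
  simpa using Polynomial.aeval_algebraMap_apply_eq_algebraMap_eval (A := R) m h

lemma sub_dvd_aeval_sub {R : Type*} [CommRing R] (x y : R) (h : Polynomial ℤ) :
    x - y ∣ Polynomial.aeval x h - Polynomial.aeval y h := by
  simpa [Polynomial.aeval_def, Polynomial.eval₂_eq_eval_map] using
    Polynomial.sub_dvd_eval_sub x y (h.map (algebraMap ℤ R))

lemma exists_hom_of_absNorm_prime (F : Type*) [Field F] [NumberField F] :
    ∃ N : ℕ, ∀ P : HeightOneSpectrum (𝓞 F), (Ideal.absNorm P.asIdeal).Prime →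
      N < Ideal.absNorm P.asIdeal → ∃ (_ : Fact (Ideal.absNorm P.asIdeal).Prime)
        (σ : F →+* ℚ_[Ideal.absNorm P.asIdeal]), primeOfHom σ = P := by
  obtain ⟨B, hB⟩ := exists_powerBasis_isIntegral F
  obtain ⟨β, hβ⟩ : ∃ β : 𝓞 F, (β : F) = B.gen := ⟨⟨B.gen, hB⟩, rfl⟩
  obtain ⟨D, hD⟩ : ∃ D : ℤ, (D : ℚ) = Algebra.discr ℚ B.basis := by
    refine IsIntegrallyClosed.isIntegral_iff.1 (Algebra.discr_isIntegral ℚ fun i => ?_)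
    rw [PowerBasis.basis_eq_pow]
    exact hB.pow _
  have hD0 : D ≠ 0 := by
    rintro rfl
    exact Algebra.discr_not_zero_of_basis ℚ B.basis (by rw [← hD]; simp)
  have hadj : ∀ x : 𝓞 F, ∃ h : Polynomial ℤ, D • x = Polynomial.aeval β h := by
    intro x
    have h1 := Algebra.discr_mul_isIntegral_mem_adjoin ℚ hB x.2
    rw [← hD, Algebra.adjoin_singleton_eq_range_aeval] at h1
    obtain ⟨h, hh⟩ := h1
    refine ⟨h, ?_⟩
    apply RingOfIntegers.ext
    have h2 : algebraMap (𝓞 F) F (Polynomial.aeval β h) = Polynomial.aeval B.gen h := by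
      rw [← hβ, Polynomial.aeval_algebraMap_apply]
    refine Eq.trans ?_ (hh.symm.trans h2.symm)
    simp only [zsmul_eq_mul, Int.cast_smul_eq_zsmul, map_mul, map_intCast]
    rfl
  set g := minpoly ℤ β with hg
  have hgβ : Polynomial.aeval β g = 0 := minpoly.aeval ℤ β
  have hgQ : g.map (algebraMap ℤ ℚ) = minpoly ℚ B.gen := by
    rw [minpoly.isIntegrallyClosed_eq_field_fractions' ℚ hB, hg, ← hβ,
      minpoly.algebraMap_eq RingOfIntegers.coe_injective]
  set y : 𝓞 F := Polynomial.aeval β g.derivative with hy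
  have hy0 : y ≠ 0 := by
    intro h0
    have h1 := (Algebra.IsSeparable.isSeparable ℚ B.gen).aeval_derivative_ne_zero
      (minpoly.aeval ℚ B.gen)
    rw [← hgQ, Polynomial.derivative_map, Polynomial.aeval_map_algebraMap, ← hβ] at h1
    refine h1 ((Polynomial.aeval_algebraMap_apply F β g.derivative).trans ?_)
    rw [← hy, h0, map_zero]
  refine ⟨max D.natAbs (Ideal.absNorm (Ideal.span {y})), fun P hP hN => ⟨⟨hP⟩, ?_⟩⟩
  have : Fact (Ideal.absNorm P.asIdeal).Prime := ⟨hP⟩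
  have hpmem : ((Ideal.absNorm P.asIdeal : ℕ) : 𝓞 F) ∈ P.asIdeal := Ideal.absNorm_mem _
  set p := Ideal.absNorm P.asIdeal with hp
  obtain ⟨m, hm⟩ := exists_intCast_sub_mem P hP β
  have h_int : ∀ k : ℤ, (k : 𝓞 F) ∈ P.asIdeal ↔ ‖(k : ℤ_[p])‖ < 1 := by
    intro k
    rw [PadicInt.norm_int_lt_one_iff_dvd]
    constructor
    · intro hk
      by_contra hdvd
      obtain ⟨a, c, hac⟩ := (Nat.prime_iff_prime_int.1 hP).irreducible.coprime_iff_not_dvd.2 hdvd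
      refine P.isPrime.ne_top ((Ideal.eq_top_iff_one _).2 ?_)
      have h1 := congrArg (Int.cast : ℤ → 𝓞 F) hac
      push_cast at h1
      rw [← h1]
      exact P.asIdeal.add_mem (P.asIdeal.mul_mem_left _ hpmem) (P.asIdeal.mul_mem_left _ hk)
    · rintro ⟨c, rfl⟩
      push_cast
      exact P.asIdeal.mul_mem_right _ hpmem
  have heval : ∀ h : Polynomial ℤ, Polynomial.aeval β h ∈ P.asIdeal ↔
      ‖Polynomial.aeval (m : ℤ_[p]) h‖ < 1 := by
    intro h
    have h1 : Polynomial.aeval β h - ((h.eval m : ℤ) : 𝓞 F) ∈ P.asIdeal := by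
      rw [← aeval_intCast_eq]
      exact Ideal.mem_of_dvd _ (sub_dvd_aeval_sub _ _ h) hm
    rw [aeval_intCast_eq, ← h_int]
    exact ⟨fun h2 => (Submodule.sub_mem_iff_right _ h2).1 h1,
      fun h2 => (Submodule.sub_mem_iff_left _ h2).1 h1⟩
  have hyP : ‖Polynomial.aeval (m : ℤ_[p]) g.derivative‖ = 1 := by
    refine le_antisymm (PadicInt.norm_le_one _) (not_lt.1 fun hlt => ?_)
    rw [← heval] at hlt
    have h1 := Ideal.absNorm_dvd_absNorm_of_le ((Ideal.span_singleton_le_iff_mem _).2 hlt)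
    have h2 := Nat.le_of_dvd (Nat.pos_of_ne_zero
      (by simpa [Ideal.absNorm_eq_zero_iff] using hy0)) h1
    exact absurd hN (not_lt.2 (h2.trans (le_max_right _ _)))
  obtain ⟨b, hb, hbm, -, -⟩ := hensels_lemma (F := g) (a := (m : ℤ_[p])) (by
    rw [hyP, one_pow, ← heval, hgβ]
    exact P.asIdeal.zero_mem)
  rw [hyP] at hbm
  let σ : F →ₐ[ℚ] ℚ_[p] := B.lift (b : ℚ_[p]) (by
    rw [← hgQ, Polynomial.aeval_map_algebraMap]
    refine (Polynomial.aeval_algebraMap_apply ℚ_[p] b g).trans ?_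
    rw [hb, map_zero])
  refine ⟨σ, ?_⟩
  have hle : P.asIdeal ≤ (primeOfHom (σ : F →+* ℚ_[p])).asIdeal := by
    intro x hx
    rw [mem_primeOfHom]
    obtain ⟨h, hh⟩ := hadj x
    have h1 : ‖Polynomial.aeval b h‖ < 1 := by
      have h2 : Polynomial.aeval β h ∈ P.asIdeal := by
        rw [← hh]
        exact Submodule.smul_of_tower_mem _ D hx
      rw [heval, ← PadicInt.mem_nonunits] at h2
      rw [← PadicInt.mem_nonunits, ← IsLocalRing.mem_maximalIdeal]
      refine (Submodule.sub_mem_iff_left _ ((IsLocalRing.mem_maximalIdeal _).2 h2)).1 ?_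
      refine Ideal.mem_of_dvd _ (sub_dvd_aeval_sub _ _ h) ?_
      rwa [IsLocalRing.mem_maximalIdeal, PadicInt.mem_nonunits]
    have h3 : σ (β : F) = b := by rw [hβ]; exact B.lift_gen _ _
    have h4 : (D : ℚ_[p]) * σ x = (Polynomial.aeval b h : ℤ_[p]) := by
      have h5 := congrArg (fun z : 𝓞 F => σ z) hh
      have h6 : σ (Polynomial.aeval β h : 𝓞 F) = Polynomial.aeval (b : ℚ_[p]) h := by
        rw [← h3]
        have h7 : ((Polynomial.aeval β h : 𝓞 F) : F) = Polynomial.aeval (β : F) h :=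
          (Polynomial.aeval_algebraMap_apply F β h).symm
        rw [h7]
        exact (Polynomial.aeval_algHom_apply (σ.restrictScalars ℤ) (β : F) h).symm
      have h8 : Polynomial.aeval (b : ℚ_[p]) h = (Polynomial.aeval b h : ℤ_[p]) :=
        Polynomial.aeval_algebraMap_apply ℚ_[p] b h
      rw [← h8, ← h6, ← h5]
      simp
    have h9 := congrArg norm h4
    rw [norm_mul, norm_intCast_eq_one hD0 ((le_max_left _ _).trans_lt hN), one_mul] at h9
    refine lt_of_eq_of_lt h9 h1
  exact HeightOneSpectrum.ext ((P.isMaximal.eq_of_le (primeOfHom _).isPrime.ne_top hle).symm)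

/-- A number field containing a square root `s` of a nonsquare `δ`, such that homomorphisms extend
along every choice of image of `s`. -/
lemma exists_numberField_sqrt.{u} {L : Type u} [Field L] [NumberField L] {δ : L} (hδ : ¬ IsSquare δ) :
    ∃ (M : Type u) (_ : Field M) (_ : NumberField M) (i : L →+* M) (s : M), s ≠ 0 ∧
      ∀ (R : Type) [Field R] (σ : L →+* R) (r : R), r * r = σ δ →
        ∃ τ : M →+* R, τ.comp i = σ ∧ τ s = r := by
  have hirr : Irreducible (Polynomial.X ^ 2 - Polynomial.C δ) :=
    X_pow_sub_C_irreducible_of_prime Nat.prime_two fun b hb => hδ ⟨b, by rw [← hb, sq]⟩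
  have := Fact.mk hirr
  have hmon : (Polynomial.X ^ 2 - Polynomial.C δ).Monic :=
    Polynomial.monic_X_pow_sub_C δ two_ne_zero
  have := hmon.finite_adjoinRoot
  have : NumberField (AdjoinRoot (Polynomial.X ^ 2 - Polynomial.C δ)) := .of_module_finite L _
  refine ⟨AdjoinRoot (Polynomial.X ^ 2 - Polynomial.C δ), inferInstance, this, AdjoinRoot.of _,
    AdjoinRoot.root _, ?_, ?_⟩
  · intro h
    have h1 := AdjoinRoot.eval₂_root (Polynomial.X ^ 2 - Polynomial.C δ)
    simp [h] at h1
    exact hδ ⟨0, by simpa using h1⟩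
  · intro R _ σ r hr
    refine ⟨AdjoinRoot.lift σ r (by simp [hr, sq]), ?_, ?_⟩
    · ext x; simp
    · simp

theorem exists_hom_not_isSquare {L : Type*} [Field L] [NumberField L] {δ : L} (hδ : ¬ IsSquare δ)
    (N : ℕ) : ∃ (p : ℕ) (_ : Fact p.Prime) (σ : L →+* ℚ_[p]), N < p ∧ ¬ IsSquare (σ δ) := by
  by_contra! hcon
  obtain ⟨M, _, _, i, s, hs, hlift⟩ := exists_numberField_sqrt hδ
  obtain ⟨n, hn, hns⟩ := IsAlgebraic.exists_integral_multiple
    ((IsFractionRing.isAlgebraic_iff ℤ ℚ M).2 (.of_finite ℚ s))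
  obtain ⟨N₁, hN₁⟩ := exists_norm_map_eq_one (x := 2 * (n • s))
    (mul_ne_zero two_ne_zero (smul_ne_zero hn hs))
  obtain ⟨N₂, hN₂⟩ := exists_hom_of_absNorm_prime L
  let G : Set (HeightOneSpectrum (𝓞 L)) := {P | ∃ (p : ℕ) (_ : Fact p.Prime) (σ : L →+* ℚ_[p]),
    N < p ∧ N₁ < p ∧ primeOfHom σ = P}
  have hG := tsum_normTerm_compl_ne_top (max N (max N₁ N₂)) G (by
    intro P hP hlt
    simp only [max_lt_iff] at hlt
    obtain ⟨hp, σ, hσ⟩ := hN₂ P hP hlt.2.2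
    exact ⟨_, hp, σ, hlt.1, hlt.2.1, hσ⟩)
  have key : ∀ P : G, ∃ (p : ℕ) (_ : Fact p.Prime) (τ₁ τ₂ : M →+* ℚ_[p]), N₁ < p ∧
      τ₁.comp i = τ₂.comp i ∧ primeOfHom (τ₁.comp i) = P ∧ τ₂ s = - τ₁ s := by
    rintro ⟨P, p, hp, σ, hpN, hpN₁, hσ⟩
    obtain ⟨r, hr⟩ := hcon p hp σ hpN
    obtain ⟨τ₁, h1, h1'⟩ := hlift _ σ r hr.symm
    obtain ⟨τ₂, h2, h2'⟩ := hlift _ σ (-r) (by rw [hr, neg_mul_neg])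
    exact ⟨p, hp, τ₁, τ₂, hpN₁, by rw [h1, h2], by rw [h1]; exact hσ, by rw [h1', h2']⟩
  choose p hp τ₁ τ₂ hpN hcomp hprime hneg using key
  let f : G ⊕ G → HeightOneSpectrum (𝓞 M) :=
    Sum.elim (fun P => primeOfHom (τ₁ P)) (fun P => primeOfHom (τ₂ P))
  have hmap : ∀ (P : G) (τ : M →+* ℚ_[p P]), τ.comp i = (τ₁ P).comp i → ∀ x : 𝓞 L,
      x ∈ (P : HeightOneSpectrum (𝓞 L)).asIdeal ↔
        RingOfIntegers.mapRingHom i x ∈ (primeOfHom τ).asIdeal := by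
    intro P τ hτ x
    rw [← hprime P, mem_primeOfHom, mem_primeOfHom, ← hτ]
    rfl
  have hf₁ : ∀ x, ∀ y : 𝓞 L, y ∈ (Sum.elim Subtype.val Subtype.val x :
      HeightOneSpectrum (𝓞 L)).asIdeal ↔ RingOfIntegers.mapRingHom i y ∈ (f x).asIdeal := by
    rintro (P | P) y
    · exact hmap P (τ₁ P) rfl y
    · exact hmap P (τ₂ P) (hcomp P).symm y
  have hf₂ : ∀ P : G, f (Sum.inl P) ≠ f (Sum.inr P) := by
    intro P hP
    set r : ℚ_[p P] := τ₁ P (n • s) with hr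
    have hr1 : ‖r‖ ≤ 1 := norm_map_le_one (τ₁ P) ⟨n • s, hns⟩
    have hr2 : τ₂ P (n • s) = -r := by
      rw [hr, map_zsmul, map_zsmul, hneg, smul_neg]
    have hr3 : ‖2 * r‖ = 1 := by
      have := hN₁ (p P) (hp P) (τ₁ P) (hpN P)
      rwa [map_mul, map_ofNat] at this
    obtain ⟨m, -, hm⟩ := PadicInt.exists_mem_range (⟨r, hr1⟩ : ℤ_[p P])
    rw [IsLocalRing.mem_maximalIdeal, PadicInt.mem_nonunits, PadicInt.norm_def] at hm
    replace hm : ‖r - m‖ < 1 := hm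
    let x : 𝓞 M := ⟨n • s, hns⟩ - (m : 𝓞 M)
    have hx : ∀ τ : M →+* ℚ_[p P], τ x = τ (n • s) - m := by
      intro τ
      have : (x : M) = n • s - (m : M) := (map_sub (algebraMap (𝓞 M) M) _ _).trans (by
        rw [map_natCast]
        rfl)
      rw [this, map_sub, map_natCast]
    have h1 : x ∈ (f (Sum.inl P)).asIdeal := by
      refine (mem_primeOfHom _ _).2 ?_
      rwa [hx]
    rw [hP] at h1
    have h2 := (mem_primeOfHom (τ₂ P) x).1 h1
    rw [hx, hr2] at h2
    have h3 : (2 : ℚ_[p P]) * r = (r - m) - (-r - m) := by ring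
    have h4 := Padic.nonarchimedean (r - (m : ℚ_[p P])) (-(-r - (m : ℚ_[p P])))
    rw [← sub_eq_add_neg, ← h3, hr3, norm_neg] at h4
    exact absurd h4 (not_le.2 (max_lt hm h2))
  refine not_exists_two_copies G hG f ?_ ?_
  · intro x y hxy
    have h1 : (Sum.elim Subtype.val Subtype.val x : HeightOneSpectrum (𝓞 L)) =
        Sum.elim Subtype.val Subtype.val y := by
      ext z
      rw [hf₁, hf₁, hxy]
    rcases x with P | P <;> rcases y with Q | Q <;> obtain rfl := Subtype.ext h1
    · rfl
    · exact absurd hxy (hf₂ P)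
    · exact absurd hxy.symm (hf₂ P)
    · rfl
  · rintro (P | P)
    · simp only [f, Sum.elim_inl]
      rw [absNorm_primeOfHom, ← hprime P, absNorm_primeOfHom]
    · simp only [f, Sum.elim_inr]
      rw [absNorm_primeOfHom, ← hprime P, absNorm_primeOfHom]

lemma isSquare_of_norm_sub_one_lt {p : ℕ} [hp : Fact p.Prime] (hp2 : p ≠ 2) {t : ℚ_[p]}
    (ht : ‖t - 1‖ < 1) : IsSquare t := by
  have h2 : ‖(2 : ℤ_[p])‖ = 1 := by
    have := norm_intCast_eq_one (p := p) (n := 2) (by norm_num)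
      (lt_of_le_of_ne hp.1.two_le (Ne.symm hp2))
    rw [PadicInt.norm_def]
    exact_mod_cast this
  have ht1 : ‖t‖ ≤ 1 := by
    have := Padic.nonarchimedean (t - 1) 1
    rw [sub_add_cancel, norm_one] at this
    exact this.trans (max_le ht.le le_rfl)
  obtain ⟨t, rfl⟩ : ∃ t' : ℤ_[p], (t' : ℚ_[p]) = t := ⟨⟨t, ht1⟩, rfl⟩
  have h3 : ‖1 - t‖ < 1 := by
    rw [norm_sub_rev, PadicInt.norm_def]
    exact_mod_cast ht
  obtain ⟨z, hz, -⟩ := hensels_lemma (p := p) (a := 1)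
    (F := Polynomial.X ^ 2 - Polynomial.C t) (by simpa [h2, one_add_one_eq_two] using h3)
  refine ⟨z, ?_⟩
  have h3 : z ^ 2 = t := by simpa [sub_eq_zero] using hz
  rw [← h3, sq]
  push_cast
  rfl

lemma norm_sq_sub_mul_sq {p : ℕ} [Fact p.Prime] (hp2 : p ≠ 2) {d : ℚ_[p]} (hd : ‖d‖ = 1)
    (hsq : ¬ IsSquare d) (u v : ℚ_[p]) : ‖u ^ 2 - d * v ^ 2‖ = max ‖u‖ ‖v‖ ^ 2 := by
  have hn : ‖-(d * v ^ 2)‖ = ‖v‖ ^ 2 := by rw [norm_neg, norm_mul, hd, one_mul, norm_pow]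
  rcases eq_or_ne ‖u‖ ‖v‖ with huv | huv
  · rw [huv, max_self]
    refine le_antisymm ?_ (not_lt.1 fun hlt => hsq ?_)
    · have := Padic.nonarchimedean (u ^ 2) (-(d * v ^ 2))
      rwa [hn, norm_pow, huv, max_self, ← sub_eq_add_neg] at this
    · have hv : v ≠ 0 := by
        rintro rfl
        simp only [norm_zero, norm_eq_zero] at huv
        simp [huv] at hlt
      have hu : u ≠ 0 := by
        rw [← norm_ne_zero_iff] at hv ⊢
        rwa [huv]
      have h1 : ‖d * (v / u) ^ 2 - 1‖ < 1 := by
        have : d * (v / u) ^ 2 - 1 = -(u ^ 2 - d * v ^ 2) / u ^ 2 := by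
          field_simp
          ring
        rw [this, norm_div, norm_neg, norm_pow, huv, div_lt_one (by positivity)]
        exact hlt
      obtain ⟨w, hw⟩ := isSquare_of_norm_sub_one_lt hp2 h1
      refine ⟨w * (u / v), ?_⟩
      have : d = (d * (v / u) ^ 2) * (u / v) ^ 2 := by field_simp
      rw [this, hw]
      ring
  · rw [sub_eq_add_neg, Padic.add_eq_max_of_ne, hn, norm_pow]
    · rcases le_total ‖u‖ ‖v‖ with h | h
      · rw [max_eq_right h, max_eq_right (by gcongr)]
      · rw [max_eq_left h, max_eq_left (by gcongr)]
    · rw [hn, norm_pow]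
      intro h
      exact huv ((pow_left_inj₀ (norm_nonneg _) (norm_nonneg _) two_ne_zero).1 h)

lemma norm_sq_ne_inv_prime {p : ℕ} [hp : Fact p.Prime] (w : ℚ_[p]) : ‖w‖ ^ 2 ≠ (p : ℝ)⁻¹ := by
  intro h
  have hp0 : (0 : ℝ) < p := by exact_mod_cast hp.1.pos
  rcases eq_or_ne w 0 with rfl | hw
  · simp only [norm_zero, ne_eq, OfNat.ofNat_ne_zero, not_false_eq_true, zero_pow] at h
    exact (inv_pos.2 hp0).ne h
  · rw [Padic.norm_eq_zpow_neg_valuation hw, ← zpow_natCast, ← _root_.zpow_mul, ← _root_.zpow_neg_one] at h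
    have := zpow_right_injective₀ hp0 (by exact_mod_cast hp.1.one_lt.ne') h
    push_cast at this
    omega

lemma norm_binary_ne_inv_prime {p : ℕ} [hp : Fact p.Prime] (hp2 : p ≠ 2) {a b c : ℚ_[p]}
    (ha : ‖a‖ ≤ 1) (hc : ‖c‖ ≤ 1) (hd : ‖b ^ 2 - a * c‖ = 1)
    (hsq : ¬ IsSquare (b ^ 2 - a * c)) (x y : ℚ_[p]) :
    ‖a * x ^ 2 + 2 * b * x * y + c * y ^ 2‖ ≠ (p : ℝ)⁻¹ := by
  have ha1 : ‖a‖ = 1 := by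
    refine le_antisymm ha (not_lt.1 fun hlt => ?_)
    have h1 := norm_sq_sub_mul_sq hp2 hd hsq b 1
    rw [show b ^ 2 - (b ^ 2 - a * c) * 1 ^ 2 = a * c by ring, norm_mul, norm_one] at h1
    have h2 : ‖a‖ * ‖c‖ < 1 := mul_lt_one_of_nonneg_of_lt_one_left (norm_nonneg _) hlt hc
    have h3 : (1 : ℝ) ≤ max ‖b‖ 1 := le_max_right _ _
    nlinarith
  have h1 := norm_sq_sub_mul_sq hp2 hd hsq (a * x + b * y) y
  rw [show (a * x + b * y) ^ 2 - (b ^ 2 - a * c) * y ^ 2 =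
    a * (a * x ^ 2 + 2 * b * x * y + c * y ^ 2) by ring, norm_mul, ha1, one_mul] at h1
  rw [h1]
  rcases max_choice ‖a * x + b * y‖ ‖y‖ with h | h <;> rw [h] <;> exact norm_sq_ne_inv_prime _

lemma exists_binary_eq {k : Type*} [Field k] (h2 : (2 : k) ≠ 0) {a b c e : k} (he : e ≠ 0)
    (h : b ^ 2 - a * c = e ^ 2) (t : k) : ∃ x y : k, a * x ^ 2 + 2 * b * x * y + c * y ^ 2 = t := by
  rcases eq_or_ne a 0 with rfl | ha
  · have hb : b ≠ 0 := by
      rintro rfl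
      apply he
      simpa using h.symm
    refine ⟨(t - c) / (2 * b), 1, ?_⟩
    field_simp
    ring
  · refine ⟨((1 + a * t) / 2 - b * ((a * t - 1) / (2 * e))) / a, (a * t - 1) / (2 * e), ?_⟩
    apply mul_left_cancel₀ ha
    have h3 : ∀ x y : k, a * (a * x ^ 2 + 2 * b * x * y + c * y ^ 2) =
        (a * x + b * y) ^ 2 - e ^ 2 * y ^ 2 := fun x y => by rw [← h]; ring
    rw [h3, mul_div_cancel₀ _ ha]
    field_simp
    ring

lemma exists_quadForm_eq {k : Type*} [Field k] (h2 : (2 : k) ≠ 0) {G : Matrix (Fin 3) (Fin 3) k}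
    (hG : G.IsSymm) {j : Fin 3} (hj : G.adjugate j j ≠ 0) (hsq : IsSquare (-G.adjugate j j))
    (t : k) : ∃ x : Fin 3 → k, x ⬝ᵥ (G *ᵥ x) = t := by
  obtain ⟨e, he⟩ := hsq
  have he0 : e ≠ 0 := by
    rintro rfl
    exact hj (by simpa using he)
  have h01 := hG.apply 0 1
  have h02 := hG.apply 0 2
  have h12 := hG.apply 1 2
  fin_cases j <;> simp [adjugate_fin_three] at he
  · obtain ⟨x, y, h⟩ := exists_binary_eq h2 (a := G 1 1) (b := G 1 2) (c := G 2 2) he0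
      (by linear_combination he - G 1 2 * h12) t
    refine ⟨![0, x, y], ?_⟩
    simp [dotProduct, mulVec, Fin.sum_univ_three, ← h]
    linear_combination (x * y) * h12
  · obtain ⟨x, y, h⟩ := exists_binary_eq h2 (a := G 0 0) (b := G 0 2) (c := G 2 2) he0
      (by linear_combination he - G 0 2 * h02) t
    refine ⟨![x, 0, y], ?_⟩
    simp [dotProduct, mulVec, Fin.sum_univ_three, ← h]
    linear_combination (x * y) * h02
  · obtain ⟨x, y, h⟩ := exists_binary_eq h2 (a := G 0 0) (b := G 0 1) (c := G 1 1) he0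
      (by linear_combination he - G 0 1 * h01) t
    refine ⟨![x, y, 0], ?_⟩
    simp [dotProduct, mulVec, Fin.sum_univ_three, ← h]
    linear_combination (x * y) * h01

lemma norm_quadForm_ne_inv_prime {p : ℕ} [hp : Fact p.Prime] (hp2 : p ≠ 2)
    {G : Matrix (Fin 3) (Fin 3) ℚ_[p]} (hG : G.IsSymm) (hdet : G.det = 0)
    (h_int : ∀ i j, ‖G i j‖ ≤ 1) {j : Fin 3} (hj : ‖G.adjugate j j‖ = 1)
    (hsq : ¬ IsSquare (-G.adjugate j j)) (y : Fin 3 → ℚ_[p]) :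
    ‖y ⬝ᵥ (G *ᵥ y)‖ ≠ (p : ℝ)⁻¹ := by
  have hj0 : G.adjugate j j ≠ 0 := by
    rw [← norm_ne_zero_iff, hj]
    exact one_ne_zero
  set u : Fin 3 → ℚ_[p] := fun i => G.adjugate i j with hu
  have hGu : G *ᵥ u = 0 := by
    ext i
    have := congrFun (congrFun G.mul_adjugate i) j
    rw [hdet, zero_smul, mul_apply] at this
    exact this
  have huG : u ᵥ* G = 0 := by rw [← hGu, ← mulVec_transpose, hG.eq]
  obtain ⟨z, hz, hzj⟩ : ∃ z : Fin 3 → ℚ_[p], y ⬝ᵥ (G *ᵥ y) = z ⬝ᵥ (G *ᵥ z) ∧ z j = 0 := by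
    refine ⟨y - (y j / u j) • u, ?_, ?_⟩
    · rw [mulVec_sub, mulVec_smul, hGu, smul_zero, sub_zero, sub_dotProduct, smul_dotProduct,
        dotProduct_mulVec u, huG, zero_dotProduct, smul_zero, sub_zero]
    · simp [u, hj0]
  rw [hz]
  have h01 := hG.apply 0 1
  have h02 := hG.apply 0 2
  have h12 := hG.apply 1 2
  fin_cases j <;> simp [adjugate_fin_three] at hj hsq hzj
  · have hd : G 1 2 ^ 2 - G 1 1 * G 2 2 = G 1 2 * G 2 1 - G 1 1 * G 2 2 := by
      linear_combination -G 1 2 * h12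
    have hq : z ⬝ᵥ (G *ᵥ z) =
        G 1 1 * z 1 ^ 2 + 2 * G 1 2 * z 1 * z 2 + G 2 2 * z 2 ^ 2 := by
      simp [dotProduct, mulVec, Fin.sum_univ_three, hzj]
      linear_combination (z 1 * z 2) * h12
    rw [hq]
    exact norm_binary_ne_inv_prime hp2 (h_int 1 1) (h_int 2 2)
      (by rw [hd, norm_sub_rev]; exact hj) (by rwa [hd]) (z 1) (z 2)
  · have hd : G 0 2 ^ 2 - G 0 0 * G 2 2 = G 0 2 * G 2 0 - G 0 0 * G 2 2 := by
      linear_combination -G 0 2 * h02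
    have hq : z ⬝ᵥ (G *ᵥ z) =
        G 0 0 * z 0 ^ 2 + 2 * G 0 2 * z 0 * z 2 + G 2 2 * z 2 ^ 2 := by
      simp [dotProduct, mulVec, Fin.sum_univ_three, hzj]
      linear_combination (z 0 * z 2) * h02
    rw [hq]
    exact norm_binary_ne_inv_prime hp2 (h_int 0 0) (h_int 2 2)
      (by rw [hd, norm_sub_rev]; exact hj) (by rwa [hd]) (z 0) (z 2)
  · have hd : G 0 1 ^ 2 - G 0 0 * G 1 1 = G 0 1 * G 1 0 - G 0 0 * G 1 1 := by
      linear_combination -G 0 1 * h01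
    have hq : z ⬝ᵥ (G *ᵥ z) =
        G 0 0 * z 0 ^ 2 + 2 * G 0 1 * z 0 * z 1 + G 1 1 * z 1 ^ 2 := by
      simp [dotProduct, mulVec, Fin.sum_univ_three, hzj]
      linear_combination (z 0 * z 1) * h01
    rw [hq]
    exact norm_binary_ne_inv_prime hp2 (h_int 0 0) (h_int 1 1)
      (by rw [hd, norm_sub_rev]; exact hj) (by rwa [hd]) (z 0) (z 1)

lemma exists_rat_norm_quadForm_eq {p : ℕ} [hp : Fact p.Prime] {G : Matrix (Fin 3) (Fin 3) ℚ_[p]}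
    (h : ∀ t : ℚ_[p], ∃ x : Fin 3 → ℚ_[p], x ⬝ᵥ (G *ᵥ x) = t) :
    ∃ x : Fin 3 → ℚ,
      ‖(((↑) : ℚ → ℚ_[p]) ∘ x) ⬝ᵥ (G *ᵥ (((↑) : ℚ → ℚ_[p]) ∘ x))‖ = (p : ℝ)⁻¹ := by
  have hd : DenseRange (fun x : Fin 3 → ℚ => ((↑) : ℚ → ℚ_[p]) ∘ x) :=
    DenseRange.piMap fun _ => Padic.denseRange_ratCast p
  have hcont : Continuous fun x : Fin 3 → ℚ_[p] => x ⬝ᵥ (G *ᵥ x) := by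
    fun_prop
  have hp0 : (0 : ℝ) < (p : ℝ)⁻¹ := inv_pos.2 (by exact_mod_cast hp.1.pos)
  obtain ⟨x₀, hx₀⟩ := h p
  obtain ⟨x, hx⟩ := hd.exists_mem_open
    (Metric.isOpen_ball.preimage hcont : IsOpen (_ ⁻¹' Metric.ball (p : ℚ_[p]) (p : ℝ)⁻¹))
    ⟨x₀, by simpa [hx₀] using hp.1.pos⟩
  refine ⟨x, ?_⟩
  rw [Set.mem_preimage, Metric.mem_ball, dist_eq_norm] at hx
  rw [← Padic.norm_p]
  have h1 := Padic.add_eq_max_of_ne (p := p) (q := _ - (p : ℚ_[p])) (r := (p : ℚ_[p]))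
    (by rw [Padic.norm_p]; exact hx.ne)
  rw [sub_add_cancel] at h1
  rw [h1, max_eq_right]
  rw [Padic.norm_p]
  exact hx.le

lemma isSquare_neg_adjugate_of_forall_rep {L : Type*} [Field L] [NumberField L]
    {G₁ G₂ : Matrix (Fin 3) (Fin 3) L} (hG₁ : G₁.IsSymm) (hG₂ : G₂.IsSymm) (hdet : G₂.det = 0)
    {j k : Fin 3} (hj : G₁.adjugate j j ≠ 0) (hk : G₂.adjugate k k ≠ 0)
    (h : ∀ x : Fin 3 → ℚ, ∃ y : Fin 3 → ℚ,
      (((↑) : ℚ → L) ∘ x) ⬝ᵥ (G₁ *ᵥ (((↑) : ℚ → L) ∘ x)) =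
        (((↑) : ℚ → L) ∘ y) ⬝ᵥ (G₂ *ᵥ (((↑) : ℚ → L) ∘ y)))
    (hsq : IsSquare (-G₁.adjugate j j)) : IsSquare (-G₂.adjugate k k) := by
  by_contra hns
  obtain ⟨N₁, hN₁⟩ := exists_norm_map_eq_one hk
  choose N hN using fun i l => exists_norm_map_le_one (G₂ i l)
  obtain ⟨p, hp, σ, hpN, hσ⟩ := exists_hom_not_isSquare hns
    (2 + N₁ + ∑ i, ∑ l, N i l)
  have hle : ∀ i l, N i l ≤ ∑ i, ∑ l, N i l := fun i l =>
    (Finset.single_le_sum (f := fun l => N i l) (fun _ _ => Nat.zero_le _) (Finset.mem_univ l)).trans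
      (Finset.single_le_sum (f := fun i => ∑ l, N i l) (fun _ _ => Nat.zero_le _)
        (Finset.mem_univ i))
  have hadj : ∀ (G : Matrix (Fin 3) (Fin 3) L) i, (G.map σ).adjugate i i = σ (G.adjugate i i) := by
    intro G i
    have := congrFun (congrFun (σ.map_adjugate G) i) i
    exact this.symm
  have hform : ∀ (G : Matrix (Fin 3) (Fin 3) L) (x : Fin 3 → ℚ),
      σ ((((↑) : ℚ → L) ∘ x) ⬝ᵥ (G *ᵥ (((↑) : ℚ → L) ∘ x))) =
        (((↑) : ℚ → ℚ_[p]) ∘ x) ⬝ᵥ (G.map σ *ᵥ (((↑) : ℚ → ℚ_[p]) ∘ x)) := by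
    intro G x
    have hx : σ ∘ (((↑) : ℚ → L) ∘ x) = ((↑) : ℚ → ℚ_[p]) ∘ x := by
      ext i
      simp
    have hG : σ ∘ (G *ᵥ (((↑) : ℚ → L) ∘ x)) = G.map σ *ᵥ (((↑) : ℚ → ℚ_[p]) ∘ x) := by
      ext i
      rw [← hx]
      exact σ.map_mulVec _ _ _
    rw [σ.map_dotProduct, hx, hG]
  obtain ⟨x, hx⟩ := exists_rat_norm_quadForm_eq (p := p) (G := G₁.map σ)
    (exists_quadForm_eq two_ne_zero (hG₁.map σ) (j := j)
      (by rw [hadj]; exact (map_ne_zero σ).2 hj) (by rw [hadj, ← map_neg]; exact hsq.map σ))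
  obtain ⟨y, hy⟩ := h x
  rw [← hform, hy, hform] at hx
  refine norm_quadForm_ne_inv_prime (p := p) (by lia) (hG₂.map σ) ?_ (fun i l => ?_) (j := k) ?_ ?_
    _ hx
  · exact (σ.map_det G₂).symm.trans (by rw [hdet, map_zero])
  · exact hN i l p hp σ (by have := hle i l; lia)
  · rw [hadj]
    exact hN₁ p hp σ (by lia)
  · rwa [hadj, ← map_neg]

/-- A number field in which `δ` becomes a square, and in which any element which becomes a square
is a square up to a factor `δ`. -/
lemma exists_numberField_isSquare_or.{u} {L : Type u} [Field L] [NumberField L] {δ : L}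
    (hδ : ¬ IsSquare δ) : ∃ (M : Type u) (_ : Field M) (_ : NumberField M) (i : L →+* M),
      IsSquare (i δ) ∧ ∀ x : L, IsSquare (i x) → IsSquare x ∨ IsSquare (δ * x) := by
  have hirr : Irreducible (Polynomial.X ^ 2 - Polynomial.C δ) :=
    X_pow_sub_C_irreducible_of_prime Nat.prime_two fun b hb => hδ ⟨b, by rw [← hb, sq]⟩
  have := Fact.mk hirr
  have hmon : (Polynomial.X ^ 2 - Polynomial.C δ).Monic :=
    Polynomial.monic_X_pow_sub_C δ two_ne_zero
  have := hmon.finite_adjoinRoot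
  have : NumberField (AdjoinRoot (Polynomial.X ^ 2 - Polynomial.C δ)) := .of_module_finite L _
  set s := AdjoinRoot.root (Polynomial.X ^ 2 - Polynomial.C δ) with hs
  set i := AdjoinRoot.of (Polynomial.X ^ 2 - Polynomial.C δ) with hi
  have hss : i δ = s * s := by
    have h1 := AdjoinRoot.eval₂_root (Polynomial.X ^ 2 - Polynomial.C δ)
    rw [Polynomial.eval₂_sub, Polynomial.eval₂_X_pow, Polynomial.eval₂_C, sub_eq_zero] at h1
    exact h1.symm.trans (sq s)
  have hrep : ∀ m : AdjoinRoot (Polynomial.X ^ 2 - Polynomial.C δ), ∃ a b, m = i a + i b * s := by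
    intro m
    obtain ⟨P, rfl⟩ := AdjoinRoot.mk_surjective m
    induction P using Polynomial.induction_on' with
    | add P Q hP hQ =>
      obtain ⟨a, b, h1⟩ := hP
      obtain ⟨c, d, h2⟩ := hQ
      exact ⟨a + c, b + d, by rw [map_add, h1, h2, map_add, map_add]; ring⟩
    | monomial n a =>
      induction n with
      | zero => exact ⟨a, 0, by simp [hi]⟩
      | succ n ih =>
        obtain ⟨c, d, h1⟩ := ih
        refine ⟨d * δ, c, ?_⟩
        rw [← Polynomial.monomial_mul_X, map_mul, h1, AdjoinRoot.mk_X, ← hs, map_mul, hss]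
        ring
  have hinj : ∀ a b : L, i a + i b * s = 0 → b = 0 := by
    intro a b hab
    by_contra hb
    refine hδ ⟨-a / b, i.injective ?_⟩
    have h2 : s = i (-a / b) := by
      rw [map_div₀, map_neg, eq_div_iff ((map_ne_zero i).2 hb)]
      linear_combination hab
    rw [hss, map_mul, ← h2]
  refine ⟨AdjoinRoot (Polynomial.X ^ 2 - Polynomial.C δ), inferInstance, this, i, ⟨s, hss⟩, ?_⟩
  rintro x ⟨m, hm⟩
  obtain ⟨a, b, rfl⟩ := hrep m
  have h1 : 2 * a * b = 0 := by
    refine hinj (a * a + b * b * δ - x) _ ?_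
    simp only [map_sub, map_add, map_mul, map_ofNat]
    rw [hm, hss]
    ring
  rcases mul_eq_zero.1 h1 with h1 | rfl
  · have ha : a = 0 := by simpa using h1
    refine .inr ⟨δ * b, i.injective ?_⟩
    rw [map_mul, hm, hss, ha]
    simp only [map_mul, map_zero, hss]
    ring
  · refine .inl ⟨a, i.injective ?_⟩
    rw [hm]
    simp

lemma isSquare_adjugate_mul_adjugate {K : Type*} [Field K] [NumberField K]
    {G₁ G₂ : Matrix (Fin 3) (Fin 3) K} (hG₁ : G₁.IsSymm) (hG₂ : G₂.IsSymm)
    (hdet₁ : G₁.det = 0) (hdet₂ : G₂.det = 0)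
    {j k : Fin 3} (hj : G₁.adjugate j j ≠ 0) (hk : G₂.adjugate k k ≠ 0)
    (h₁₂ : ∀ x : Fin 3 → ℚ, ∃ y : Fin 3 → ℚ,
      (((↑) : ℚ → K) ∘ x) ⬝ᵥ (G₁ *ᵥ (((↑) : ℚ → K) ∘ x)) =
        (((↑) : ℚ → K) ∘ y) ⬝ᵥ (G₂ *ᵥ (((↑) : ℚ → K) ∘ y)))
    (h₂₁ : ∀ x : Fin 3 → ℚ, ∃ y : Fin 3 → ℚ,
      (((↑) : ℚ → K) ∘ x) ⬝ᵥ (G₂ *ᵥ (((↑) : ℚ → K) ∘ x)) =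
        (((↑) : ℚ → K) ∘ y) ⬝ᵥ (G₁ *ᵥ (((↑) : ℚ → K) ∘ y))) :
    IsSquare (G₁.adjugate j j * G₂.adjugate k k) := by
  by_cases hsq : IsSquare (-G₁.adjugate j j)
  · have := hsq.mul (isSquare_neg_adjugate_of_forall_rep hG₁ hG₂ hdet₂ hj hk h₁₂ hsq)
    rwa [neg_mul_neg] at this
  obtain ⟨M, _, _, i, hi, hM⟩ := exists_numberField_isSquare_or hsq
  have hadj : ∀ (G : Matrix (Fin 3) (Fin 3) K) l, (G.map i).adjugate l l = i (G.adjugate l l) := by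
    intro G l
    have := congrFun (congrFun (i.map_adjugate G) l) l
    exact this.symm
  have hform : ∀ (G : Matrix (Fin 3) (Fin 3) K) (x : Fin 3 → ℚ),
      i ((((↑) : ℚ → K) ∘ x) ⬝ᵥ (G *ᵥ (((↑) : ℚ → K) ∘ x))) =
        (((↑) : ℚ → M) ∘ x) ⬝ᵥ (G.map i *ᵥ (((↑) : ℚ → M) ∘ x)) := by
    intro G x
    have hx : i ∘ (((↑) : ℚ → K) ∘ x) = ((↑) : ℚ → M) ∘ x := by
      ext l
      simp
    have hG : i ∘ (G *ᵥ (((↑) : ℚ → K) ∘ x)) = G.map i *ᵥ (((↑) : ℚ → M) ∘ x) := by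
      ext l
      rw [← hx]
      exact i.map_mulVec _ _ _
    rw [i.map_dotProduct, hx, hG]
  have h1 := isSquare_neg_adjugate_of_forall_rep (hG₁.map i) (hG₂.map i) (j := j) (k := k)
    ((i.map_det G₂).symm.trans (by rw [hdet₂, map_zero]))
    (by rw [hadj]; exact (map_ne_zero i).2 hj) (by rw [hadj]; exact (map_ne_zero i).2 hk)
    (fun x => by
      obtain ⟨y, hy⟩ := h₁₂ x
      exact ⟨y, by rw [← hform, hy, hform]⟩) (by rwa [hadj, ← map_neg])
  rw [hadj, ← map_neg] at h1
  rcases hM _ h1 with h2 | h2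
  · exact absurd (isSquare_neg_adjugate_of_forall_rep hG₂ hG₁ hdet₁ hk hj h₂₁ h2) hsq
  · rwa [neg_mul_neg] at h2

lemma charpoly_dvd_pow_card {n R : Type*} [Fintype n] [DecidableEq n] [CommRing R]
    (T : Matrix n n R) {p : Polynomial R} (hp : Polynomial.aeval T p = 0) :
    T.charpoly ∣ p ^ Fintype.card n := by
  obtain ⟨Q, hQ⟩ : ∃ Q, scalar n p - (Polynomial.aeval T p).map Polynomial.C =
      charmatrix T * Q := by
    clear hp
    induction p using Polynomial.induction_on with
    | C a =>
      refine ⟨0, ?_⟩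
      ext i j
      by_cases h : i = j <;> simp [h, algebraMap_matrix_apply, diagonal]
    | add p q hp hq =>
      obtain ⟨P, hP⟩ := hp
      obtain ⟨Q, hQ⟩ := hq
      refine ⟨P + Q, ?_⟩
      rw [mul_add, ← hP, ← hQ, map_add, map_add, Matrix.map_add _ (by simp)]
      abel
    | monomial k a ih =>
      obtain ⟨Q, hQ⟩ := ih
      have h1 : Polynomial.C a * Polynomial.X ^ (k + 1) =
          Polynomial.C a * Polynomial.X ^ k * Polynomial.X := by rw [pow_succ, mul_assoc]
      rw [h1]
      generalize Polynomial.C a * Polynomial.X ^ k = q at hQ ⊢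
      set M := (Polynomial.aeval T q).map Polynomial.C with hM
      have hcomm : T.map Polynomial.C * M = M * T.map Polynomial.C := by
        rw [hM, ← Matrix.map_mul, ← Matrix.map_mul]
        have h2 := congrArg (Polynomial.aeval T) (mul_comm Polynomial.X q)
        rw [map_mul, map_mul, Polynomial.aeval_X] at h2
        rw [h2]
      refine ⟨Q * scalar n Polynomial.X + M, ?_⟩
      rw [mul_add, ← mul_assoc, ← hQ, map_mul, map_mul, Polynomial.aeval_X, Matrix.map_mul,
        ← hM, charmatrix, sub_mul, sub_mul]
      have h2 : (scalar n (Polynomial.X : Polynomial R)) * M = M * scalar n Polynomial.X :=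
        (scalar_commute _ (fun _ => Commute.all _ _) M).eq
      rw [h2]
      have h3 : (Polynomial.C.mapMatrix T : Matrix n n (Polynomial R)) = T.map Polynomial.C := rfl
      rw [h3, hcomm]
      abel
  rw [hp, Matrix.map_zero _ (by simp), sub_zero] at hQ
  have h := congrArg det hQ
  rw [det_mul, scalar_apply, det_diagonal, Finset.prod_const, Finset.card_univ] at h
  exact ⟨_, h⟩

/-- A matrix with squarefree characteristic polynomial has a cyclic vector. -/
lemma exists_forall_charpoly_dvd {n k : Type*} [Fintype n] [DecidableEq n] [Nonempty n] [Field k]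
    (T : Matrix n n k) (hsq : Squarefree T.charpoly) :
    ∃ u : n → k, ∀ p : Polynomial k, Polynomial.aeval T p *ᵥ u = 0 → T.charpoly ∣ p := by
  have haeval : ∀ p : Polynomial k, Polynomial.aeval (toLin' T) p = toLin' (Polynomial.aeval T p) :=
    fun p => Polynomial.aeval_algHom_apply (toLinAlgEquiv' : Matrix n n k ≃ₐ[k] _).toAlgHom T p
  obtain ⟨x, hx⟩ := Module.exists_ker_toSpanSingleton_eq_annihilator (R := Polynomial k)
    (M := Module.AEval k (n → k) (toLin' T))
  refine ⟨(Module.AEval.of k (n → k) (toLin' T)).symm x, fun p hp => ?_⟩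
  have h1 : p ∈ LinearMap.ker (LinearMap.toSpanSingleton (Polynomial k)
      (Module.AEval k (n → k) (toLin' T)) x) := by
    rw [LinearMap.mem_ker, LinearMap.toSpanSingleton_apply,
      ← (Module.AEval.of k (n → k) (toLin' T)).symm.map_eq_zero_iff,
      Module.AEval.of_symm_smul, haeval]
    exact hp
  rw [hx, Module.AEval.annihilator_eq_ker_aeval, RingHom.mem_ker, haeval] at h1
  have h2 := charpoly_dvd_pow_card T (toLin'.map_eq_zero_iff.1 h1)
  exact (hsq.dvd_pow_iff_dvd Fintype.card_ne_zero).1 h2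

lemma exists_mul_eq_mul_companion {k : Type*} [Field k] {T : Matrix (Fin 3) (Fin 3) k} {a b c : k}
    (hT : T.charpoly = Polynomial.X ^ 3 - Polynomial.C c * Polynomial.X ^ 2 -
      Polynomial.C b * Polynomial.X - Polynomial.C a) (hsq : Squarefree T.charpoly) :
    ∃ P : Matrix (Fin 3) (Fin 3) k, P.det ≠ 0 ∧ T * P = P * !![0, 0, a; 1, 0, b; 0, 1, c] := by
  obtain ⟨u, hu⟩ := exists_forall_charpoly_dvd T hsq
  have hCH : T ^ 3 = c • T ^ 2 + b • T + a • 1 := by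
    have := aeval_self_charpoly T
    simp only [hT, map_sub, map_mul, Polynomial.aeval_X, Polynomial.aeval_C, map_pow,
      Algebra.algebraMap_eq_smul_one, smul_mul_assoc, one_mul] at this
    rw [sub_sub, sub_sub, sub_eq_zero] at this
    rw [this, add_assoc]
  refine ⟨of fun i j => (T ^ (j : ℕ) *ᵥ u) i, fun hdet => ?_, ?_⟩
  · obtain ⟨v, hv, hv0⟩ := exists_mulVec_eq_zero_iff.2 hdet
    set p : Polynomial k := Polynomial.C (v 0) + Polynomial.C (v 1) * Polynomial.X +
      Polynomial.C (v 2) * Polynomial.X ^ 2 with hp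
    have h1 : Polynomial.aeval T p *ᵥ u = 0 := by
      rw [← hv0]
      ext i
      simp only [hp, map_add, map_mul, Polynomial.aeval_C, Polynomial.aeval_X, map_pow,
        Algebra.algebraMap_eq_smul_one, smul_mul_assoc, one_mul, add_mulVec, smul_mulVec]
      rw [mulVec, dotProduct, Fin.sum_univ_three]
      simp [mul_comm]
    have h2 : p = 0 := by
      refine Polynomial.eq_zero_of_dvd_of_natDegree_lt (hu p h1) ?_
      rw [charpoly_natDegree_eq_dim, Fintype.card_fin, hp]
      refine Nat.lt_succ_of_le ?_
      compute_degree
    refine hv (funext fun i => ?_)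
    have h3 : p.coeff i = 0 := by rw [h2, Polynomial.coeff_zero]
    fin_cases i <;> simpa [hp, Polynomial.coeff_X, Polynomial.coeff_C] using h3
  · ext i j
    have h0 : ∀ j : Fin 3, (T * of fun i (j : Fin 3) => (T ^ (j : ℕ) *ᵥ u) i) i j =
        (T ^ ((j : ℕ) + 1) *ᵥ u) i := by
      intro j
      rw [pow_succ', ← mulVec_mulVec]
      rfl
    rw [h0]
    fin_cases j
    · simp [mul_apply, Fin.sum_univ_three]
    · simp [mul_apply, Fin.sum_univ_three]
    · simp only [Fin.reduceFinMk, Nat.reduceAdd, hCH, add_mulVec, smul_mulVec]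
      simp [mul_apply, Fin.sum_univ_three]
      ring

lemma exists_dvd_sq_mul_sub_one {k : Type*} [Field k] (s : Polynomial k) {f : Polynomial k}
    (hf : Squarefree f) (h : ∀ g, Irreducible g → g ∣ f → ∃ h, g ∣ h ^ 2 * s - 1) :
    ∃ h, f ∣ h ^ 2 * s - 1 := by
  induction f using WfDvdMonoid.induction_on_irreducible with
  | zero => exact absurd hf not_squarefree_zero
  | unit u hu => exact ⟨0, hu.dvd⟩
  | mul f g _ hg ih =>
    obtain ⟨h₁, hh₁⟩ := h g hg (dvd_mul_right _ _)
    obtain ⟨h₂, hh₂⟩ := ih (hf.squarefree_of_dvd (dvd_mul_left _ _))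
      fun q hq hqf => h q hq (hqf.mul_left _)
    have hcop : IsCoprime g f := by
      refine (hg.coprime_iff_not_dvd).2 fun hgf => hg.not_isUnit (hf g ?_)
      exact mul_dvd_mul_left g hgf
    obtain ⟨u, v, huv⟩ := hcop
    have key : ∀ q x y : Polynomial k, q ∣ x - y → q ∣ y ^ 2 * s - 1 → q ∣ x ^ 2 * s - 1 := by
      intro q x y hxy hy
      have : x ^ 2 * s - 1 = (x - y) * ((x + y) * s) + (y ^ 2 * s - 1) := by ring
      rw [this]
      exact (hxy.mul_right _).add hy
    refine ⟨h₂ * (u * g) + h₁ * (v * f), IsCoprime.mul_dvd ⟨u, v, huv⟩ ?_ ?_⟩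
    · refine key g _ h₁ ⟨(h₂ - h₁) * u, ?_⟩ hh₁
      linear_combination h₁ * huv
    · refine key f _ h₂ ⟨(h₁ - h₂) * v, ?_⟩ hh₂
      linear_combination h₂ * huv

lemma mul_eq_mul_of_adjugate_eq_zero {k : Type*} [Field k] {G : Matrix (Fin 3) (Fin 3) k}
    (hG : G.IsSymm) (hadj : G.adjugate = 0) (i j l : Fin 3) :
    G i j * G l j = G j j * G i l := by
  have h01 := hG.apply 0 1
  have h02 := hG.apply 0 2
  have h12 := hG.apply 1 2
  have h : ∀ i j, G.adjugate i j = 0 := fun i j => by rw [hadj, Matrix.zero_apply]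
  have h1 := h 0 0
  have h2 := h 0 1
  have h3 := h 0 2
  have h4 := h 1 1
  have h5 := h 1 2
  have h6 := h 2 2
  simp [adjugate_fin_three, h01, h02, h12] at h1 h2 h3 h4 h5 h6
  fin_cases i <;> fin_cases j <;> fin_cases l <;> simp [h01, h02, h12] <;>
    first
    | ring1
    | linear_combination h1
    | linear_combination h2
    | linear_combination h3
    | linear_combination h4
    | linear_combination h5
    | linear_combination h6
    | linear_combination -h1
    | linear_combination -h2
    | linear_combination -h3
    | linear_combination -h4
    | linear_combination -h5
    | linear_combination -h6

lemma exists_diag_ne_zero {k : Type*} [Field k] {G : Matrix (Fin 3) (Fin 3) k}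
    (hG : G.IsSymm) (hadj : G.adjugate = 0) (hne : G ≠ 0) : ∃ j, G j j ≠ 0 := by
  by_contra! h
  refine hne (ext fun i j => ?_)
  have h1 := mul_eq_mul_of_adjugate_eq_zero hG hadj i j i
  rw [h, zero_mul] at h1
  simpa using h1

lemma adjugate_adjugate_eq_zero {k : Type*} [Field k] {G : Matrix (Fin 3) (Fin 3) k}
    (hdet : G.det = 0) : G.adjugate.adjugate = 0 := by
  rw [adjugate_adjugate G (by simp), hdet, Fintype.card_fin, zero_pow (by norm_num), zero_smul]

lemma isSymm_adjugate {n k : Type*} [Fintype n] [DecidableEq n] [CommRing k] {G : Matrix n n k}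
    (hG : G.IsSymm) : G.adjugate.IsSymm := by
  rw [IsSymm, adjugate_transpose, hG.eq]

/-- Every simultaneous value of the pair `(A, B)` is a simultaneous value of `(A', B')`. -/
def SimRepLE (A B A' B' : Matrix (Fin 3) (Fin 3) ℚ) : Prop :=
  ∀ x : Fin 3 → ℚ, ∃ y : Fin 3 → ℚ,
    x ⬝ᵥ (A *ᵥ x) = y ⬝ᵥ (A' *ᵥ y) ∧ x ⬝ᵥ (B *ᵥ x) = y ⬝ᵥ (B' *ᵥ y)

/-- The form `θ A - B` over a field of characteristic zero. -/
def pencilAt {K : Type*} [Field K] [Algebra ℚ K] (A B : Matrix (Fin 3) (Fin 3) ℚ) (θ : K) :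
    Matrix (Fin 3) (Fin 3) K :=
  θ • A.map (algebraMap ℚ K) - B.map (algebraMap ℚ K)

lemma isSymm_pencilAt {K : Type*} [Field K] [Algebra ℚ K] {A B : Matrix (Fin 3) (Fin 3) ℚ}
    (hA : A.IsSymm) (hB : B.IsSymm) (θ : K) : (pencilAt A B θ).IsSymm :=
  ((hA.map _).smul θ).sub (hB.map _)

lemma SimRepLE.exists_pencilAt_eq {K : Type*} [Field K] [NumberField K]
    {A B A' B' : Matrix (Fin 3) (Fin 3) ℚ} (h : SimRepLE A B A' B') (θ : K) (x : Fin 3 → ℚ) :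
    ∃ y : Fin 3 → ℚ,
      (((↑) : ℚ → K) ∘ x) ⬝ᵥ (pencilAt A B θ *ᵥ (((↑) : ℚ → K) ∘ x)) =
        (((↑) : ℚ → K) ∘ y) ⬝ᵥ (pencilAt A' B' θ *ᵥ (((↑) : ℚ → K) ∘ y)) := by
  have hmap : ∀ (A : Matrix (Fin 3) (Fin 3) ℚ) (x : Fin 3 → ℚ),
      (((↑) : ℚ → K) ∘ x) ⬝ᵥ (A.map (algebraMap ℚ K) *ᵥ (((↑) : ℚ → K) ∘ x)) =
        ((x ⬝ᵥ (A *ᵥ x) : ℚ) : K) := by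
    intro A x
    simp [dotProduct, mulVec, Fin.sum_univ_three]
  have hform : ∀ (A B : Matrix (Fin 3) (Fin 3) ℚ) (x : Fin 3 → ℚ),
      (((↑) : ℚ → K) ∘ x) ⬝ᵥ (pencilAt A B θ *ᵥ (((↑) : ℚ → K) ∘ x)) =
        θ * ((x ⬝ᵥ (A *ᵥ x) : ℚ) : K) - ((x ⬝ᵥ (B *ᵥ x) : ℚ) : K) := by
    intro A B x
    rw [pencilAt, sub_mulVec, smul_mulVec, dotProduct_sub, dotProduct_smul, hmap, hmap,
      smul_eq_mul]
  obtain ⟨y, h1, h2⟩ := h x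
  exact ⟨y, by rw [hform, hform, h1, h2]⟩

lemma eq_of_commute_companion {k : Type*} [Field k] {a b c : k} {M M' : Matrix (Fin 3) (Fin 3) k}
    (hM : M * !![0, 0, a; 1, 0, b; 0, 1, c] = !![0, 0, a; 1, 0, b; 0, 1, c] * M)
    (hM' : M' * !![0, 0, a; 1, 0, b; 0, 1, c] = !![0, 0, a; 1, 0, b; 0, 1, c] * M')
    (h : ∀ i, M i 0 = M' i 0) : M = M' := by
  set C : Matrix (Fin 3) (Fin 3) k := !![0, 0, a; 1, 0, b; 0, 1, c] with hC
  have hmul : ∀ (M : Matrix (Fin 3) (Fin 3) k) i,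
      (M * C) i 0 = M i 1 ∧ (M * C) i 1 = M i 2 := by
    intro M i
    simp [hC, mul_apply, Fin.sum_univ_three]
  have hcol : ∀ j, (∀ i, M i j = M' i j) → ∀ i, (M * C) i j = (M' * C) i j := by
    intro j hj i
    rw [hM, hM', mul_apply, mul_apply]
    exact Finset.sum_congr rfl fun l _ => by rw [hj]
  have h1 : ∀ i, M i 1 = M' i 1 := fun i => by
    rw [← (hmul M i).1, ← (hmul M' i).1, hcol 0 h]
  have h2 : ∀ i, M i 2 = M' i 2 := fun i => by
    rw [← (hmul M i).2, ← (hmul M' i).2, hcol 1 h1]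
  ext i j
  fin_cases j
  exacts [h i, h1 i, h2 i]

lemma exists_aeval_companion_eq {k : Type*} [Field k] {a b c : k} {S : Matrix (Fin 3) (Fin 3) k}
    (hS : S * !![0, 0, a; 1, 0, b; 0, 1, c] = !![0, 0, a; 1, 0, b; 0, 1, c] * S) :
    ∃ s : Polynomial k, Polynomial.aeval !![0, 0, a; 1, 0, b; 0, 1, c] s = S := by
  refine ⟨Polynomial.C (S 0 0) + Polynomial.C (S 1 0) * Polynomial.X +
    Polynomial.C (S 2 0) * Polynomial.X ^ 2, eq_of_commute_companion ?_ hS ?_⟩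
  · have := congrArg (Polynomial.aeval !![0, 0, a; 1, 0, b; 0, 1, c])
      (mul_comm (Polynomial.C (S 0 0) + Polynomial.C (S 1 0) * Polynomial.X +
        Polynomial.C (S 2 0) * Polynomial.X ^ 2) Polynomial.X)
    rwa [map_mul, map_mul, Polynomial.aeval_X] at this
  · intro i
    simp only [map_add, map_mul, Polynomial.aeval_C, Polynomial.aeval_X,
      Algebra.algebraMap_eq_smul_one, smul_mul_assoc, one_mul, sq]
    fin_cases i <;> simp

lemma mul_aeval_eq_smul {R K n : Type*} [CommRing R] [Field K] [Algebra R K] [Fintype n]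
    [DecidableEq n] {N C : Matrix n n K} {θ : K} (h : N * C = θ • N) (s : Polynomial R) :
    N * Polynomial.aeval C s = Polynomial.aeval θ s • N := by
  induction s using Polynomial.induction_on with
  | C a => simp [Algebra.algebraMap_eq_smul_one]
  | add p q hp hq => rw [map_add, mul_add, hp, hq, map_add, add_smul]
  | monomial k a ih =>
    rw [pow_succ, ← mul_assoc, map_mul, map_mul (Polynomial.aeval θ), ← mul_assoc, ih,
      Polynomial.aeval_X, Polynomial.aeval_X, smul_mul_assoc, h, smul_smul]

lemma transpose_aeval_mul {k n : Type*} [Field k] [Fintype n] [DecidableEq n] {A C : Matrix n n k}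
    (h : Cᵀ * A = A * C) (p : Polynomial k) :
    (Polynomial.aeval C p)ᵀ * A = A * Polynomial.aeval C p := by
  induction p using Polynomial.induction_on with
  | C a => simp [Algebra.algebraMap_eq_smul_one]
  | add p q hp hq => rw [map_add, transpose_add, add_mul, mul_add, hp, hq]
  | monomial k a ih =>
    have h1 : Polynomial.C a * Polynomial.X ^ (k + 1) =
      Polynomial.C a * Polynomial.X ^ k * Polynomial.X := by rw [pow_succ, mul_assoc]
    have h2 : Polynomial.C a * Polynomial.X ^ (k + 1) =
      Polynomial.X * (Polynomial.C a * Polynomial.X ^ k) := by ring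
    conv_lhs => rw [h2, map_mul, transpose_mul, mul_assoc, Polynomial.aeval_X, h, ← mul_assoc, ih]
    rw [h1, map_mul (Polynomial.aeval C) (_ * _), Polynomial.aeval_X, mul_assoc]

lemma exists_adjugate_eq {K : Type*} [Field K] {A₁ A₂ S C : Matrix (Fin 3) (Fin 3) K} {r θ t : K}
    (hA₂ : A₂.IsSymm) (hB₂ : (A₂ * C).IsSymm) (hS : A₂ * S = r • A₁) (hr : r ≠ 0)
    (hd₁ : A₁.det ≠ 0) (hd₂ : A₂.det ≠ 0) (hdet : (θ • 1 - C).det = 0)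
    (hN : (θ • 1 - C).adjugate ≠ 0)
    (hNS : (θ • 1 - C).adjugate * S = t • (θ • 1 - C).adjugate) :
    ∃ j, (θ • A₁ - A₁ * C).adjugate j j ≠ 0 ∧ (θ • A₂ - A₂ * C).adjugate j j ≠ 0 ∧
      r * A₁.det * (θ • A₂ - A₂ * C).adjugate j j =
        A₂.det * t * (θ • A₁ - A₁ * C).adjugate j j := by
  set N := (θ • 1 - C).adjugate with hNdef
  have hG : ∀ A : Matrix (Fin 3) (Fin 3) K, θ • A - A * C = A * (θ • 1 - C) := by
    intro A
    rw [mul_sub, mul_smul_comm, mul_one]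
  have hu₁ : IsUnit A₁ := (isUnit_iff_isUnit_det A₁).2 hd₁.isUnit
  have hu₂ : IsUnit A₂ := (isUnit_iff_isUnit_det A₂).2 hd₂.isUnit
  have key : (r * A₁.det) • (N * A₂.adjugate) = (A₂.det * t) • (N * A₁.adjugate) := by
    refine hu₁.mul_left_injective ?_
    have h1 : N * A₂.adjugate * (r • A₁) = (A₂.det * t) • N := by
      rw [← hS, mul_assoc, ← mul_assoc A₂.adjugate, adjugate_mul, smul_mul_assoc, one_mul,
        mul_smul_comm, hNS, smul_smul]
    simp only
    rw [smul_mul_assoc, smul_mul_assoc, mul_assoc N A₁.adjugate, adjugate_mul, mul_smul_comm,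
      mul_one, smul_smul, mul_comm r, mul_smul, ← mul_smul_comm, h1, smul_smul]
    congr 1
    ring
  have hadj : ∀ A : Matrix (Fin 3) (Fin 3) K, (A * (θ • 1 - C)).adjugate = N * A.adjugate :=
    fun A => adjugate_mul_distrib _ _
  simp only [hG, hadj]
  obtain ⟨j, hj⟩ : ∃ j, (N * A₂.adjugate) j j ≠ 0 := by
    rw [← hadj]
    refine exists_diag_ne_zero (isSymm_adjugate ?_) (adjugate_adjugate_eq_zero ?_) ?_
    · rw [← hG]
      exact (hA₂.smul θ).sub hB₂
    · rw [det_mul, hdet, mul_zero]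
    · rw [hadj]
      intro h
      refine hN ?_
      have h1 := congrArg (· * A₂) h
      simp only [mul_assoc, adjugate_mul, zero_mul, mul_smul_comm, mul_one] at h1
      exact (smul_eq_zero.1 h1).resolve_left hd₂
  have h1 := congrFun (congrFun key j) j
  simp only [Matrix.smul_apply, smul_eq_mul] at h1
  refine ⟨j, fun h => ?_, hj, h1⟩
  rw [h, mul_zero] at h1
  exact mul_ne_zero (mul_ne_zero hr hd₁) hj h1

lemma isSquare_aeval_of_simRepLE {K : Type*} [Field K] [NumberField K]
    {A₁ A₂ : Matrix (Fin 3) (Fin 3) ℚ} {a b c r : ℚ} {s : Polynomial ℚ}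
    (hA₁ : A₁.IsSymm) (hA₂ : A₂.IsSymm) (hd₁ : A₁.det ≠ 0) (hd₂ : A₂.det ≠ 0)
    (hB₁ : (A₁ * !![0, 0, a; 1, 0, b; 0, 1, c]).IsSymm)
    (hB₂ : (A₂ * !![0, 0, a; 1, 0, b; 0, 1, c]).IsSymm)
    (h₁₂ : SimRepLE A₁ (A₁ * !![0, 0, a; 1, 0, b; 0, 1, c])
      A₂ (A₂ * !![0, 0, a; 1, 0, b; 0, 1, c]))
    (h₂₁ : SimRepLE A₂ (A₂ * !![0, 0, a; 1, 0, b; 0, 1, c])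
      A₁ (A₁ * !![0, 0, a; 1, 0, b; 0, 1, c]))
    (hr : r ≠ 0) (hrd : IsSquare (r * A₁.det * A₂.det))
    (hs : A₂ * Polynomial.aeval !![0, 0, a; 1, 0, b; 0, 1, c] s = r • A₁)
    {θ : K} (hθ : θ ^ 3 = algebraMap ℚ K c * θ ^ 2 + algebraMap ℚ K b * θ + algebraMap ℚ K a) :
    Polynomial.aeval θ s ≠ 0 ∧ IsSquare (Polynomial.aeval θ s) := by
  set C : Matrix (Fin 3) (Fin 3) ℚ := !![0, 0, a; 1, 0, b; 0, 1, c] with hC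
  set φ := algebraMap ℚ K
  have hpencil : ∀ A : Matrix (Fin 3) (Fin 3) ℚ,
      pencilAt A (A * C) θ = θ • A.map φ - A.map φ * C.map φ := by
    intro A
    rw [pencilAt, Matrix.map_mul]
  have hCθ : θ • (1 : Matrix (Fin 3) (Fin 3) K) - C.map φ =
      !![θ, 0, -φ a; -1, θ, -φ b; 0, -1, θ - φ c] := by
    ext i j
    fin_cases i <;> fin_cases j <;> simp [hC]
  have hdet : (θ • (1 : Matrix (Fin 3) (Fin 3) K) - C.map φ).det = 0 := by
    rw [hCθ, det_fin_three]
    simp [-eq_ratCast]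
    linear_combination hθ
  have hN : (θ • (1 : Matrix (Fin 3) (Fin 3) K) - C.map φ).adjugate ≠ 0 := by
    intro h
    have := congrFun (congrFun h 2) 0
    rw [hCθ, adjugate_fin_three] at this
    simp at this
  have hNC : (θ • (1 : Matrix (Fin 3) (Fin 3) K) - C.map φ).adjugate * C.map φ =
      θ • (θ • (1 : Matrix (Fin 3) (Fin 3) K) - C.map φ).adjugate := by
    have := adjugate_mul (θ • (1 : Matrix (Fin 3) (Fin 3) K) - C.map φ)
    rw [hdet, zero_smul, mul_sub, sub_eq_zero, mul_smul_comm, mul_one] at this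
    exact this.symm
  have hSmap : (Polynomial.aeval C s).map φ = Polynomial.aeval (C.map φ) s :=
    (Polynomial.aeval_algHom_apply (Algebra.ofId ℚ K).mapMatrix C s).symm
  have hdmap : ∀ A : Matrix (Fin 3) (Fin 3) ℚ, (A.map φ).det = φ A.det := fun A =>
    (φ.map_det A).symm
  obtain ⟨j, hj₁, hj₂, hj⟩ := exists_adjugate_eq (A₁ := A₁.map φ) (A₂ := A₂.map φ)
    (S := (Polynomial.aeval C s).map φ) (C := C.map φ) (r := φ r) (θ := θ)
    (t := Polynomial.aeval θ s) (hA₂.map φ) (by rw [← Matrix.map_mul]; exact hB₂.map φ)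
    (by rw [← Matrix.map_mul, hs]; ext i j; simp) ((map_ne_zero φ).2 hr)
    (by rw [hdmap]; exact (map_ne_zero φ).2 hd₁) (by rw [hdmap]; exact (map_ne_zero φ).2 hd₂)
    hdet hN (by rw [hSmap]; exact mul_aeval_eq_smul hNC s)
  have hsing : ∀ A : Matrix (Fin 3) (Fin 3) ℚ, (pencilAt A (A * C) θ).det = 0 := by
    intro A
    rw [hpencil, show θ • A.map φ - A.map φ * C.map φ = A.map φ * (θ • 1 - C.map φ) by
      rw [mul_sub, mul_smul_comm, mul_one], det_mul, hdet, mul_zero]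
  rw [← hpencil] at hj₁ hj₂
  rw [← hpencil, ← hpencil, hdmap, hdmap] at hj
  obtain ⟨m, hm⟩ := isSquare_adjugate_mul_adjugate (isSymm_pencilAt hA₁ hB₁ θ)
    (isSymm_pencilAt hA₂ hB₂ θ) (hsing A₁) (hsing A₂) hj₁ hj₂
    (h₁₂.exists_pencilAt_eq θ) (h₂₁.exists_pencilAt_eq θ)
  obtain ⟨e, he⟩ := hrd
  replace he := congrArg φ he
  simp only [map_mul] at he
  have hd₁' := (map_ne_zero φ).2 hd₁
  have hd₂' := (map_ne_zero φ).2 hd₂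
  have hr' := (map_ne_zero φ).2 hr
  set c₁ := (pencilAt A₁ (A₁ * C) θ).adjugate j j
  set c₂ := (pencilAt A₂ (A₂ * C) θ).adjugate j j
  refine ⟨fun h0 => ?_, φ e * m / (φ A₂.det * c₁), ?_⟩
  · rw [h0, mul_zero, zero_mul] at hj
    exact mul_ne_zero (mul_ne_zero hr' hd₁') hj₂ hj
  · rw [div_mul_div_comm, eq_div_iff (mul_ne_zero (mul_ne_zero hd₂' hj₁) (mul_ne_zero hd₂' hj₁))]
    linear_combination (-φ A₂.det * c₁) * hj + φ e * φ e * hm + c₁ * c₂ * he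

theorem exists_equiv_of_companion {A₁ A₂ : Matrix (Fin 3) (Fin 3) ℚ} {a b c r : ℚ}
    (hf : Squarefree (Polynomial.X ^ 3 - Polynomial.C c * Polynomial.X ^ 2 -
      Polynomial.C b * Polynomial.X - Polynomial.C a))
    (hA₁ : A₁.IsSymm) (hA₂ : A₂.IsSymm) (hd₁ : A₁.det ≠ 0) (hd₂ : A₂.det ≠ 0)
    (hB₁ : (A₁ * !![0, 0, a; 1, 0, b; 0, 1, c]).IsSymm)
    (hB₂ : (A₂ * !![0, 0, a; 1, 0, b; 0, 1, c]).IsSymm)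
    (h₁₂ : SimRepLE A₁ (A₁ * !![0, 0, a; 1, 0, b; 0, 1, c])
      A₂ (A₂ * !![0, 0, a; 1, 0, b; 0, 1, c]))
    (h₂₁ : SimRepLE A₂ (A₂ * !![0, 0, a; 1, 0, b; 0, 1, c])
      A₁ (A₁ * !![0, 0, a; 1, 0, b; 0, 1, c]))
    (hr : r ≠ 0) (hrd : IsSquare (r * A₁.det * A₂.det)) :
    ∃ w : Matrix (Fin 3) (Fin 3) ℚ, wᵀ * (r • A₁) * w = A₂ ∧
      wᵀ * (r • (A₁ * !![0, 0, a; 1, 0, b; 0, 1, c])) * w =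
        A₂ * !![0, 0, a; 1, 0, b; 0, 1, c] := by
  have hu₂ : IsUnit A₂ := (isUnit_iff_isUnit_det A₂).2 hd₂.isUnit
  set f : Polynomial ℚ := Polynomial.X ^ 3 - Polynomial.C c * Polynomial.X ^ 2 -
      Polynomial.C b * Polynomial.X - Polynomial.C a with hf_def
  set C : Matrix (Fin 3) (Fin 3) ℚ := !![0, 0, a; 1, 0, b; 0, 1, c] with hC
  have htr : ∀ {A : Matrix (Fin 3) (Fin 3) ℚ}, A.IsSymm → (A * C).IsSymm → Cᵀ * A = A * C := by
    intro A hA hB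
    rw [← hB.eq, transpose_mul, hA.eq]
  have hS : A₂ * (A₂⁻¹ * (r • A₁)) = r • A₁ := mul_nonsing_inv_cancel_left _ _ hd₂.isUnit
  obtain ⟨s, hs⟩ := exists_aeval_companion_eq (a := a) (b := b) (c := c)
    (S := A₂⁻¹ * (r • A₁)) (by
      rw [← hC]
      refine hu₂.mul_right_injective ?_
      simp only
      rw [← mul_assoc, hS, ← mul_assoc A₂, ← htr hA₂ hB₂, mul_assoc, hS, smul_mul_assoc,
        mul_smul_comm, htr hA₁ hB₁])
  rw [← hs] at hS
  have hCf : Polynomial.aeval C f = 0 := by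
    simp only [hf_def, map_sub, map_mul, map_pow, Polynomial.aeval_X, Polynomial.aeval_C,
      Algebra.algebraMap_eq_smul_one, smul_mul_assoc, one_mul]
    ext i j
    fin_cases i <;> fin_cases j <;> simp [hC, pow_succ] <;> ring
  obtain ⟨h, hh⟩ := exists_dvd_sq_mul_sub_one s hf (by
    intro g hg hgf
    have := Fact.mk hg
    have haeval : ∀ p : Polynomial ℚ,
        Polynomial.aeval (AdjoinRoot.root g) p = AdjoinRoot.mk g p := by
      intro p
      rw [← AdjoinRoot.aeval_eq, Polynomial.aeval_def, Polynomial.aeval_def]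
      congr 1
    have hroot : Polynomial.aeval (AdjoinRoot.root g) f = 0 := by
      rw [haeval, AdjoinRoot.mk_eq_zero]
      exact hgf
    have : Module.Finite ℚ (AdjoinRoot g) := (AdjoinRoot.powerBasis hg.ne_zero).finite
    have : NumberField (AdjoinRoot g) := .of_module_finite ℚ _
    obtain ⟨hne, m, hm⟩ := isSquare_aeval_of_simRepLE (θ := AdjoinRoot.root g) hA₁ hA₂ hd₁ hd₂
      hB₁ hB₂ h₁₂ h₂₁ hr hrd hS (by
        simp only [hf_def, map_sub, map_mul, map_pow, Polynomial.aeval_X,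
          Polynomial.aeval_C] at hroot
        linear_combination hroot)
    obtain ⟨q, hq⟩ := AdjoinRoot.mk_surjective (g := g) m⁻¹
    refine ⟨q, ?_⟩
    have hm0 : m ≠ 0 := by
      rintro rfl
      exact hne (by simpa using hm)
    rw [haeval] at hm
    rw [← AdjoinRoot.mk_eq_zero, map_sub, map_mul, map_pow, hq, hm, map_one]
    field_simp
    ring)
  obtain ⟨q, hq⟩ := hh
  have hw : Polynomial.aeval C h * Polynomial.aeval C s * Polynomial.aeval C h = 1 := by
    rw [← map_mul, ← map_mul, show h * s * h = f * q + 1 by rw [← hq]; ring, map_add, map_mul,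
      hCf, zero_mul, zero_add, map_one]
  have h1 : (Polynomial.aeval C h)ᵀ * (r • A₁) * Polynomial.aeval C h = A₂ := by
    rw [← hS, ← mul_assoc, transpose_aeval_mul (htr hA₂ hB₂), mul_assoc A₂, mul_assoc A₂, hw,
      mul_one]
  refine ⟨Polynomial.aeval C h, h1, ?_⟩
  have hcomm : C * Polynomial.aeval C h = Polynomial.aeval C h * C := by
    have := congrArg (Polynomial.aeval C) (mul_comm Polynomial.X h)
    rwa [map_mul, map_mul, Polynomial.aeval_X] at this
  rw [← smul_mul_assoc, ← mul_assoc, mul_assoc, hcomm, ← mul_assoc, h1]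

lemma dotProduct_conj_mulVec {R n : Type*} [CommRing R] [Fintype n] (P A : Matrix n n R)
    (x : n → R) : x ⬝ᵥ ((Pᵀ * A * P) *ᵥ x) = (P *ᵥ x) ⬝ᵥ (A *ᵥ (P *ᵥ x)) := by
  rw [← mulVec_mulVec, ← mulVec_mulVec, dotProduct_mulVec, vecMul_transpose]

lemma SimRepLE.conj {A B A' B' P P' : Matrix (Fin 3) (Fin 3) ℚ} (h : SimRepLE A B A' B')
    (hP' : P'.det ≠ 0) :
    SimRepLE (Pᵀ * A * P) (Pᵀ * B * P) (P'ᵀ * A' * P') (P'ᵀ * B' * P') := by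
  intro x
  obtain ⟨y, h1, h2⟩ := h (P *ᵥ x)
  have hy : P' *ᵥ (P'⁻¹ *ᵥ y) = y := by
    rw [mulVec_mulVec, mul_nonsing_inv _ hP'.isUnit, one_mulVec]
  refine ⟨P'⁻¹ *ᵥ y, ?_, ?_⟩
  · rw [dotProduct_conj_mulVec, dotProduct_conj_mulVec, hy, h1]
  · rw [dotProduct_conj_mulVec, dotProduct_conj_mulVec, hy, h2]

lemma eq_of_conj_eq {P P' w A A' : Matrix (Fin 3) (Fin 3) ℚ} {r : ℚ} (hP' : P'.det ≠ 0)
    (h : wᵀ * (r • (Pᵀ * A * P)) * w = P'ᵀ * A' * P') :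
    (P * w * P'⁻¹)ᵀ * (r • A) * (P * w * P'⁻¹) = A' := by
  have h1 : P' * P'⁻¹ = 1 := mul_nonsing_inv _ hP'.isUnit
  calc (P * w * P'⁻¹)ᵀ * (r • A) * (P * w * P'⁻¹)
      = P'⁻¹ᵀ * (wᵀ * (r • (Pᵀ * A * P)) * w) * P'⁻¹ := by
        simp only [transpose_mul, mul_smul_comm, smul_mul_assoc, mul_assoc]
    _ = (P' * P'⁻¹)ᵀ * A' * (P' * P'⁻¹) := by
        rw [h]
        simp only [transpose_mul, mul_assoc]
    _ = A' := by simp [h1]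

lemma isSymm_conj {R n : Type*} [CommRing R] [Fintype n] {A : Matrix n n R} (hA : A.IsSymm)
    (P : Matrix n n R) : (Pᵀ * A * P).IsSymm := by
  rw [IsSymm, transpose_mul, transpose_mul, transpose_transpose, hA.eq, mul_assoc]

lemma charpoly_nonsing_inv_mul_eval {k : Type*} [Field k] {A : Matrix (Fin 3) (Fin 3) k}
    (B : Matrix (Fin 3) (Fin 3) k) (hA : A.det ≠ 0) (t : k) :
    A.det * (A⁻¹ * B).charpoly.eval t = (t • A - B).det := by
  rw [eval_charpoly, ← det_mul, mul_sub, mul_nonsing_inv_cancel_left _ _ hA.isUnit]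
  congr 2
  ext i j
  simp [mul_apply, Matrix.scalar_apply, diagonal_apply, mul_comm]

lemma charpoly_eq_of_det_eq {A₁ B₁ A₂ B₂ : Matrix (Fin 3) (Fin 3) ℚ} {r : ℚ}
    (hd₁ : A₁.det ≠ 0) (hd₂ : A₂.det ≠ 0)
    (hdet : ∀ x y : ℚ, (x • A₁ - y • B₁).det = r * (x • A₂ - y • B₂).det) :
    (A₁⁻¹ * B₁).charpoly = (A₂⁻¹ * B₂).charpoly := by
  have hd := hdet 1 0
  simp only [one_smul, zero_smul, sub_zero] at hd
  refine Polynomial.funext fun t => mul_left_cancel₀ hd₁ ?_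
  have h1 := hdet t 1
  rw [one_smul, one_smul, ← charpoly_nonsing_inv_mul_eval _ hd₁,
    ← charpoly_nonsing_inv_mul_eval _ hd₂] at h1
  rw [h1, hd, mul_assoc]

theorem exists_equiv_of_squarefree {A₁ B₁ A₂ B₂ : Matrix (Fin 3) (Fin 3) ℚ} {r : ℚ}
    (hA₁ : A₁.IsSymm) (hB₁ : B₁.IsSymm) (hA₂ : A₂.IsSymm) (hB₂ : B₂.IsSymm)
    (hd₁ : A₁.det ≠ 0) (hd₂ : A₂.det ≠ 0)
    (h₁₂ : SimRepLE A₁ B₁ A₂ B₂) (h₂₁ : SimRepLE A₂ B₂ A₁ B₁) (hr : r ≠ 0)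
    (hdet : ∀ x y : ℚ, (x • A₁ - y • B₁).det = r * (x • A₂ - y • B₂).det)
    (hsq : Squarefree (A₁⁻¹ * B₁).charpoly) :
    ∃ w : Matrix (Fin 3) (Fin 3) ℚ, wᵀ * (r • A₁) * w = A₂ ∧ wᵀ * (r • B₁) * w = B₂ := by
  have hd : A₁.det = r * A₂.det := by simpa using hdet 1 0
  have hchar := charpoly_eq_of_det_eq hd₁ hd₂ hdet
  set f := (A₁⁻¹ * B₁).charpoly with hf
  have hdeg : f.natDegree = 3 := by simp [hf, charpoly_natDegree_eq_dim]
  have hmonic : f.Monic := charpoly_monic _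
  have hform : f = Polynomial.X ^ 3 - Polynomial.C (-f.coeff 2) * Polynomial.X ^ 2 -
      Polynomial.C (-f.coeff 1) * Polynomial.X - Polynomial.C (-f.coeff 0) := by
    have h3 : f.coeff 3 = 1 := by rw [← hdeg]; exact hmonic
    conv_lhs => rw [f.as_sum_range_C_mul_X_pow, hdeg]
    simp only [Finset.sum_range_succ, Finset.sum_range_zero, h3, map_neg, map_one]
    ring
  generalize -f.coeff 2 = c at hform
  generalize -f.coeff 1 = b at hform
  generalize -f.coeff 0 = a at hform
  obtain ⟨P₁, hP₁, hT₁⟩ := exists_mul_eq_mul_companion (hf ▸ hform) hsq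
  obtain ⟨P₂, hP₂, hT₂⟩ := exists_mul_eq_mul_companion (hchar ▸ hform) (hchar ▸ hsq)
  have hcomp : ∀ {A B P : Matrix (Fin 3) (Fin 3) ℚ}, A.det ≠ 0 →
      A⁻¹ * B * P = P * !![0, 0, a; 1, 0, b; 0, 1, c] →
      Pᵀ * A * P * !![0, 0, a; 1, 0, b; 0, 1, c] = Pᵀ * B * P := by
    intro A B P hA h
    rw [mul_assoc (Pᵀ * A), ← h, mul_assoc Pᵀ, ← mul_assoc A, mul_nonsing_inv_cancel_left _ _
      hA.isUnit, mul_assoc]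
  have hc₁ := hcomp hd₁ hT₁
  have hc₂ := hcomp hd₂ hT₂
  obtain ⟨w, hw₁, hw₂⟩ := exists_equiv_of_companion (A₁ := P₁ᵀ * A₁ * P₁) (A₂ := P₂ᵀ * A₂ * P₂)
    (hform ▸ hsq) (isSymm_conj hA₁ _) (isSymm_conj hA₂ _)
    (by simp [det_mul, hP₁, hd₁]) (by simp [det_mul, hP₂, hd₂])
    (hc₁ ▸ isSymm_conj hB₁ _) (hc₂ ▸ isSymm_conj hB₂ _)
    (by rw [hc₁, hc₂]; exact h₁₂.conj hP₂) (by rw [hc₁, hc₂]; exact h₂₁.conj hP₁) hr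
    ⟨r * A₂.det * P₁.det * P₂.det, by
      simp only [det_mul, det_transpose, hd]
      ring⟩
  rw [hc₁, hc₂] at hw₂
  exact ⟨P₁ * w * P₂⁻¹, eq_of_conj_eq hP₂ hw₁, eq_of_conj_eq hP₂ hw₂⟩

lemma adjugate_eq_zero_of_anisotropic {k : Type*} [Field k] [NeZero (2 : k)]
    {A M : Matrix (Fin 3) (Fin 3) k} {e : k} (hM : M.IsSymm)
    (han : ∀ x : Fin 3 → k, x ⬝ᵥ (A *ᵥ x) = 0 → x ⬝ᵥ (M *ᵥ x) = 0 → x = 0)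
    (hdet : ∀ s : k, (s • A + M).det = A.det * (s ^ 2 * (s + e))) : M.adjugate = 0 := by
  have hdM : M.det = 0 := by simpa using hdet 0
  have htr : ∑ i, ∑ l, M.adjugate l i * A i l = 0 := by
    refine (mul_eq_zero.1 ?_).resolve_left (two_ne_zero' k)
    have h1 := hdet 1
    have h2 := hdet (-1)
    simp only [det_fin_three, Matrix.add_apply, Matrix.smul_apply, smul_eq_mul] at h1 h2
    simp only [Fin.sum_univ_three, adjugate_fin_three, of_apply, cons_val', cons_val_zero,
      cons_val_one, cons_val]
    linear_combination h1 - h2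
  by_contra hne
  have hQ := isSymm_adjugate hM
  have hQQ := adjugate_adjugate_eq_zero hdM
  obtain ⟨j, hj⟩ := exists_diag_ne_zero hQ hQQ hne
  have hMQ : M * M.adjugate = 0 := by rw [mul_adjugate, hdM, zero_smul]
  refine hj (congrFun (han (fun i => M.adjugate i j) ?_ ?_) j)
  · rw [← mul_zero (M.adjugate j j), ← htr, Finset.mul_sum, dotProduct]
    refine Finset.sum_congr rfl fun i _ => ?_
    rw [mulVec, dotProduct, Finset.mul_sum, Finset.mul_sum]
    refine Finset.sum_congr rfl fun l _ => ?_
    linear_combination A i l * mul_eq_mul_of_adjugate_eq_zero hQ hQQ l j i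
  · have : M *ᵥ (fun i => M.adjugate i j) = 0 := by
      ext i
      exact congrFun (congrFun hMQ i) j
    rw [this, dotProduct_zero]

lemma transpose_mul_mul_apply {R n : Type*} [CommRing R] [Fintype n] (v : n → n → R)
    (A : Matrix n n R) (i j : n) : (of v * A * (of v)ᵀ) i j = v i ⬝ᵥ (A *ᵥ v j) := by
  rw [mul_assoc, mul_apply_eq_vecMul, vecMul, dotProduct]
  rfl

lemma exists_diagonalization {A M : Matrix (Fin 3) (Fin 3) ℚ} {e : ℚ} (hA : A.IsSymm)
    (hM : M.IsSymm) (hd : A.det ≠ 0) (hM0 : M ≠ 0)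
    (han : ∀ x : Fin 3 → ℚ, x ⬝ᵥ (A *ᵥ x) = 0 → x ⬝ᵥ (M *ᵥ x) = 0 → x = 0)
    (hdet : ∀ s : ℚ, (s • A + M).det = A.det * (s ^ 2 * (s + e))) :
    ∃ (P : Matrix (Fin 3) (Fin 3) ℚ) (n a b : ℚ), P.det ≠ 0 ∧ n ≠ 0 ∧ a ≠ 0 ∧ b ≠ 0 ∧ e ≠ 0 ∧
      Pᵀ * A * P = !![n, 0, 0; 0, a, 0; 0, 0, b] ∧
      Pᵀ * M * P = !![e * n, 0, 0; 0, 0, 0; 0, 0, 0] := by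
  have hadj := adjugate_eq_zero_of_anisotropic hM han hdet
  have hdM : M.det = 0 := by simpa using hdet 0
  obtain ⟨j, hj⟩ := exists_diag_ne_zero hM hadj hM0
  set l : Fin 3 → ℚ := fun i => M i j with hl
  have hMl : ∀ x y : Fin 3 → ℚ, x ⬝ᵥ (M *ᵥ y) = (M j j)⁻¹ * (l ⬝ᵥ x) * (l ⬝ᵥ y) := by
    intro x y
    have h : ∀ i m, M i m = (M j j)⁻¹ * l i * l m := by
      intro i m
      rw [mul_assoc, mul_eq_mul_of_adjugate_eq_zero hM hadj i j m, inv_mul_cancel_left₀ hj]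
    generalize (M j j)⁻¹ = c at h ⊢
    simp only [dotProduct, mulVec, Fin.sum_univ_three, h]
    ring
  have hsym : ∀ x y : Fin 3 → ℚ, x ⬝ᵥ (A *ᵥ y) = y ⬝ᵥ (A *ᵥ x) := by
    intro x y
    rw [dotProduct_mulVec, dotProduct_comm, ← mulVec_transpose, hA.eq]
  set v : Fin 3 → ℚ := A⁻¹ *ᵥ l
  have hAv : A *ᵥ v = l := by rw [mulVec_mulVec, mul_nonsing_inv _ hd.isUnit, one_mulVec]
  have hn : l ⬝ᵥ v ≠ 0 := by
    intro h
    have hv := han v (by rw [hAv, dotProduct_comm, h]) (by rw [hMl, h, mul_zero])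
    rw [hv, mulVec_zero] at hAv
    exact hj (congrFun hAv j).symm
  obtain ⟨x, hx0, hx⟩ := exists_mulVec_eq_zero_iff.2 hdM
  have hlx : l ⬝ᵥ x = 0 := by
    have := congrFun hx j
    rwa [mulVec, show M j = l from funext fun i => hM.apply i j] at this
  have ha : x ⬝ᵥ (A *ᵥ x) ≠ 0 := fun h => hx0 (han x h (by rw [hx, dotProduct_zero]))
  set z : Fin 3 → ℚ := l ⨯₃ (A *ᵥ x) with hz
  have hlz : l ⬝ᵥ z = 0 := dot_self_cross _ _
  have hxz : z ⬝ᵥ (A *ᵥ x) = 0 := by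
    rw [dotProduct_comm]
    exact dot_cross_self _ _
  have hP : (of ![v, x, z]).det = (l ⬝ᵥ v) * (x ⬝ᵥ (A *ᵥ x)) := by
    have h1 : (of ![v, x, z]).det = z ⬝ᵥ (v ⨯₃ x) := by
      rw [← triple_product_permutation, ← triple_product_permutation, triple_product_eq_det]
      rfl
    rw [h1, hz, cross_dot_cross, hlx]
    rw [dotProduct_comm (A *ᵥ x) x]
    ring
  have hP0 : (of ![v, x, z])ᵀ.det ≠ 0 := by
    rw [det_transpose, hP]
    exact mul_ne_zero hn ha
  have hPA : of ![v, x, z] * A * (of ![v, x, z])ᵀ =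
      !![l ⬝ᵥ v, 0, 0; 0, x ⬝ᵥ (A *ᵥ x), 0; 0, 0, z ⬝ᵥ (A *ᵥ z)] := by
    ext i m
    rw [transpose_mul_mul_apply]
    fin_cases i <;> fin_cases m <;>
      simp [hxz, hsym v x, hsym v z, hsym x z, hAv, dotProduct_comm v l,
        dotProduct_comm z l, dotProduct_comm x l, hlx, hlz]
  have hPM : of ![v, x, z] * M * (of ![v, x, z])ᵀ =
      !![(M j j)⁻¹ * (l ⬝ᵥ v) * (l ⬝ᵥ v), 0, 0; 0, 0, 0; 0, 0, 0] := by
    ext i m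
    rw [transpose_mul_mul_apply, hMl]
    fin_cases i <;> fin_cases m <;> simp [hlx, hlz]
  have hb : z ⬝ᵥ (A *ᵥ z) ≠ 0 := by
    intro hb
    have := congrArg det hPA
    rw [det_mul, det_mul, hb] at this
    simp [det_fin_three !![_, _, _; _, _, _; _, _, _], hd] at this
    exact hP0 (by rw [det_transpose]; exact this)
  have he : e = (M j j)⁻¹ * (l ⬝ᵥ v) := by
    have h1 := congrArg det hPA
    have h2 := congrArg det (congrArg₂ HAdd.hAdd hPA hPM)
    rw [← add_mul, ← mul_add] at h2
    have h3 := hdet 1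
    rw [one_smul] at h3
    rw [det_mul, det_mul] at h1 h2
    rw [h3] at h2
    simp [det_fin_three !![_, _, _; _, _, _; _, _, _]] at h1 h2
    have h4 := mul_ne_zero (mul_ne_zero hn ha) hb
    refine mul_left_cancel₀ h4 ?_
    linear_combination h2 - (1 + e) * h1
  refine ⟨(of ![v, x, z])ᵀ, _, _, _, hP0, hn, ha, hb, ?_, ?_, ?_⟩
  · rw [he]
    exact mul_ne_zero (inv_ne_zero hj) hn
  · rw [transpose_transpose, hPA]
  · rw [transpose_transpose, hPM, he]

lemma adjugate_pencilAt_diag (n a b δ : ℚ) :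
    (pencilAt !![n, 0, 0; 0, a, 0; 0, 0, b] !![δ * n, 0, 0; 0, 0, 0; 0, 0, 0] δ).adjugate 0 0 =
      δ ^ 2 * (a * b) := by
  simp [pencilAt, adjugate_fin_three]
  ring

lemma exists_equiv_of_diag {n₁ a₁ b₁ n₂ a₂ b₂ δ r : ℚ} (hn₁ : n₁ ≠ 0) (ha₁ : a₁ ≠ 0)
    (hb₁ : b₁ ≠ 0) (hn₂ : n₂ ≠ 0) (ha₂ : a₂ ≠ 0) (hb₂ : b₂ ≠ 0) (hδ : δ ≠ 0) (hr : r ≠ 0)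
    (hrd : IsSquare (r * (n₁ * a₁ * b₁) * (n₂ * a₂ * b₂)))
    (h₁₂ : SimRepLE !![n₁, 0, 0; 0, a₁, 0; 0, 0, b₁] !![δ * n₁, 0, 0; 0, 0, 0; 0, 0, 0]
      !![n₂, 0, 0; 0, a₂, 0; 0, 0, b₂] !![δ * n₂, 0, 0; 0, 0, 0; 0, 0, 0])
    (h₂₁ : SimRepLE !![n₂, 0, 0; 0, a₂, 0; 0, 0, b₂] !![δ * n₂, 0, 0; 0, 0, 0; 0, 0, 0]
      !![n₁, 0, 0; 0, a₁, 0; 0, 0, b₁] !![δ * n₁, 0, 0; 0, 0, 0; 0, 0, 0]) :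
    ∃ w : Matrix (Fin 3) (Fin 3) ℚ,
      wᵀ * (r • !![n₁, 0, 0; 0, a₁, 0; 0, 0, b₁]) * w = !![n₂, 0, 0; 0, a₂, 0; 0, 0, b₂] ∧
      wᵀ * (r • !![δ * n₁, 0, 0; 0, 0, 0; 0, 0, 0]) * w =
        !![δ * n₂, 0, 0; 0, 0, 0; 0, 0, 0] := by
  obtain ⟨y, -, hy⟩ := h₂₁ ![1, 0, 0]
  obtain ⟨y', hy1, hy2⟩ := h₂₁ ![0, 1, 0]
  simp [dotProduct, mulVec, Fin.sum_univ_three, hδ, hn₁] at hy hy1 hy2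
  replace hy : n₂ = n₁ * y 0 ^ 2 := mul_left_cancel₀ hδ (by linear_combination hy)
  simp [hy2] at hy1
  have hy0 : y 0 ≠ 0 := by
    intro h
    simp [h, hn₂] at hy
  have hsymm : ∀ a b c : ℚ, (!![a, 0, 0; 0, b, 0; 0, 0, c] : Matrix (Fin 3) (Fin 3) ℚ).IsSymm := by
    intro a b c
    ext i j
    fin_cases i <;> fin_cases j <;> rfl
  have hsing : ∀ n a b : ℚ,
      (pencilAt !![n, 0, 0; 0, a, 0; 0, 0, b] !![δ * n, 0, 0; 0, 0, 0; 0, 0, 0] δ).det = 0 := by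
    intro n a b
    simp [pencilAt, det_fin_three]
  have hne : ∀ {n a b : ℚ}, a ≠ 0 → b ≠ 0 →
      (pencilAt !![n, 0, 0; 0, a, 0; 0, 0, b] !![δ * n, 0, 0; 0, 0, 0; 0, 0, 0] δ).adjugate 0 0 ≠
        0 := by
    intro n a b ha hb
    rw [adjugate_pencilAt_diag]
    exact mul_ne_zero (pow_ne_zero 2 hδ) (mul_ne_zero ha hb)
  obtain ⟨m, hm⟩ := isSquare_adjugate_mul_adjugate
    (isSymm_pencilAt (hsymm _ _ _) (hsymm _ _ _) δ) (isSymm_pencilAt (hsymm _ _ _) (hsymm _ _ _) δ)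
    (hsing n₁ a₁ b₁) (hsing n₂ a₂ b₂) (hne ha₁ hb₁) (hne ha₂ hb₂)
    (h₁₂.exists_pencilAt_eq δ) (h₂₁.exists_pencilAt_eq δ)
  rw [adjugate_pencilAt_diag, adjugate_pencilAt_diag] at hm
  obtain ⟨e, he⟩ := hrd
  obtain ⟨p, hp⟩ : ∃ p, p = m / δ ^ 2 := ⟨_, rfl⟩
  replace hm : a₁ * b₁ * (a₂ * b₂) = p ^ 2 := by
    rw [hp, div_pow, eq_div_iff (by positivity)]
    linear_combination hm
  have hp0 : p ≠ 0 := by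
    rintro rfl
    have := mul_ne_zero (mul_ne_zero ha₁ hb₁) (mul_ne_zero ha₂ hb₂)
    exact this (by simpa using hm)
  obtain ⟨t, ht⟩ : ∃ t, t = e / (n₁ * y 0 * p) := ⟨_, rfl⟩
  have hrt : r = t ^ 2 := by
    rw [ht, div_pow, eq_div_iff (by positivity)]
    rw [hy] at he
    linear_combination he - r * n₁ ^ 2 * y 0 ^ 2 * hm
  have ht0 : t ≠ 0 := by
    rintro rfl
    simp [hr] at hrt
  obtain ⟨k, hk⟩ : ∃ k, k = p / (a₁ * a₂ * b₁) := ⟨_, rfl⟩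
  replace hk : a₁ * b₁ * a₂ * k ^ 2 = b₂ := by
    rw [hk]
    field_simp
    linear_combination -hm
  have hA : !![y 0, 0, 0; 0, y' 1, -(b₁ * y' 2 * k); 0, y' 2, a₁ * y' 1 * k]ᵀ *
      !![n₁, 0, 0; 0, a₁, 0; 0, 0, b₁] *
      !![y 0, 0, 0; 0, y' 1, -(b₁ * y' 2 * k); 0, y' 2, a₁ * y' 1 * k] =
      !![n₂, 0, 0; 0, a₂, 0; 0, 0, b₂] := by
    ext i j
    fin_cases i <;> fin_cases j <;> simp [mul_apply, Fin.sum_univ_three]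
    · linear_combination -hy
    · linear_combination -hy1
    · ring
    · ring
    · linear_combination hk - a₁ * b₁ * k ^ 2 * hy1
  have hM : !![y 0, 0, 0; 0, y' 1, -(b₁ * y' 2 * k); 0, y' 2, a₁ * y' 1 * k]ᵀ *
      !![δ * n₁, 0, 0; 0, 0, 0; 0, 0, 0] *
      !![y 0, 0, 0; 0, y' 1, -(b₁ * y' 2 * k); 0, y' 2, a₁ * y' 1 * k] =
      !![δ * n₂, 0, 0; 0, 0, 0; 0, 0, 0] := by
    ext i j
    fin_cases i <;> fin_cases j <;> simp [mul_apply, Fin.sum_univ_three]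
    linear_combination -δ * hy
  have hrt' : t⁻¹ * t⁻¹ * r = 1 := by
    rw [hrt]
    field_simp
  refine ⟨t⁻¹ • !![y 0, 0, 0; 0, y' 1, -(b₁ * y' 2 * k); 0, y' 2, a₁ * y' 1 * k], ?_, ?_⟩
  · rw [transpose_smul, mul_smul_comm, smul_mul_assoc, mul_smul_comm, smul_mul_assoc,
      smul_mul_assoc, hA, smul_smul, smul_smul, hrt', one_smul]
  · rw [transpose_smul, mul_smul_comm, smul_mul_assoc, mul_smul_comm, smul_mul_assoc,
      smul_mul_assoc, hM, smul_smul, smul_smul, hrt', one_smul]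

lemma SimRepLE.pencil {A B A' B' : Matrix (Fin 3) (Fin 3) ℚ} (h : SimRepLE A B A' B')
    (a b c d : ℚ) :
    SimRepLE (a • A + b • B) (c • A + d • B) (a • A' + b • B') (c • A' + d • B') := by
  intro x
  obtain ⟨y, h1, h2⟩ := h x
  refine ⟨y, ?_, ?_⟩ <;>
    simp only [add_mulVec, smul_mulVec, dotProduct_add, dotProduct_smul, h1, h2]

lemma exists_eq_sq_mul_of_not_squarefree {f : Polynomial ℚ} (hf : f.Monic) (hdeg : f.natDegree = 3)
    (hsq : ¬ Squarefree f) :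
    ∃ θ φ : ℚ, f = (Polynomial.X - Polynomial.C θ) ^ 2 * (Polynomial.X - Polynomial.C φ) := by
  rw [squarefree_iff_irreducible_sq_not_dvd_of_ne_zero hf.ne_zero] at hsq
  push Not at hsq
  obtain ⟨g, hg, q, hq⟩ := hsq
  have hg0 := hg.ne_zero
  have hq0 : q ≠ 0 := by
    rintro rfl
    exact hf.ne_zero (by rw [hq, mul_zero])
  have hdg := hg.natDegree_pos
  have hdeg' := congrArg Polynomial.natDegree hq
  rw [hdeg, Polynomial.natDegree_mul (mul_ne_zero hg0 hg0) hq0,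
    Polynomial.natDegree_mul hg0 hg0] at hdeg'
  have hlin : ∀ {p : Polynomial ℚ}, p.natDegree = 1 →
      ∃ θ, p = Polynomial.C p.leadingCoeff * (Polynomial.X - Polynomial.C θ) := by
    intro p hp
    have hp0 : p.leadingCoeff ≠ 0 := by
      rw [Polynomial.leadingCoeff_ne_zero]
      rintro rfl
      simp at hp
    refine ⟨-(p.leadingCoeff⁻¹ * p.coeff 0), ?_⟩
    conv_lhs => rw [Polynomial.eq_X_add_C_of_natDegree_le_one hp.le]
    rw [Polynomial.leadingCoeff, hp] at hp0 ⊢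
    rw [map_neg, map_mul, sub_neg_eq_add, mul_add, ← mul_assoc, ← map_mul,
      mul_inv_cancel₀ hp0, map_one, one_mul]
  obtain ⟨θ, hθ⟩ := hlin (p := g) (by omega)
  obtain ⟨φ, hφ⟩ := hlin (p := q) (by omega)
  refine ⟨θ, φ, ?_⟩
  have hlead : g.leadingCoeff * g.leadingCoeff * q.leadingCoeff = 1 := by
    rw [← Polynomial.leadingCoeff_mul, ← Polynomial.leadingCoeff_mul, ← hq]
    exact hf
  replace hlead := congrArg Polynomial.C hlead
  rw [map_mul, map_mul, map_one] at hlead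
  rw [hq, hθ, hφ]
  generalize Polynomial.C g.leadingCoeff = u at hlead
  generalize Polynomial.C q.leadingCoeff = v at hlead
  linear_combination (Polynomial.X - Polynomial.C θ) ^ 2 * (Polynomial.X - Polynomial.C φ) * hlead

theorem exists_equiv_of_not_squarefree {A₁ B₁ A₂ B₂ : Matrix (Fin 3) (Fin 3) ℚ} {r : ℚ}
    (hA₁ : A₁.IsSymm) (hB₁ : B₁.IsSymm) (hA₂ : A₂.IsSymm) (hB₂ : B₂.IsSymm)
    (hd₁ : A₁.det ≠ 0) (hd₂ : A₂.det ≠ 0)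
    (hli₁ : ∀ a b : ℚ, a • A₁ + b • B₁ = 0 → a = 0 ∧ b = 0)
    (hli₂ : ∀ a b : ℚ, a • A₂ + b • B₂ = 0 → a = 0 ∧ b = 0)
    (han₁ : ∀ x : Fin 3 → ℚ, x ⬝ᵥ (A₁ *ᵥ x) = 0 → x ⬝ᵥ (B₁ *ᵥ x) = 0 → x = 0)
    (han₂ : ∀ x : Fin 3 → ℚ, x ⬝ᵥ (A₂ *ᵥ x) = 0 → x ⬝ᵥ (B₂ *ᵥ x) = 0 → x = 0)
    (h₁₂ : SimRepLE A₁ B₁ A₂ B₂) (h₂₁ : SimRepLE A₂ B₂ A₁ B₁) (hr : r ≠ 0)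
    (hdet : ∀ x y : ℚ, (x • A₁ - y • B₁).det = r * (x • A₂ - y • B₂).det)
    (hsq : ¬ Squarefree (A₁⁻¹ * B₁).charpoly) :
    ∃ w : Matrix (Fin 3) (Fin 3) ℚ, wᵀ * (r • A₁) * w = A₂ ∧ wᵀ * (r • B₁) * w = B₂ := by
  have hd : A₁.det = r * A₂.det := by simpa using hdet 1 0
  have hchar := charpoly_eq_of_det_eq hd₁ hd₂ hdet
  obtain ⟨θ, φ, hf⟩ := exists_eq_sq_mul_of_not_squarefree (charpoly_monic (A₁⁻¹ * B₁))
    (by simp [charpoly_natDegree_eq_dim]) hsq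
  have hdiag : ∀ {A B : Matrix (Fin 3) (Fin 3) ℚ}, A.IsSymm → B.IsSymm → A.det ≠ 0 →
      (∀ a b : ℚ, a • A + b • B = 0 → a = 0 ∧ b = 0) →
      (∀ x : Fin 3 → ℚ, x ⬝ᵥ (A *ᵥ x) = 0 → x ⬝ᵥ (B *ᵥ x) = 0 → x = 0) →
      (A⁻¹ * B).charpoly =
        (Polynomial.X - Polynomial.C θ) ^ 2 * (Polynomial.X - Polynomial.C φ) →
      ∃ (P : Matrix (Fin 3) (Fin 3) ℚ) (n a b : ℚ), P.det ≠ 0 ∧ n ≠ 0 ∧ a ≠ 0 ∧ b ≠ 0 ∧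
        θ - φ ≠ 0 ∧ Pᵀ * A * P = !![n, 0, 0; 0, a, 0; 0, 0, b] ∧
        Pᵀ * (θ • A + (-1 : ℚ) • B) * P = !![(θ - φ) * n, 0, 0; 0, 0, 0; 0, 0, 0] := by
    intro A B hA hB hdA hli han hchar
    refine exists_diagonalization hA ((hA.smul θ).add (hB.smul _)) hdA ?_ ?_ ?_
    · intro h
      exact neg_ne_zero.2 one_ne_zero (hli _ _ h).2
    · intro x h1 h2
      refine han x h1 ?_
      simpa [add_mulVec, smul_mulVec, h1, neg_mulVec] using h2
    · intro s
      have h1 := charpoly_nonsing_inv_mul_eval B hdA (s + θ)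
      rw [hchar] at h1
      rw [show s • A + (θ • A + (-1 : ℚ) • B) = (s + θ) • A - B by rw [add_smul]; module, ← h1]
      simp only [Polynomial.eval_mul, Polynomial.eval_pow, Polynomial.eval_sub, Polynomial.eval_X,
        Polynomial.eval_C]
      ring
  obtain ⟨P₁, n₁, a₁, b₁, hP₁, hn₁, ha₁, hb₁, hδ, hPA₁, hPM₁⟩ :=
    hdiag hA₁ hB₁ hd₁ hli₁ han₁ hf
  obtain ⟨P₂, n₂, a₂, b₂, hP₂, hn₂, ha₂, hb₂, -, hPA₂, hPM₂⟩ :=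
    hdiag hA₂ hB₂ hd₂ hli₂ han₂ (hchar ▸ hf)
  have hM : ∀ A B : Matrix (Fin 3) (Fin 3) ℚ, (1 : ℚ) • A + (0 : ℚ) • B = A := by simp
  have g₁₂ := (h₁₂.pencil 1 0 θ (-1)).conj (P := P₁) hP₂
  have g₂₁ := (h₂₁.pencil 1 0 θ (-1)).conj (P := P₂) hP₁
  rw [hM, hM, hPA₁, hPA₂, hPM₁, hPM₂] at g₁₂ g₂₁
  have hdP : ∀ {P A : Matrix (Fin 3) (Fin 3) ℚ} {n a b : ℚ},
      Pᵀ * A * P = !![n, 0, 0; 0, a, 0; 0, 0, b] → n * a * b = P.det ^ 2 * A.det := by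
    intro P A n a b h
    have := congrArg det h
    rw [det_mul, det_mul, det_transpose] at this
    simp [det_fin_three !![_, _, _; _, _, _; _, _, _]] at this
    linear_combination -this
  obtain ⟨w, hw₁, hw₂⟩ := exists_equiv_of_diag hn₁ ha₁ hb₁ hn₂ ha₂ hb₂ hδ hr
    ⟨r * P₁.det * P₂.det * A₂.det, by
      rw [hdP hPA₁, hdP hPA₂, hd]
      ring⟩ g₁₂ g₂₁
  rw [← hPA₁, ← hPA₂] at hw₁
  rw [← hPM₁, ← hPM₂] at hw₂
  have e₁ := eq_of_conj_eq hP₂ hw₁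
  have e₂ := eq_of_conj_eq hP₂ hw₂
  refine ⟨P₁ * w * P₂⁻¹, e₁, ?_⟩
  generalize P₁ * w * P₂⁻¹ = u at e₁ e₂
  rw [show r • B₁ = θ • (r • A₁) - r • (θ • A₁ + (-1 : ℚ) • B₁) by module, mul_sub, sub_mul,
    mul_smul_comm, smul_mul_assoc, e₁, e₂]
  module

theorem exists_equiv_of_det_ne_zero {A₁ B₁ A₂ B₂ : Matrix (Fin 3) (Fin 3) ℚ} {r : ℚ}
    (hA₁ : A₁.IsSymm) (hB₁ : B₁.IsSymm) (hA₂ : A₂.IsSymm) (hB₂ : B₂.IsSymm)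
    (hd₁ : A₁.det ≠ 0)
    (hli₁ : ∀ a b : ℚ, a • A₁ + b • B₁ = 0 → a = 0 ∧ b = 0)
    (hli₂ : ∀ a b : ℚ, a • A₂ + b • B₂ = 0 → a = 0 ∧ b = 0)
    (han₁ : ∀ x : Fin 3 → ℚ, x ⬝ᵥ (A₁ *ᵥ x) = 0 → x ⬝ᵥ (B₁ *ᵥ x) = 0 → x = 0)
    (han₂ : ∀ x : Fin 3 → ℚ, x ⬝ᵥ (A₂ *ᵥ x) = 0 → x ⬝ᵥ (B₂ *ᵥ x) = 0 → x = 0)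
    (h₁₂ : SimRepLE A₁ B₁ A₂ B₂) (h₂₁ : SimRepLE A₂ B₂ A₁ B₁)
    (hdet : ∀ x y : ℚ, (x • A₁ - y • B₁).det = r * (x • A₂ - y • B₂).det) :
    ∃ w : Matrix (Fin 3) (Fin 3) ℚ, w.det ≠ 0 ∧
      wᵀ * (r • A₁) * w = A₂ ∧ wᵀ * (r • B₁) * w = B₂ := by
  have hd : A₁.det = r * A₂.det := by simpa using hdet 1 0
  have hr : r ≠ 0 := by
    rintro rfl
    exact hd₁ (by rw [hd, zero_mul])
  have hd₂ : A₂.det ≠ 0 := by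
    intro h
    exact hd₁ (by rw [hd, h, mul_zero])
  obtain ⟨w, h1, h2⟩ : ∃ w : Matrix (Fin 3) (Fin 3) ℚ,
      wᵀ * (r • A₁) * w = A₂ ∧ wᵀ * (r • B₁) * w = B₂ := by
    by_cases hsq : Squarefree (A₁⁻¹ * B₁).charpoly
    · exact exists_equiv_of_squarefree hA₁ hB₁ hA₂ hB₂ hd₁ hd₂ h₁₂ h₂₁ hr hdet hsq
    · exact exists_equiv_of_not_squarefree hA₁ hB₁ hA₂ hB₂ hd₁ hd₂ hli₁ hli₂ han₁ han₂ h₁₂ h₂₁ hr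
        hdet hsq
  refine ⟨w, fun h => hd₂ ?_, h1, h2⟩
  rw [← h1, det_mul, h, mul_zero]

lemma eval_detPolyXY (A B : Matrix (Fin 3) (Fin 3) ℚ) (v : Fin 2 → ℚ) :
    MvPolynomial.eval v (detPolyXY A B) = (v 0 • A - v 1 • B).det := by
  simp [detPolyXY, det_fin_three]

lemma eval_detPolyX (A B : Matrix (Fin 3) (Fin 3) ℚ) (t : ℚ) :
    (detPolyX A B).eval t = (t • A - B).det := by
  simp [detPolyX, det_fin_three]
  ring

lemma det_pencil_of_detPolyX {A₁ B₁ A₂ B₂ : Matrix (Fin 3) (Fin 3) ℚ} {r₁ r₂ : ℚ}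
    (h : r₂ • detPolyX A₁ B₁ = r₁ • detPolyX A₂ B₂) (x y : ℚ) :
    r₂ * (x • A₁ - y • B₁).det = r₁ * (x • A₂ - y • B₂).det := by
  have heval : ∀ t : ℚ, r₂ * (t • A₁ - B₁).det = r₁ * (t • A₂ - B₂).det := by
    intro t
    have := congrArg (Polynomial.eval t) h
    rwa [Polynomial.eval_smul, Polynomial.eval_smul, eval_detPolyX, eval_detPolyX] at this
  by_cases hy : y = 0
  · have hdet : ∀ A B : Matrix (Fin 3) (Fin 3) ℚ, A.det = (((2 : ℚ) • A - B).det -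
        3 * ((1 : ℚ) • A - B).det + 3 * ((0 : ℚ) • A - B).det - ((-1 : ℚ) • A - B).det) / 6 := by
      intro A B
      simp only [det_fin_three, Matrix.sub_apply, Matrix.smul_apply, smul_eq_mul]
      ring
    rw [hy, zero_smul, zero_smul, sub_zero, sub_zero, det_smul, det_smul, hdet A₁ B₁, hdet A₂ B₂]
    linear_combination (x ^ Fintype.card (Fin 3) / 6) * (heval 2 - 3 * heval 1 + 3 * heval 0 -
      heval (-1))
  · have hdet : ∀ A B : Matrix (Fin 3) (Fin 3) ℚ,
        (x • A - y • B).det = y ^ 3 * ((x / y) • A - B).det := by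
      intro A B
      rw [show x • A - y • B = y • ((x / y) • A - B) by
        rw [smul_sub, smul_smul, mul_div_cancel₀ _ hy], det_smul, Fintype.card_fin]
    rw [hdet, hdet]
    linear_combination y ^ 3 * heval (x / y)

lemma simRepLE_of_subset {A B A' B' : Matrix (Fin 3) (Fin 3) ℚ}
    (h : simRepQ A B ⊆ simRepQ A' B') : SimRepLE A B A' B' := by
  intro x
  by_cases hx : x = 0
  · exact ⟨0, by simp [hx]⟩
  · obtain ⟨y, -, h1, h2⟩ := h (show (x ⬝ᵥ (A *ᵥ x), x ⬝ᵥ (B *ᵥ x)) ∈ simRepQ A B from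
      ⟨x, hx, rfl, rfl⟩)
    exact ⟨y, h1.symm, h2.symm⟩

end

theorem stmt_0
    (A₁ B₁ A₂ B₂ : Matrix (Fin 3) (Fin 3) ℚ)
    (hsA₁ : A₁.IsSymm) (hsB₁ : B₁.IsSymm) (hsA₂ : A₂.IsSymm) (hsB₂ : B₂.IsSymm)
    -- (a) linear independence over ℚ
    (hli₁ : ∀ a b : ℚ, a • A₁ + b • B₁ = 0 → a = 0 ∧ b = 0)
    (hli₂ : ∀ a b : ℚ, a • A₂ + b • B₂ = 0 → a = 0 ∧ b = 0)
    -- (b') non-singular and anisotropic over ℚ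
    (hns₁ : detPolyXY A₁ B₁ ≠ 0)
    (hns₂ : detPolyXY A₂ B₂ ≠ 0)
    (han₁ : ∀ x : Fin 3 → ℚ, x ⬝ᵥ (A₁ *ᵥ x) = 0 → x ⬝ᵥ (B₁ *ᵥ x) = 0 → x = 0)
    (han₂ : ∀ x : Fin 3 → ℚ, x ⬝ᵥ (A₂ *ᵥ x) = 0 → x ⬝ᵥ (B₂ *ᵥ x) = 0 → x = 0)
    -- (c') equal simultaneous rational representations
    (hrep : simRepQ A₁ B₁ = simRepQ A₂ B₂)
    -- nonzero integers with r₂·det(A₁X − B₁) = r₁·det(A₂X − B₂) as polynomials in X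
    (r₁ r₂ : ℤ) (hr₁ : r₁ ≠ 0) (hr₂ : r₂ ≠ 0)
    (hdet : (r₂ : ℚ) • detPolyX A₁ B₁ = (r₁ : ℚ) • detPolyX A₂ B₂) :
    ∃ w : Matrix (Fin 3) (Fin 3) ℚ, IsUnit w.det ∧
      wᵀ * ((r₁ : ℚ) • A₁) * w = (r₂ : ℚ) • A₂ ∧
      wᵀ * ((r₁ : ℚ) • B₁) * w = (r₂ : ℚ) • B₂ := by
  have hr₂' : (r₂ : ℚ) ≠ 0 := by exact_mod_cast hr₂
  obtain ⟨v, hv⟩ : ∃ v : Fin 2 → ℚ, (v 0 • A₁ - v 1 • B₁).det ≠ 0 := by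
    by_contra! h
    refine hns₁ (MvPolynomial.funext fun v => ?_)
    rw [eval_detPolyXY, h, map_zero]
  generalize v 0 = x at hv
  generalize v 1 = y at hv
  have hxy : x ^ 2 + y ^ 2 ≠ 0 := by
    intro h
    have hx : x = 0 := by nlinarith [sq_nonneg x, sq_nonneg y]
    have hy : y = 0 := by nlinarith [sq_nonneg x, sq_nonneg y]
    simp [hx, hy] at hv
  have hsymm : ∀ {A B : Matrix (Fin 3) (Fin 3) ℚ}, A.IsSymm → B.IsSymm → ∀ x y : ℚ,
      (x • A + y • B).IsSymm := fun hA hB x y => (hA.smul x).add (hB.smul y)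
  have hli : ∀ {A B : Matrix (Fin 3) (Fin 3) ℚ},
      (∀ a b : ℚ, a • A + b • B = 0 → a = 0 ∧ b = 0) → ∀ a b : ℚ,
      a • (x • A + (-y) • B) + b • (y • A + x • B) = 0 → a = 0 ∧ b = 0 := by
    intro A B h a b hab
    obtain ⟨h1, h2⟩ := h (a * x + b * y) (b * x - a * y) (by rw [← hab]; module)
    refine ⟨(mul_eq_zero.1 ?_).resolve_left hxy, (mul_eq_zero.1 ?_).resolve_left hxy⟩
    · linear_combination x * h1 - y * h2
    · linear_combination y * h1 + x * h2
  have han : ∀ {A B : Matrix (Fin 3) (Fin 3) ℚ},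
      (∀ u : Fin 3 → ℚ, u ⬝ᵥ (A *ᵥ u) = 0 → u ⬝ᵥ (B *ᵥ u) = 0 → u = 0) → ∀ u : Fin 3 → ℚ,
      u ⬝ᵥ ((x • A + (-y) • B) *ᵥ u) = 0 → u ⬝ᵥ ((y • A + x • B) *ᵥ u) = 0 → u = 0 := by
    intro A B h u h1 h2
    simp only [add_mulVec, smul_mulVec, dotProduct_add, dotProduct_smul, smul_eq_mul] at h1 h2
    refine h u ((mul_eq_zero.1 ?_).resolve_left hxy) ((mul_eq_zero.1 ?_).resolve_left hxy)
    · linear_combination x * h1 + y * h2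
    · linear_combination x * h2 - y * h1
  obtain ⟨w, hw, hw₁, hw₂⟩ := exists_equiv_of_det_ne_zero (r := (r₁ : ℚ) / r₂)
    (hsymm hsA₁ hsB₁ x (-y)) (hsymm hsA₁ hsB₁ y x) (hsymm hsA₂ hsB₂ x (-y)) (hsymm hsA₂ hsB₂ y x)
    (by rwa [neg_smul, ← sub_eq_add_neg]) (hli hli₁) (hli hli₂) (han han₁) (han han₂)
    ((simRepLE_of_subset hrep.subset).pencil _ _ _ _)
    ((simRepLE_of_subset hrep.superset).pencil _ _ _ _) (by
      intro s t
      have hcomb : ∀ A B : Matrix (Fin 3) (Fin 3) ℚ, s • (x • A + (-y) • B) - t • (y • A + x • B) =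
          (s * x - t * y) • A - (s * y + t * x) • B := by
        intro A B
        module
      rw [hcomb, hcomb, div_mul_eq_mul_div, eq_div_iff hr₂', mul_comm]
      exact det_pencil_of_detPolyX hdet _ _)
  have hconj : ∀ {A B A' B' : Matrix (Fin 3) (Fin 3) ℚ} (p q : ℚ),
      wᵀ * (((r₁ : ℚ) / r₂) • A) * w = A' → wᵀ * (((r₁ : ℚ) / r₂) • B) * w = B' →
      wᵀ * ((r₁ : ℚ) • (p • A + q • B)) * w = (r₂ : ℚ) • (p • A' + q • B') := by
    rintro A B _ _ p q rfl rfl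
    simp only [mul_smul_comm, smul_mul_assoc, mul_add, add_mul, smul_add, smul_smul]
    congr 2 <;> field_simp
  have hA : ∀ A B : Matrix (Fin 3) (Fin 3) ℚ, A =
      (x / (x ^ 2 + y ^ 2)) • (x • A + (-y) • B) + (y / (x ^ 2 + y ^ 2)) • (y • A + x • B) := by
    intro A B
    match_scalars <;> field_simp; ring
  have hB : ∀ A B : Matrix (Fin 3) (Fin 3) ℚ, B =
      (-y / (x ^ 2 + y ^ 2)) • (x • A + (-y) • B) + (x / (x ^ 2 + y ^ 2)) • (y • A + x • B) := by
    intro A B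
    match_scalars <;> field_simp <;> ring
  refine ⟨w, hw.isUnit, ?_, ?_⟩
  · rw [hA A₁ B₁, hA A₂ B₂]
    exact hconj _ _ hw₁ hw₂
  · rw [hB A₁ B₁, hB A₂ B₂]
    exact hconj _ _ hw₁ hw₂
end

section
/- Let k be a field of characteristic ≠ 2, and let A, B be symmetric 3×3 matrices over k that are linearly independent over k, with det A ≠ 0, such that the pair (A,B) is non-singular and anisotropic over k, and such that the cubic polynomial p(X) = det(A·X − B) has no repeated root in an algebraic closure k̄ of k. For a root α ∈ k̄ of p, let K_α ⊆ k̄ denote the normal closure of k(α) over k; call the root α good if every x ∈ K_α³ with xᵀ(A·α − B)x = 0 satisfies (A·α − B)x = 0 (equivalently, the binary quadratic form C_α with A·α − B equivalent over k(α) to C_α ⊥ [0] is anisotropic over K_α). Then at least two of the three roots of p in k̄ are good, and moreover every root α with k(α) ≠ k is good. -/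
open Matrix

/-- The normal closure `K_α` of `k(α)` over `k` inside the algebraic closure, realized as the
field generated over `k` by all roots of the minimal polynomial of `α`. -/
noncomputable def normalClo (k : Type*) [Field k] (α : AlgebraicClosure k) :
    IntermediateField k (AlgebraicClosure k) :=
  IntermediateField.adjoin k ((minpoly k α).rootSet (AlgebraicClosure k))

/-- The root `α` of `det(A·X − B)` is *good* if every vector `x` with entries in the normal
closure `K_α` of `k(α)` that is isotropic for the form `A·α − B` lies in its kernel. -/
def IsGoodRoot {k : Type*} [Field k] (A B : Matrix (Fin 3) (Fin 3) k)
    (α : AlgebraicClosure k) : Prop :=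
  ∀ x : Fin 3 → AlgebraicClosure k, (∀ i, x i ∈ normalClo k α) →
    x ⬝ᵥ ((α • A.map (algebraMap k (AlgebraicClosure k))
        - B.map (algebraMap k (AlgebraicClosure k))) *ᵥ x) = 0 →
    (α • A.map (algebraMap k (AlgebraicClosure k))
        - B.map (algebraMap k (AlgebraicClosure k))) *ᵥ x = 0

section Pencil
variable {K : Type*} [Field K] {A B : Matrix (Fin 3) (Fin 3) K}

theorem dotProduct_mulVec_comm_of_isSymm {C : Matrix (Fin 3) (Fin 3) K} (hC : C.IsSymm)
    (v w : Fin 3 → K) : v ⬝ᵥ (C *ᵥ w) = w ⬝ᵥ (C *ᵥ v) := by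
  rw [dotProduct_mulVec, ← mulVec_transpose, hC.eq, dotProduct_comm]

theorem mulVec_eq_smul_of_pencil_mulVec_eq_zero {r : K} {v : Fin 3 → K}
    (h : (r • A - B) *ᵥ v = 0) : B *ᵥ v = r • (A *ᵥ v) := by
  rw [sub_mulVec, smul_mulVec, sub_eq_zero] at h
  exact h.symm

theorem pencil_orthogonal (hA : A.IsSymm) (hB : B.IsSymm) {r s : K} (hrs : r ≠ s)
    {v w : Fin 3 → K} (hv : (r • A - B) *ᵥ v = 0) (hw : (s • A - B) *ᵥ w = 0) :
    v ⬝ᵥ (A *ᵥ w) = 0 := by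
  have h := dotProduct_mulVec_comm_of_isSymm hB v w
  rw [mulVec_eq_smul_of_pencil_mulVec_eq_zero hv, mulVec_eq_smul_of_pencil_mulVec_eq_zero hw,
    dotProduct_smul, dotProduct_smul, dotProduct_mulVec_comm_of_isSymm hA w v, smul_eq_mul,
    smul_eq_mul] at h
  have h' : (r - s) * (v ⬝ᵥ (A *ᵥ w)) = 0 := by linear_combination -h
  exact (mul_eq_zero.1 h').resolve_left (sub_ne_zero.2 hrs)

theorem pencil_kernels_span (hdet : A.det ≠ 0) {r : Fin 3 → K} (hr : Function.Injective r)
    {v : Fin 3 → Fin 3 → K} (hv0 : ∀ i, v i ≠ 0) (hv : ∀ i, (r i • A - B) *ᵥ v i = 0)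
    (x : Fin 3 → K) : ∃ y : Fin 3 → K, x = ∑ i, y i • v i := by
  have hli : LinearIndependent K v := by
    refine Module.End.eigenvectors_linearIndependent' (toLin' (A⁻¹ * B)) r hr v fun i => ?_
    refine ⟨Module.End.mem_eigenspace_iff.2 ?_, hv0 i⟩
    rw [toLin'_apply, ← mulVec_mulVec, mulVec_eq_smul_of_pencil_mulVec_eq_zero (hv i),
      mulVec_smul, mulVec_mulVec, nonsing_inv_mul _ (isUnit_iff_ne_zero.2 hdet), one_mulVec]
  let b := basisOfLinearIndependentOfCardEqFinrank hli (by simp)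
  refine ⟨b.repr x, ?_⟩
  conv_lhs => rw [← b.sum_repr x]
  simp [b]

theorem pencil_kernel_anisotropic (hA : A.IsSymm) (hB : B.IsSymm) (hdet : A.det ≠ 0)
    {r : Fin 3 → K} (hr : Function.Injective r)
    {v : Fin 3 → Fin 3 → K} (hv0 : ∀ i, v i ≠ 0) (hv : ∀ i, (r i • A - B) *ᵥ v i = 0)
    (i : Fin 3) : v i ⬝ᵥ (A *ᵥ v i) ≠ 0 := by
  intro h
  have key : ∀ x, x ⬝ᵥ (A *ᵥ v i) = 0 := by
    intro x
    obtain ⟨y, rfl⟩ := pencil_kernels_span hdet hr hv0 hv x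
    rw [sum_dotProduct]
    refine Finset.sum_eq_zero fun j _ => ?_
    rw [smul_dotProduct]
    by_cases hij : j = i
    · rw [hij, h, smul_zero]
    · rw [pencil_orthogonal hA hB (hr.ne hij) (hv j) (hv i), smul_zero]
  have hz : A *ᵥ v i = 0 := by
    ext j
    simpa using key (Pi.single j 1)
  exact hv0 i (eq_zero_of_mulVec_eq_zero hdet hz)

theorem pencil_form_sum (hA : A.IsSymm) (hB : B.IsSymm)
    {r : Fin 3 → K} (hr : Function.Injective r)
    {v : Fin 3 → Fin 3 → K} (hv : ∀ i, (r i • A - B) *ᵥ v i = 0) (y : Fin 3 → K) :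
    (∑ i, y i • v i) ⬝ᵥ (A *ᵥ ∑ i, y i • v i) = ∑ i, y i ^ 2 * (v i ⬝ᵥ (A *ᵥ v i)) ∧
    (∑ i, y i • v i) ⬝ᵥ (B *ᵥ ∑ i, y i • v i) =
      ∑ i, r i * y i ^ 2 * (v i ⬝ᵥ (A *ᵥ v i)) := by
  have ho : ∀ i j, i ≠ j → v i ⬝ᵥ (A *ᵥ v j) = 0 := fun i j hij =>
    pencil_orthogonal hA hB (hr.ne hij) (hv i) (hv j)
  constructor
  · rw [sum_dotProduct]
    refine Finset.sum_congr rfl fun i _ => ?_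
    rw [mulVec_sum, dotProduct_sum, Finset.sum_eq_single i]
    · simp only [mulVec_smul, smul_dotProduct, dotProduct_smul, smul_eq_mul]; ring
    · intro j _ hj
      simp [mulVec_smul, ho i j hj.symm]
    · simp
  · rw [sum_dotProduct]
    refine Finset.sum_congr rfl fun i _ => ?_
    rw [mulVec_sum, dotProduct_sum, Finset.sum_eq_single i]
    · simp only [mulVec_smul, smul_dotProduct, dotProduct_smul, smul_eq_mul,
        mulVec_eq_smul_of_pencil_mulVec_eq_zero (hv i)]; ring
    · intro j _ hj
      simp [mulVec_smul, mulVec_eq_smul_of_pencil_mulVec_eq_zero (hv j), ho i j hj.symm]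
    · simp

/-- An isotropic vector of the degenerate form `r 0 • A - B` outside its kernel makes minus the
discriminant of the nondegenerate binary part a square. -/
theorem exists_sq_of_isotropic (hA : A.IsSymm) (hB : B.IsSymm) (hdet : A.det ≠ 0)
    {r : Fin 3 → K} (hr : Function.Injective r)
    {v : Fin 3 → Fin 3 → K} (hv0 : ∀ i, v i ≠ 0) (hv : ∀ i, (r i • A - B) *ᵥ v i = 0)
    {x : Fin 3 → K} (hx : x ⬝ᵥ ((r 0 • A - B) *ᵥ x) = 0) (hx' : (r 0 • A - B) *ᵥ x ≠ 0) :
    ∃ m : K, m ^ 2 = (r 0 - r 1) * (r 2 - r 0) * (v 1 ⬝ᵥ (A *ᵥ v 1)) * (v 2 ⬝ᵥ (A *ᵥ v 2)) := by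
  obtain ⟨y, rfl⟩ := pencil_kernels_span hdet hr hv0 hv x
  have ha := pencil_kernel_anisotropic hA hB hdet hr hv0 hv
  obtain ⟨h1, h2⟩ := pencil_form_sum hA hB hr hv y
  rw [sub_mulVec, smul_mulVec, dotProduct_sub, dotProduct_smul, h1, h2] at hx
  simp only [Fin.sum_univ_three, smul_eq_mul] at hx
  have h01 : r 0 - r 1 ≠ 0 := sub_ne_zero.2 (hr.ne (by decide))
  have hy2 : y 2 ≠ 0 := by
    intro h
    have h' : (r 0 - r 1) * (v 1 ⬝ᵥ (A *ᵥ v 1)) * y 1 ^ 2 = 0 := by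
      rw [h] at hx; linear_combination hx
    have hy1 : y 1 = 0 := by simpa [h01, ha 1] using h'
    apply hx'
    simp [Fin.sum_univ_three, h, hy1, mulVec_smul, hv 0]
  refine ⟨(r 0 - r 1) * (v 1 ⬝ᵥ (A *ᵥ v 1)) * y 1 / y 2, ?_⟩
  rw [div_pow, div_eq_iff (pow_ne_zero 2 hy2)]
  linear_combination (r 0 - r 1) * (v 1 ⬝ᵥ (A *ᵥ v 1)) * hx

theorem common_zero_of_sq (hA : A.IsSymm) (hB : B.IsSymm)
    {r : Fin 3 → K} (hr : Function.Injective r)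
    {v : Fin 3 → Fin 3 → K} (hv : ∀ i, (r i • A - B) *ᵥ v i = 0)
    {y : Fin 3 → K} {s : K} (hs : s ≠ 0)
    (h0 : y 0 ^ 2 * (v 0 ⬝ᵥ (A *ᵥ v 0)) = s * (r 1 - r 2))
    (h1 : y 1 ^ 2 * (v 1 ⬝ᵥ (A *ᵥ v 1)) = s * (r 2 - r 0))
    (h2 : y 2 ^ 2 * (v 2 ⬝ᵥ (A *ᵥ v 2)) = s * (r 0 - r 1)) :
    (∑ i, y i • v i) ⬝ᵥ (A *ᵥ ∑ i, y i • v i) = 0 ∧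
    (∑ i, y i • v i) ⬝ᵥ (B *ᵥ ∑ i, y i • v i) = 0 ∧ ∑ i, y i • v i ≠ 0 := by
  obtain ⟨hqA, hqB⟩ := pencil_form_sum hA hB hr hv y
  refine ⟨?_, ?_, fun h => ?_⟩
  · rw [hqA, Fin.sum_univ_three, h0, h1, h2]; ring
  · rw [hqB, Fin.sum_univ_three, mul_assoc, mul_assoc, mul_assoc, h0, h1, h2]; ring
  · have h3 : v 0 ⬝ᵥ (A *ᵥ ∑ i, y i • v i) = y 0 * (v 0 ⬝ᵥ (A *ᵥ v 0)) := by
      simp [Fin.sum_univ_three, mulVec_add, mulVec_smul, dotProduct_add,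
        pencil_orthogonal hA hB (hr.ne (show (0 : Fin 3) ≠ 1 by decide)) (hv 0) (hv 1),
        pencil_orthogonal hA hB (hr.ne (show (0 : Fin 3) ≠ 2 by decide)) (hv 0) (hv 2)]
    rw [h, mulVec_zero, dotProduct_zero] at h3
    have h4 : s * (r 1 - r 2) = 0 := by rw [← h0]; linear_combination -y 0 * h3
    exact mul_ne_zero hs (sub_ne_zero.2 (hr.ne (by decide))) h4

/-- If two of the three degenerate forms of a pencil are isotropic modulo their kernels, the pencil
has a nontrivial common zero. -/
theorem common_zero_of_two_isotropic (hA : A.IsSymm) (hB : B.IsSymm) (hdet : A.det ≠ 0)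
    {r : Fin 3 → K} (hr : Function.Injective r)
    {v : Fin 3 → Fin 3 → K} (hv0 : ∀ i, v i ≠ 0) (hv : ∀ i, (r i • A - B) *ᵥ v i = 0)
    {i j : Fin 3} (hij : i ≠ j) {x z : Fin 3 → K}
    (hx : x ⬝ᵥ ((r i • A - B) *ᵥ x) = 0) (hx' : (r i • A - B) *ᵥ x ≠ 0)
    (hz : z ⬝ᵥ ((r j • A - B) *ᵥ z) = 0) (hz' : (r j • A - B) *ᵥ z ≠ 0) :
    ∃ w : Fin 3 → K, w ⬝ᵥ (A *ᵥ w) = 0 ∧ w ⬝ᵥ (B *ᵥ w) = 0 ∧ w ≠ 0 := by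
  obtain ⟨e, rfl, rfl⟩ : ∃ e : Equiv.Perm (Fin 3), e 0 = i ∧ e 1 = j := by
    clear hx hx' hz hz'
    revert i j
    decide
  obtain ⟨m, hm⟩ := exists_sq_of_isotropic hA hB hdet (hr.comp e.injective)
    (fun i => hv0 (e i)) (fun i => hv (e i)) hx hx'
  obtain ⟨n, hn⟩ := exists_sq_of_isotropic hA hB hdet
    (r := r ∘ e ∘ Equiv.swap 0 1) (v := v ∘ e ∘ Equiv.swap 0 1)
    (hr.comp (e.injective.comp (Equiv.injective _)))
    (fun i => hv0 _) (fun i => hv _) (x := z) (by simpa using hz) (by simpa using hz')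
  have ha := pencil_kernel_anisotropic hA hB hdet hr hv0 hv
  have h21 : Equiv.swap (0 : Fin 3) 1 2 = 2 := by decide
  simp only [Function.comp_apply, Equiv.swap_apply_left, Equiv.swap_apply_right, h21] at hm hn
  set a : Fin 3 → K := fun i => v (e i) ⬝ᵥ (A *ᵥ v (e i)) with hadef
  have ha' : ∀ i, a i ≠ 0 := fun i => ha (e i)
  change m ^ 2 = _ * a 1 * a 2 at hm
  change n ^ 2 = _ * a 0 * a 2 at hn
  refine ⟨_, common_zero_of_sq hA hB (hr.comp e.injective)
    (v := v ∘ e) (fun i => hv (e i))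
    (y := ![n * a 1, m * a 0, (r (e 0) - r (e 1)) * a 0 * a 1])
    (s := a 2 * (r (e 0) - r (e 1)) * a 0 ^ 2 * a 1 ^ 2) ?_ ?_ ?_ ?_⟩
  · have h01 : r (e 0) - r (e 1) ≠ 0 := sub_ne_zero.2 (hr.ne (e.injective.ne (by decide)))
    exact mul_ne_zero (mul_ne_zero (mul_ne_zero (ha' 2) h01) (pow_ne_zero _ (ha' 0)))
      (pow_ne_zero _ (ha' 1))
  · change (n * a 1) ^ 2 * a 0 = _ * (r (e 1) - r (e 2))
    linear_combination a 1 ^ 2 * a 0 * hn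
  · change (m * a 0) ^ 2 * a 1 = _ * (r (e 2) - r (e 0))
    linear_combination a 0 ^ 2 * a 1 * hm
  · change ((r (e 0) - r (e 1)) * a 0 * a 1) ^ 2 * a 2 = _ * (r (e 0) - r (e 1))
    ring

end Pencil

section Descent
variable {k K : Type*} [Field k] [Field K] [Algebra k K] {A B : Matrix (Fin 3) (Fin 3) k}

theorem map_pencil_mulVec (C D : Matrix (Fin 3) (Fin 3) k) (σ : K ≃ₐ[k] K) (r : K)
    (v : Fin 3 → K) (i : Fin 3) :
    σ (((r • C.map (algebraMap k K) - D.map (algebraMap k K)) *ᵥ v) i) =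
      ((σ r • C.map (algebraMap k K) - D.map (algebraMap k K)) *ᵥ fun i => σ (v i)) i := by
  simp [mulVec, dotProduct]

theorem map_dotProduct_mulVec (C : Matrix (Fin 3) (Fin 3) k) (σ : K ≃ₐ[k] K)
    (v w : Fin 3 → K) :
    σ (v ⬝ᵥ (C.map (algebraMap k K) *ᵥ w)) =
      (fun i => σ (v i)) ⬝ᵥ (C.map (algebraMap k K) *ᵥ fun i => σ (w i)) := by
  simp [mulVec, dotProduct]

theorem pencil_mulVec_conj_eq_zero (σ : K ≃ₐ[k] K) {r : K} {v : Fin 3 → K}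
    (hv : (r • A.map (algebraMap k K) - B.map (algebraMap k K)) *ᵥ v = 0) :
    (σ r • A.map (algebraMap k K) - B.map (algebraMap k K)) *ᵥ (fun i => σ (v i)) = 0 := by
  ext i
  rw [← map_pencil_mulVec, hv]
  simp

/-- A degenerate member of the pencil has a kernel vector with entries in `k(r)`. -/
theorem exists_kernel_vector_fixed {r : K}
    (hr : (r • A.map (algebraMap k K) - B.map (algebraMap k K)).det = 0) :
    ∃ v : Fin 3 → K, v ≠ 0 ∧
      (r • A.map (algebraMap k K) - B.map (algebraMap k K)) *ᵥ v = 0 ∧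
      ∀ σ : K ≃ₐ[k] K, σ r = r → ∀ i, σ (v i) = v i := by
  let F := IntermediateField.adjoin k {r}
  let g : F := IntermediateField.AdjoinSimple.gen k r
  let N : Matrix (Fin 3) (Fin 3) F := g • A.map (algebraMap k F) - B.map (algebraMap k F)
  have hN : (algebraMap F K).mapMatrix N =
      r • A.map (algebraMap k K) - B.map (algebraMap k K) := by
    ext i j
    simp [N, g]
  have hdN : N.det = 0 := by
    apply (algebraMap F K).injective
    rw [RingHom.map_det, hN, hr, map_zero]
  obtain ⟨v, hv0, hv⟩ := exists_mulVec_eq_zero_iff.2 hdN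
  refine ⟨fun i => algebraMap F K (v i), ?_, ?_, ?_⟩
  · intro h
    apply hv0
    ext i
    exact congrArg _ ((algebraMap F K).injective ((congrFun h i).trans (map_zero _).symm))
  · rw [← hN]
    ext i
    have := RingHom.map_mulVec (algebraMap F K) N v i
    rw [hv] at this
    simpa [Function.comp_def] using this.symm
  · intro σ hσ i
    have h := IntermediateField.algHom_ext_of_eq_adjoin (S := F) (s := {r}) _ rfl
      (φ₁ := (σ : K →ₐ[k] K).comp F.val) (φ₂ := F.val)
      (by rintro x hx; obtain rfl := Set.mem_singleton_iff.1 hx; exact hσ)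
    exact DFunLike.congr_fun h (v i)

theorem exists_rational_zero [FiniteDimensional k K] [IsGalois k K] {w : Fin 3 → K}
    (hw : ∀ (σ : K ≃ₐ[k] K) i, σ (w i) = w i)
    (hwAB : w ⬝ᵥ (A.map (algebraMap k K) *ᵥ w) = 0 ∧
      w ⬝ᵥ (B.map (algebraMap k K) *ᵥ w) = 0 ∧ w ≠ 0) :
    ∃ x : Fin 3 → k, x ⬝ᵥ (A *ᵥ x) = 0 ∧ x ⬝ᵥ (B *ᵥ x) = 0 ∧ x ≠ 0 := by
  have h : ∀ i, ∃ c, algebraMap k K c = w i := fun i =>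
    (IsGalois.mem_range_algebraMap_iff_fixed (w i)).2 fun σ => hw σ i
  choose x hx using h
  obtain rfl : (fun i => algebraMap k K (x i)) = w := funext hx
  obtain ⟨hwA, hwB, hw0⟩ := hwAB
  have key : ∀ C : Matrix (Fin 3) (Fin 3) k, (fun i => algebraMap k K (x i)) ⬝ᵥ
      (C.map (algebraMap k K) *ᵥ fun i => algebraMap k K (x i)) =
        algebraMap k K (x ⬝ᵥ (C *ᵥ x)) := fun C => by
    simp [mulVec, dotProduct]
  rw [key, map_eq_zero] at hwA hwB
  refine ⟨x, hwA, hwB, ?_⟩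
  rintro rfl
  exact hw0 (by ext; simp)

theorem exists_rational_zero_of_involution [FiniteDimensional k K] [IsGalois k K]
    (hA : A.IsSymm) (hB : B.IsSymm) (hdet : A.det ≠ 0)
    {r : Fin 3 → K} (hr : Function.Injective r)
    (hroot : ∀ i, (r i • A.map (algebraMap k K) - B.map (algebraMap k K)).det = 0)
    (hfaith : ∀ τ : K ≃ₐ[k] K, (∀ i, τ (r i) = r i) → τ = 1)
    {σ : K ≃ₐ[k] K} (h0 : σ (r 0) = r 1) (h1 : σ (r 1) = r 0) (h2 : σ (r 2) = r 2)
    (hgroup : ∀ τ : K ≃ₐ[k] K, τ = 1 ∨ τ = σ)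
    {x : Fin 3 → K}
    (hx : x ⬝ᵥ ((r 0 • A.map (algebraMap k K) - B.map (algebraMap k K)) *ᵥ x) = 0)
    (hx' : (r 0 • A.map (algebraMap k K) - B.map (algebraMap k K)) *ᵥ x ≠ 0) :
    ∃ x : Fin 3 → k, x ⬝ᵥ (A *ᵥ x) = 0 ∧ x ⬝ᵥ (B *ᵥ x) = 0 ∧ x ≠ 0 := by
  have hA' : (A.map (algebraMap k K)).IsSymm := hA.map _
  have hB' : (B.map (algebraMap k K)).IsSymm := hB.map _
  have hdet' : (A.map (algebraMap k K)).det ≠ 0 := by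
    have := RingHom.map_det (algebraMap k K) A
    rw [RingHom.mapMatrix_apply] at this
    rw [← this]
    simpa using hdet
  have hσσ : ∀ z, σ (σ z) = z := by
    have : σ * σ = 1 := hfaith _ fun i => by fin_cases i <;> simp [h0, h1, h2]
    exact fun z => DFunLike.congr_fun this z
  obtain ⟨u, hu0, hu, -⟩ := exists_kernel_vector_fixed (hroot 0)
  obtain ⟨w, hw0, hw, hwfix⟩ := exists_kernel_vector_fixed (hroot 2)
  let v : Fin 3 → Fin 3 → K := ![u, fun i => σ (u i), w]
  have hv0 : ∀ i, v i ≠ 0 := by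
    intro i
    fin_cases i
    · exact hu0
    · intro h
      apply hu0
      ext j
      simpa [v] using congrFun h j
    · exact hw0
  have hv : ∀ i, (r i • A.map (algebraMap k K) - B.map (algebraMap k K)) *ᵥ v i = 0 := by
    intro i
    fin_cases i
    · exact hu
    · have := pencil_mulVec_conj_eq_zero σ hu
      rw [h0] at this
      exact this
    · exact hw
  obtain ⟨m, hm⟩ := exists_sq_of_isotropic hA' hB' hdet' hr hv0 hv hx hx'
  have ha := pencil_kernel_anisotropic hA' hB' hdet' hr hv0 hv
  set a : Fin 3 → K := fun i => v i ⬝ᵥ (A.map (algebraMap k K) *ᵥ v i) with hadef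
  have ha0 : σ (a 0) = a 1 := map_dotProduct_mulVec A σ u u
  have ha1 : σ (a 1) = a 0 := by rw [← ha0, hσσ]
  have ha2 : σ (a 2) = a 2 := by
    refine (map_dotProduct_mulVec A σ w w).trans ?_
    simp only [hwfix σ h2]
    rfl
  change m ^ 2 = _ * a 1 * a 2 at hm
  have hn : σ m ^ 2 = (r 1 - r 0) * (r 2 - r 1) * a 0 * a 2 := by
    rw [← map_pow, hm]
    simp only [map_mul, map_sub, h0, h1, h2, ha1, ha2]
  refine exists_rational_zero ?_ (common_zero_of_sq hA' hB' hr hv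
    (y := ![σ m * a 1 * (r 0 - r 1), m * a 0 * (r 1 - r 0), a 0 * a 1 * (r 0 - r 1) ^ 2])
    (s := a 2 * a 0 ^ 2 * a 1 ^ 2 * (r 0 - r 1) ^ 3) ?_ ?_ ?_ ?_)
  · intro τ i
    obtain rfl | rfl := hgroup τ
    · rfl
    · simp [Fin.sum_univ_three, v, h0, h1, ha0, ha1, hσσ, hwfix τ h2]
      ring
  · have h01 : r 0 - r 1 ≠ 0 := sub_ne_zero.2 (hr.ne (by decide))
    exact mul_ne_zero (mul_ne_zero (mul_ne_zero (ha 2) (pow_ne_zero _ (ha 0)))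
      (pow_ne_zero _ (ha 1))) (pow_ne_zero _ h01)
  · change (σ m * a 1 * (r 0 - r 1)) ^ 2 * a 0 = _
    linear_combination a 1 ^ 2 * a 0 * (r 0 - r 1) ^ 2 * hn
  · change (m * a 0 * (r 1 - r 0)) ^ 2 * a 1 = _
    linear_combination a 0 ^ 2 * a 1 * (r 0 - r 1) ^ 2 * hm
  · change (a 0 * a 1 * (r 0 - r 1) ^ 2) ^ 2 * a 2 = _
    ring

theorem exists_rational_zero_of_cyclic (hchar : (2 : k) ≠ 0)
    [FiniteDimensional k K] [IsGalois k K]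
    (hA : A.IsSymm) (hB : B.IsSymm) (hdet : A.det ≠ 0)
    {r : Fin 3 → K} (hr : Function.Injective r)
    (hroot : ∀ i, (r i • A.map (algebraMap k K) - B.map (algebraMap k K)).det = 0)
    (hperm : ∀ (τ : K ≃ₐ[k] K) i, ∃ j, τ (r i) = r j)
    (hfaith : ∀ τ : K ≃ₐ[k] K, (∀ i, τ (r i) = r i) → τ = 1)
    {σ : K ≃ₐ[k] K} (h0 : σ (r 0) = r 1) (h1 : σ (r 1) = r 2) (h2 : σ (r 2) = r 0)
    {x : Fin 3 → K}
    (hx : x ⬝ᵥ ((r 0 • A.map (algebraMap k K) - B.map (algebraMap k K)) *ᵥ x) = 0)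
    (hx' : (r 0 • A.map (algebraMap k K) - B.map (algebraMap k K)) *ᵥ x ≠ 0) :
    ∃ x : Fin 3 → k, x ⬝ᵥ (A *ᵥ x) = 0 ∧ x ⬝ᵥ (B *ᵥ x) = 0 ∧ x ≠ 0 := by
  have hA' : (A.map (algebraMap k K)).IsSymm := hA.map _
  have hB' : (B.map (algebraMap k K)).IsSymm := hB.map _
  have hdet' : (A.map (algebraMap k K)).det ≠ 0 := by
    have := RingHom.map_det (algebraMap k K) A
    rw [RingHom.mapMatrix_apply] at this
    rw [← this]
    simpa using hdet
  have h2K : (2 : K) ≠ 0 := by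
    have := (map_ne_zero (algebraMap k K)).2 hchar
    rwa [map_ofNat] at this
  have hσ3 : ∀ z, σ (σ (σ z)) = z := by
    have : σ * σ * σ = 1 := hfaith _ fun i => by fin_cases i <;> simp [h0, h1, h2]
    exact fun z => DFunLike.congr_fun this z
  obtain ⟨u, hu0, hu, hufix⟩ := exists_kernel_vector_fixed (hroot 0)
  let v : Fin 3 → Fin 3 → K := ![u, fun i => σ (u i), fun i => σ (σ (u i))]
  have hv0 : ∀ i, v i ≠ 0 := by
    intro i h
    apply hu0
    ext j
    fin_cases i <;> simpa [v] using congrFun h j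
  have hv : ∀ i, (r i • A.map (algebraMap k K) - B.map (algebraMap k K)) *ᵥ v i = 0 := by
    have hv1 := pencil_mulVec_conj_eq_zero σ hu
    have hv2 := pencil_mulVec_conj_eq_zero σ hv1
    rw [h0] at hv1 hv2
    rw [h1] at hv2
    intro i
    fin_cases i
    exacts [hu, hv1, hv2]
  obtain ⟨m, hm⟩ := exists_sq_of_isotropic hA' hB' hdet' hr hv0 hv hx hx'
  have ha := pencil_kernel_anisotropic hA' hB' hdet' hr hv0 hv
  set a : Fin 3 → K := fun i => v i ⬝ᵥ (A.map (algebraMap k K) *ᵥ v i) with hadef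
  have ha0 : σ (a 0) = a 1 := map_dotProduct_mulVec A σ _ _
  have ha1 : σ (a 1) = a 2 := map_dotProduct_mulVec A σ _ _
  have ha2 : σ (a 2) = a 0 := by rw [← ha1, ← ha0, hσ3]
  change m ^ 2 = _ * a 1 * a 2 at hm
  have h01 : r 0 - r 1 ≠ 0 := sub_ne_zero.2 (hr.ne (by decide))
  have h12 : r 1 - r 2 ≠ 0 := sub_ne_zero.2 (hr.ne (by decide))
  have h20 : r 2 - r 0 ≠ 0 := sub_ne_zero.2 (hr.ne (by decide))
  obtain ⟨y, hy⟩ : ∃ y, y = (r 1 - r 2) * m := ⟨_, rfl⟩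
  obtain ⟨s, hs⟩ : ∃ s, s = a 0 * a 1 * a 2 * ((r 0 - r 1) * (r 1 - r 2) * (r 2 - r 0)) :=
    ⟨_, rfl⟩
  have hs0 : s ≠ 0 := hs ▸ mul_ne_zero (mul_ne_zero (mul_ne_zero (ha 0) (ha 1)) (ha 2))
    (mul_ne_zero (mul_ne_zero h01 h12) h20)
  have hσs : σ s = s := by
    rw [hs]
    simp only [map_mul, map_sub, h0, h1, h2, ha0, ha1, ha2]
    ring
  have hy0 : y ^ 2 * a 0 = s * (r 1 - r 2) := by
    rw [hy, hs]; linear_combination (r 1 - r 2) ^ 2 * a 0 * hm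
  have hy1 : σ y ^ 2 * a 1 = s * (r 2 - r 0) := by
    simpa only [map_mul, map_pow, map_sub, h1, h2, ha0, hσs] using congrArg σ hy0
  have hy2 : σ (σ y) ^ 2 * a 2 = s * (r 0 - r 1) := by
    simpa only [map_mul, map_pow, map_sub, h0, h2, ha1, hσs] using congrArg σ hy1
  have hyne : y ≠ 0 := by
    rintro h
    rw [h] at hy0
    exact mul_ne_zero hs0 h12 (by rw [← hy0]; ring)
  have hnorm : y * σ y * σ (σ y) =
        a 0 * a 1 * a 2 * ((r 0 - r 1) * (r 1 - r 2) * (r 2 - r 0)) ^ 2 ∨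
      y * σ y * σ (σ y) =
        -(a 0 * a 1 * a 2 * ((r 0 - r 1) * (r 1 - r 2) * (r 2 - r 0)) ^ 2) := by
    rw [← sq_eq_sq_iff_eq_or_eq_neg]
    apply mul_right_cancel₀ (mul_ne_zero (mul_ne_zero (ha 0) (ha 1)) (ha 2))
    calc (y * σ y * σ (σ y)) ^ 2 * (a 0 * a 1 * a 2)
        = (y ^ 2 * a 0) * (σ y ^ 2 * a 1) * (σ (σ y) ^ 2 * a 2) := by ring
      _ = _ := by rw [hy0, hy1, hy2, hs]; ring
  have hstab : ∀ τ : K ≃ₐ[k] K, τ (r 0) = r 0 → τ (r 1) = r 2 → τ (r 2) = r 1 → τ y = y ∧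
      (∀ z, τ (σ z) = σ (σ (τ z))) ∧ (∀ z, τ (σ (σ z)) = σ (τ z)) := by
    intro τ t0 t1 t2
    have hτσ : ∀ z, τ (σ z) = σ (σ (τ z)) := by
      have : σ * (τ * σ) = τ := by
        rw [← mul_inv_eq_one]
        have i0 : τ⁻¹ (r 0) = r 0 := by rw [AlgEquiv.aut_inv, AlgEquiv.symm_apply_eq, t0]
        have i1 : τ⁻¹ (r 1) = r 2 := by rw [AlgEquiv.aut_inv, AlgEquiv.symm_apply_eq, t2]
        have i2 : τ⁻¹ (r 2) = r 1 := by rw [AlgEquiv.aut_inv, AlgEquiv.symm_apply_eq, t1]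
        refine hfaith _ fun i => ?_
        fin_cases i <;> simp [i0, i1, i2, h0, h1, h2, t0, t1, t2]
      intro z
      have hz : σ (τ (σ z)) = τ z := DFunLike.congr_fun this z
      rw [← hz, hσ3]
    have hτσσ : ∀ z, τ (σ (σ z)) = σ (τ z) := fun z => by rw [hτσ, hτσ, hσ3]
    refine ⟨?_, hτσ, hτσσ⟩
    have ta0 : τ (a 0) = a 0 := by
      refine (map_dotProduct_mulVec A τ u u).trans ?_
      simp only [hufix τ t0]
      rfl
    have ta1 : τ (a 1) = a 2 := by rw [← ha0, hτσ, ta0, ha0, ha1]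
    have ta2 : τ (a 2) = a 1 := by rw [← ha1, ← ha0, hτσσ, ta0]
    have hsq : τ y ^ 2 = y ^ 2 := by
      apply mul_right_cancel₀ (ha 0)
      have h := congrArg τ hy0
      rw [hs] at h hy0
      simp only [map_mul, map_pow, map_sub, t0, t1, t2, ta0, ta1, ta2] at h
      linear_combination h - hy0
    refine (sq_eq_sq_iff_eq_or_eq_neg.1 hsq).resolve_right fun hneg => ?_
    have hfix : τ (y * σ y * σ (σ y)) = y * σ y * σ (σ y) := by
      rcases hnorm with h | h <;> rw [h] <;>
        simp only [map_mul, map_pow, map_sub, map_neg, t0, t1, t2, ta0, ta1, ta2] <;> ring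
    rw [map_mul, map_mul, hτσσ, hτσ, hneg, map_neg, map_neg] at hfix
    have hP : y * σ y * σ (σ y) ≠ 0 := by simp [hyne]
    exact mul_ne_zero h2K hP (by linear_combination -hfix)
  refine exists_rational_zero ?_ (common_zero_of_sq hA' hB' hr hv
    (y := ![y, σ y, σ (σ y)]) hs0 hy0 hy1 hy2)
  have hw : ∀ i, (∑ j, (![y, σ y, σ (σ y)] : Fin 3 → K) j • v j) i =
      y * u i + σ (y * u i) + σ (σ (y * u i)) := by
    intro i
    simp [Fin.sum_univ_three, v]
  set w := ∑ j, (![y, σ y, σ (σ y)] : Fin 3 → K) j • v j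
  have hσw : ∀ i, σ (w i) = w i := by
    intro i
    rw [hw, map_add, map_add, hσ3]
    ring
  have hfix0 : ∀ τ : K ≃ₐ[k] K, τ (r 0) = r 0 → ∀ i, τ (w i) = w i := by
    intro τ t0 i
    have hne : ∀ {i j : Fin 3}, i ≠ j → τ (r i) ≠ τ (r j) := fun hij =>
      τ.injective.ne (hr.ne hij)
    have n1 := hne (show (1 : Fin 3) ≠ 0 by decide)
    have n2 := hne (show (2 : Fin 3) ≠ 0 by decide)
    have n3 := hne (show (1 : Fin 3) ≠ 2 by decide)
    obtain ⟨i1, e1⟩ := hperm τ 1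
    obtain ⟨i2, e2⟩ := hperm τ 2
    rw [e1, t0] at n1
    rw [e2, t0] at n2
    rw [e1, e2] at n3
    have hcases : (i1 = 1 ∧ i2 = 2) ∨ (i1 = 2 ∧ i2 = 1) := by
      have c1 : i1 ≠ 0 := fun h => n1 (h ▸ rfl)
      have c2 : i2 ≠ 0 := fun h => n2 (h ▸ rfl)
      have c3 : i1 ≠ i2 := fun h => n3 (h ▸ rfl)
      clear e1 e2 n1 n2 n3
      revert i1 i2
      decide
    obtain ⟨rfl, rfl⟩ | ⟨rfl, rfl⟩ := hcases
    · have : τ = 1 := hfaith τ fun i => by fin_cases i <;> assumption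
      rw [this]
      rfl
    · obtain ⟨ty, tσ, tσσ⟩ := hstab τ t0 e1 e2
      rw [hw, map_add, map_add, tσ, tσσ, map_mul, ty, hufix τ t0]
      ring
  intro τ i
  obtain ⟨j, hj⟩ := hperm τ 0
  fin_cases j
  · exact hfix0 τ hj i
  · have h := hfix0 (σ * (σ * τ)) (by simp [hj, h1, h2]) i
    apply σ.injective
    apply σ.injective
    rw [hσw, hσw]
    exact h
  · have h := hfix0 (σ * τ) (by simp [hj, h2]) i
    apply σ.injective
    rw [hσw]
    exact h

/-- If the degenerate form at an irrational root is isotropic modulo its kernel over the Galois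
extension generated by the roots, the pencil has a nontrivial rational common zero. -/
theorem exists_rational_zero_of_isotropic (hchar : (2 : k) ≠ 0)
    [FiniteDimensional k K] [IsGalois k K]
    (hA : A.IsSymm) (hB : B.IsSymm) (hdet : A.det ≠ 0)
    {r : Fin 3 → K} (hr : Function.Injective r)
    (hroot : ∀ i, (r i • A.map (algebraMap k K) - B.map (algebraMap k K)).det = 0)
    (hperm : ∀ (τ : K ≃ₐ[k] K) i, ∃ j, τ (r i) = r j)
    (hfaith : ∀ τ : K ≃ₐ[k] K, (∀ i, τ (r i) = r i) → τ = 1)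
    (hr0 : r 0 ∉ Set.range (algebraMap k K))
    {x : Fin 3 → K}
    (hx : x ⬝ᵥ ((r 0 • A.map (algebraMap k K) - B.map (algebraMap k K)) *ᵥ x) = 0)
    (hx' : (r 0 • A.map (algebraMap k K) - B.map (algebraMap k K)) *ᵥ x ≠ 0) :
    ∃ x : Fin 3 → k, x ⬝ᵥ (A *ᵥ x) = 0 ∧ x ⬝ᵥ (B *ᵥ x) = 0 ∧ x ≠ 0 := by
  have hact : ∀ τ : K ≃ₐ[k] K, ∃ e : Equiv.Perm (Fin 3), ∀ i, τ (r i) = r (e i) := by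
    intro τ
    choose f hf using hperm τ
    have hinj : Function.Injective f := fun i j hij =>
      hr (τ.injective (by rw [hf, hf, hij]))
    exact ⟨Equiv.ofBijective f (Finite.injective_iff_bijective.1 hinj), hf⟩
  have cyc : ∀ (σ : K ≃ₐ[k] K) (e : Equiv.Perm (Fin 3)), e 0 = 0 → σ (r (e 0)) = r (e 1) →
      σ (r (e 1)) = r (e 2) → σ (r (e 2)) = r (e 0) →
      ∃ x : Fin 3 → k, x ⬝ᵥ (A *ᵥ x) = 0 ∧ x ⬝ᵥ (B *ᵥ x) = 0 ∧ x ≠ 0 := by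
    intro σ e he h0 h1 h2
    refine exists_rational_zero_of_cyclic hchar hA hB hdet (r := r ∘ e)
      (hr.comp e.injective) (fun i => hroot (e i)) (fun τ i => ?_) (fun τ h => ?_) h0 h1 h2
      (x := x) (by simpa [he] using hx) (by simpa [he] using hx')
    · obtain ⟨j, hj⟩ := hperm τ (e i)
      exact ⟨e.symm j, by simpa using hj⟩
    · exact hfaith τ fun i => by simpa using h (e.symm i)
  by_contra hcon
  have nocyc : ∀ (τ : K ≃ₐ[k] K) (f : Equiv.Perm (Fin 3)), (∀ i, τ (r i) = r (f i)) →
      ¬ (f 0 ≠ 0 ∧ f 1 ≠ 1 ∧ f 2 ≠ 2) := by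
    rintro τ f hf hne
    obtain ⟨e, he, h0, h1, h2⟩ : ∃ e : Equiv.Perm (Fin 3), e 0 = 0 ∧ f (e 0) = e 1 ∧
        f (e 1) = e 2 ∧ f (e 2) = e 0 := by
      clear hf
      revert f
      decide
    exact hcon (cyc τ e he (by rw [hf, h0]) (by rw [hf, h1]) (by rw [hf, h2]))
  obtain ⟨σ, hσ⟩ : ∃ σ : K ≃ₐ[k] K, σ (r 0) ≠ r 0 := by
    by_contra! h
    exact hr0 ((IsGalois.mem_range_algebraMap_iff_fixed (r 0)).2 h)
  obtain ⟨f, hf⟩ := hact σ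
  have hf0 : f 0 ≠ 0 := fun h => hσ (by rw [hf, h])
  obtain ⟨e, he0, he1, he2, he3⟩ : ∃ e : Equiv.Perm (Fin 3), e 0 = 0 ∧ f (e 0) = e 1 ∧
      f (e 1) = e 0 ∧ f (e 2) = e 2 := by
    have := nocyc σ f hf
    clear hf
    revert f
    decide
  refine hcon (exists_rational_zero_of_involution hA hB hdet (r := r ∘ e) (σ := σ)
      (hr.comp e.injective) (fun i => hroot (e i))
      (fun τ h => hfaith τ fun i => by simpa using h (e.symm i))
      (by simp [hf, he1]) (by simp [hf, he2]) (by simp [hf, he3]) (fun τ => ?_)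
      (x := x) (by simpa [he0] using hx) (by simpa [he0] using hx'))
  obtain ⟨g, hg⟩ := hact τ
  have hg' := nocyc τ g hg
  have hgf := nocyc (σ * τ) (f * g) (fun i => by simp [hg, hf])
  have hor : (∀ i, g i = i) ∨ (∀ i, g i = f i) := by
    have hff := nocyc σ f hf
    clear hf hg hσ he0 he1 he2 he3
    revert f g
    decide
  rcases hor with h | h
  · exact Or.inl (hfaith τ fun i => by rw [hg, h])
  · right
    rw [← mul_inv_eq_one]
    refine hfaith _ fun i => ?_
    obtain ⟨j, hj⟩ := hact σ⁻¹
    have : σ (σ⁻¹ (r i)) = r i := σ.apply_symm_apply _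
    rw [AlgEquiv.mul_apply, hj, hg, h, ← hf, ← hj, this]

end Descent

section AlgebraicClosure
open Polynomial
variable {k : Type*} [Field k] {A B : Matrix (Fin 3) (Fin 3) k}

theorem det_X_smul_sub_map_C {E : Type*} [Field E] {A B : Matrix (Fin 3) (Fin 3) E}
    (hdet : A.det ≠ 0) :
    ((X : E[X]) • A.map C - B.map C).det = C A.det * (A⁻¹ * B).charpoly := by
  have hAB : (C : E →+* E[X]).mapMatrix A * charmatrix (A⁻¹ * B) =
      (X : E[X]) • A.map C - B.map C := by
    rw [charmatrix, mul_sub, ← map_mul, ← mul_assoc,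
      mul_nonsing_inv _ (isUnit_iff_ne_zero.2 hdet), one_mul, ← Matrix.scalar_comm]
    · ext i j : 1
      simp
    · exact fun _ => Commute.all _ _
  rw [← hAB, det_mul, ← RingHom.map_det]
  rfl

theorem det_smul_sub {E : Type*} [Field E] {A B : Matrix (Fin 3) (Fin 3) E}
    (hdet : A.det ≠ 0) (z : E) :
    (z • A - B).det = A.det * (A⁻¹ * B).charpoly.eval z := by
  have hAB : A * (Matrix.scalar (Fin 3) z - A⁻¹ * B) = z • A - B := by
    rw [mul_sub, ← mul_assoc, mul_nonsing_inv _ (isUnit_iff_ne_zero.2 hdet), one_mul,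
      ← Matrix.scalar_comm]
    · ext i j : 1
      simp
    · exact fun _ => Commute.all _ _
  rw [← hAB, det_mul, Matrix.eval_charpoly]

theorem exists_pencil_roots {E : Type*} [Field E] [IsAlgClosed E]
    {A B : Matrix (Fin 3) (Fin 3) E} (hdet : A.det ≠ 0) {p : E[X]}
    (hp : p = ((X : E[X]) • A.map C - B.map C).det)
    (hsq : ∀ α, p.rootMultiplicity α ≤ 1) :
    ∃ r : Fin 3 → E, Function.Injective r ∧ (A⁻¹ * B).charpoly.Separable ∧
      (A⁻¹ * B).trace = ∑ i, r i ∧ ∀ z, (A⁻¹ * B).charpoly.IsRoot z ↔ ∃ i, z = r i := by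
  classical
  have htr := Matrix.trace_eq_sum_roots_charpoly (A⁻¹ * B)
  have hdeg : (A⁻¹ * B).charpoly.natDegree = 3 := by simp [Matrix.charpoly_natDegree_eq_dim]
  have hq0 := (A⁻¹ * B).charpoly_monic.ne_zero
  rw [det_X_smul_sub_map_C hdet] at hp
  generalize (A⁻¹ * B).charpoly = q at *
  have hnodup : q.roots.Nodup := by
    rw [Multiset.nodup_iff_count_le_one]
    intro z
    rw [← roots_C_mul _ hdet, ← hp, count_roots]
    exact hsq z
  have hcard : q.roots.card = 3 := by
    rw [← (IsAlgClosed.splits q).natDegree_eq_card_roots, hdeg]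
  obtain ⟨a, b, c, habc⟩ := Multiset.card_eq_three.1 hcard
  refine ⟨![a, b, c], ?_,
    (nodup_roots_iff_of_splits hq0 (IsAlgClosed.splits _)).1 hnodup, ?_, fun z => ?_⟩
  · rw [habc] at hnodup
    simp only [Multiset.insert_eq_cons, Multiset.nodup_cons, Multiset.mem_cons,
      Multiset.mem_singleton, Multiset.nodup_singleton, and_true, not_or] at hnodup
    obtain ⟨⟨hab, hac⟩, hbc⟩ := hnodup
    intro i j hij
    fin_cases i <;> fin_cases j <;> simp_all
  · rw [htr, habc]
    simp [Fin.sum_univ_three, add_assoc]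
  · rw [← mem_roots hq0, habc]
    simp [Fin.exists_fin_succ]

theorem normalClo_algebraMap (c : k) :
    normalClo k (algebraMap k (AlgebraicClosure k) c) = ⊥ := by
  rw [normalClo, minpoly.eq_X_sub_C, eq_bot_iff, IntermediateField.adjoin_le_iff]
  intro z hz
  have hz' : z = algebraMap k (AlgebraicClosure k) c := by
    simpa [sub_eq_zero] using (mem_rootSet.1 hz).2
  rw [hz']
  exact (⊥ : IntermediateField k (AlgebraicClosure k)).algebraMap_mem c

theorem isGoodRoot_of_notMem_range (hchar : (2 : k) ≠ 0) (hsA : A.IsSymm) (hsB : B.IsSymm)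
    (hdetA : A.det ≠ 0) (han : ∀ x : Fin 3 → k, x ⬝ᵥ (A *ᵥ x) = 0 → x ⬝ᵥ (B *ᵥ x) = 0 → x = 0)
    {r : Fin 3 → AlgebraicClosure k} (hr : Function.Injective r)
    (hroot : ∀ z, (z • A.map (algebraMap k (AlgebraicClosure k))
        - B.map (algebraMap k (AlgebraicClosure k))).det = 0 ↔ ∃ i, z = r i)
    (hsum : ∑ i, r i ∈ Set.range (algebraMap k (AlgebraicClosure k)))
    (hmin : ∀ z, aeval z (minpoly k (r 0)) = 0 → ∃ i, z = r i)
    (hsep : (minpoly k (r 0)).Separable)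
    (hr1 : aeval (r 1) (minpoly k (r 0)) = 0)
    (hr0 : r 0 ∉ Set.range (algebraMap k (AlgebraicClosure k))) : IsGoodRoot A B (r 0) := by
  intro x hxK hx
  by_contra hx'
  let E := AlgebraicClosure k
  let K := normalClo k (r 0)
  have hint : IsIntegral k (r 0) := Algebra.IsIntegral.isIntegral _
  have hmin0 := minpoly.ne_zero hint
  have : IsSplittingField k K (minpoly k (r 0)) :=
    IntermediateField.adjoin_rootSet_isSplittingField (IsAlgClosed.splits _)
  have : IsGalois k K := IsGalois.of_separable_splitting_field hsep
  have : FiniteDimensional k K := IsSplittingField.finiteDimensional K (minpoly k (r 0))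
  have m0 : r 0 ∈ K :=
    IntermediateField.subset_adjoin _ _ (mem_rootSet.2 ⟨hmin0, minpoly.aeval _ _⟩)
  have m1 : r 1 ∈ K := IntermediateField.subset_adjoin _ _ (mem_rootSet.2 ⟨hmin0, hr1⟩)
  have m2 : r 2 ∈ K := by
    obtain ⟨c, hc⟩ := hsum
    rw [Fin.sum_univ_three] at hc
    have : r 2 = algebraMap k E c - r 0 - r 1 := by rw [hc]; ring
    rw [this]
    exact sub_mem (sub_mem (K.algebraMap_mem c) m0) m1
  have hmem : ∀ i, r i ∈ K := by
    intro i
    fin_cases i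
    exacts [m0, m1, m2]
  let s : Fin 3 → K := fun i => ⟨r i, hmem i⟩
  have hs : Function.Injective s := fun i j h => hr (congrArg Subtype.val h)
  have hmap : ∀ z : K, (algebraMap K E).mapMatrix
      (z • A.map (algebraMap k K) - B.map (algebraMap k K)) =
      (z : E) • A.map (algebraMap k E) - B.map (algebraMap k E) := by
    intro z
    ext i j
    simp [E]
  have hdetK : ∀ z : K, (z • A.map (algebraMap k K) - B.map (algebraMap k K)).det = 0 ↔
      ∃ i, z = s i := by
    intro z
    rw [← map_eq_zero (algebraMap K E), RingHom.map_det, hmap, hroot]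
    simp only [Subtype.ext_iff, s]
  have hrootK : ∀ i, (s i • A.map (algebraMap k K) - B.map (algebraMap k K)).det = 0 :=
    fun i => (hdetK _).2 ⟨i, rfl⟩
  let y : Fin 3 → K := fun i => ⟨x i, hxK i⟩
  have hy : ∀ i, algebraMap K E
      (((s 0 • A.map (algebraMap k K) - B.map (algebraMap k K)) *ᵥ y) i) =
      ((r 0 • A.map (algebraMap k E) - B.map (algebraMap k E)) *ᵥ x) i := by
    intro i
    rw [RingHom.map_mulVec, ← RingHom.mapMatrix_apply, hmap]
    rfl
  suffices h : ∃ w : Fin 3 → k, w ⬝ᵥ (A *ᵥ w) = 0 ∧ w ⬝ᵥ (B *ᵥ w) = 0 ∧ w ≠ 0 by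
    obtain ⟨w, hwA, hwB, hw⟩ := h
    exact hw (han w hwA hwB)
  refine exists_rational_zero_of_isotropic hchar hsA hsB hdetA hs hrootK
    (fun τ i => (hdetK _).1 ?_) (fun τ h => ?_) (fun ⟨c, hc⟩ => hr0 ⟨c, congrArg Subtype.val hc⟩)
    (x := y) ?_ ?_
  · obtain ⟨v, hv0, hv⟩ := exists_mulVec_eq_zero_iff.2 (hrootK i)
    refine exists_mulVec_eq_zero_iff.1 ⟨_, fun h => hv0 ?_, pencil_mulVec_conj_eq_zero τ hv⟩
    ext j : 1
    simpa using congrFun h j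
  · have hext := IntermediateField.algHom_ext_of_eq_adjoin (S := K)
      (s := (minpoly k (r 0)).rootSet E) _ rfl (φ₁ := (τ : K →ₐ[k] K)) (φ₂ := AlgHom.id k K)
      (by
        intro z hz
        obtain ⟨i, rfl⟩ := hmin z (mem_rootSet.1 hz).2
        exact h i)
    exact AlgEquiv.ext fun z => DFunLike.congr_fun hext z
  · apply (algebraMap K E).injective
    rw [map_zero, ← hx]
    simp only [dotProduct, map_sum, map_mul, hy]
    rfl
  · intro h
    apply hx'
    ext i
    rw [← hy, h]
    simp

theorem isGoodRoot_or_of_rational (hsA : A.IsSymm) (hsB : B.IsSymm) (hdetA : A.det ≠ 0)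
    (han : ∀ x : Fin 3 → k, x ⬝ᵥ (A *ᵥ x) = 0 → x ⬝ᵥ (B *ᵥ x) = 0 → x = 0)
    {r : Fin 3 → k} (hr : Function.Injective r)
    (hroot : ∀ i, (algebraMap k (AlgebraicClosure k) (r i) •
      A.map (algebraMap k (AlgebraicClosure k)) -
        B.map (algebraMap k (AlgebraicClosure k))).det = 0)
    {i j : Fin 3} (hij : i ≠ j) :
    IsGoodRoot A B (algebraMap k (AlgebraicClosure k) (r i)) ∨
      IsGoodRoot A B (algebraMap k (AlgebraicClosure k) (r j)) := by
  let f := algebraMap k (AlgebraicClosure k)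
  have hmap : ∀ z : k, f.mapMatrix (z • A - B) = f z • A.map f - B.map f := by
    intro z
    ext i j
    simp
  have hker : ∀ i, ∃ v : Fin 3 → k, v ≠ 0 ∧ (r i • A - B) *ᵥ v = 0 := by
    intro i
    refine exists_mulVec_eq_zero_iff.2 (f.injective ?_)
    rw [RingHom.map_det, hmap, map_zero]
    exact hroot i
  choose v hv0 hv using hker
  have hbad : ∀ i, ¬ IsGoodRoot A B (f (r i)) →
      ∃ x : Fin 3 → k, x ⬝ᵥ ((r i • A - B) *ᵥ x) = 0 ∧ (r i • A - B) *ᵥ x ≠ 0 := by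
    intro i hi
    unfold IsGoodRoot at hi
    push Not at hi
    obtain ⟨x, hxK, hx, hx'⟩ := hi
    rw [normalClo_algebraMap] at hxK
    choose y hy using fun i => IntermediateField.mem_bot.1 (hxK i)
    have hmv : ∀ j, f (((r i • A - B) *ᵥ y) j) = ((f (r i) • A.map f - B.map f) *ᵥ x) j := by
      intro j
      rw [RingHom.map_mulVec, ← RingHom.mapMatrix_apply, hmap]
      congr 2
      exact funext hy
    refine ⟨y, f.injective ?_, fun h => hx' ?_⟩
    · rw [map_zero, ← hx]
      simp only [dotProduct, map_sum, map_mul, hmv]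
      exact Finset.sum_congr rfl fun j _ => by rw [← hy j]
    · ext j
      rw [← hmv, h]
      simp
  by_contra! h
  obtain ⟨x, hx, hx'⟩ := hbad i h.1
  obtain ⟨z, hz, hz'⟩ := hbad j h.2
  obtain ⟨w, hwA, hwB, hw⟩ :=
    common_zero_of_two_isotropic hsA hsB hdetA hr hv0 hv hij hx hx' hz hz'
  exact hw (han w hwA hwB)

end AlgebraicClosure

theorem stmt_3 {k : Type*} [Field k] (hchar : (2 : k) ≠ 0)
    (A B : Matrix (Fin 3) (Fin 3) k)
    (hsA : A.IsSymm) (hsB : B.IsSymm)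
    -- A, B linearly independent over k
    (hli : ∀ a b : k, a • A + b • B = 0 → a = 0 ∧ b = 0)
    (hdetA : A.det ≠ 0)
    -- (A, B) non-singular
    (hns : (((MvPolynomial.X 0 : MvPolynomial (Fin 2) k) • A.map MvPolynomial.C
        - (MvPolynomial.X 1 : MvPolynomial (Fin 2) k) • B.map MvPolynomial.C :
          Matrix (Fin 3) (Fin 3) (MvPolynomial (Fin 2) k))).det ≠ 0)
    -- (A, B) anisotropic over k
    (han : ∀ x : Fin 3 → k, x ⬝ᵥ (A *ᵥ x) = 0 → x ⬝ᵥ (B *ᵥ x) = 0 → x = 0)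
    -- `p = det(A·X − B)` over the algebraic closure
    (p : Polynomial (AlgebraicClosure k))
    (hp : p = (((Polynomial.X : Polynomial (AlgebraicClosure k)) •
        (A.map (algebraMap k (AlgebraicClosure k))).map Polynomial.C
        - (B.map (algebraMap k (AlgebraicClosure k))).map Polynomial.C :
          Matrix (Fin 3) (Fin 3) (Polynomial (AlgebraicClosure k)))).det)
    -- `p` has no repeated root in the algebraic closure
    (hsq : ∀ α : AlgebraicClosure k, p.rootMultiplicity α ≤ 1) :
    (∃ α β : AlgebraicClosure k, α ≠ β ∧ p.IsRoot α ∧ p.IsRoot β ∧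
        IsGoodRoot A B α ∧ IsGoodRoot A B β) ∧
    ∀ α : AlgebraicClosure k, p.IsRoot α →
      α ∉ Set.range (algebraMap k (AlgebraicClosure k)) → IsGoodRoot A B α := by
  let E := AlgebraicClosure k
  let f : k →+* E := algebraMap k E
  have hdet : (A.map f).det ≠ 0 := by
    have h := f.map_det A
    rw [RingHom.mapMatrix_apply] at h
    rw [← h]
    simpa using hdetA
  let q : Polynomial k := (A⁻¹ * B).charpoly
  have hinv : (A⁻¹ * B).map f = (A.map f)⁻¹ * B.map f := by
    rw [Matrix.map_mul]
    congr 1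
    refine (Matrix.inv_eq_right_inv ?_).symm
    rw [← Matrix.map_mul, Matrix.mul_nonsing_inv _ (isUnit_iff_ne_zero.2 hdetA)]
    simp
  have hq : ((A.map f)⁻¹ * B.map f).charpoly = q.map f := by
    rw [← hinv, Matrix.charpoly_map]
  obtain ⟨r, hr, hqsep', htr, hmem⟩ := exists_pencil_roots hdet hp hsq
  have hqsep : q.Separable := by
    rw [hq] at hqsep'
    exact (Polynomial.separable_map f).1 hqsep'
  have hrootq : ∀ z, Polynomial.aeval z q = 0 ↔ ∃ i, z = r i := by
    intro z
    rw [← hmem, hq, Polynomial.IsRoot.def, Polynomial.eval_map, Polynomial.aeval_def]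
  have hproot : ∀ z, p.IsRoot z ↔ ∃ i, z = r i := by
    intro z
    rw [hp, det_X_smul_sub_map_C hdet, ← hmem, Polynomial.IsRoot.def, Polynomial.IsRoot.def,
      Polynomial.eval_mul, Polynomial.eval_C, mul_eq_zero, or_iff_right hdet]
  have hroot : ∀ z, (z • A.map f - B.map f).det = 0 ↔ ∃ i, z = r i := by
    intro z
    rw [← hmem, det_smul_sub hdet, mul_eq_zero, or_iff_right hdet, Polynomial.IsRoot.def]
  have hsum : ∑ i, r i ∈ Set.range f := by
    refine ⟨(A⁻¹ * B).trace, ?_⟩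
    rw [← htr, ← hinv]
    exact AddMonoidHom.map_trace f _
  have hdvd : ∀ i, minpoly k (r i) ∣ q := by
    intro i
    apply minpoly.dvd
    exact (hrootq _).2 ⟨i, rfl⟩
  have hmin : ∀ i z, Polynomial.aeval z (minpoly k (r i)) = 0 → ∃ j, z = r j := by
    intro i z hz
    rw [← hrootq]
    exact Polynomial.aeval_eq_zero_of_dvd_aeval_eq_zero (hdvd i) hz
  have hconj : ∀ i, r i ∉ Set.range f →
      ∃ j, j ≠ i ∧ Polynomial.aeval (r j) (minpoly k (r i)) = 0 := by
    intro i hi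
    by_contra! h
    have hint : IsIntegral k (r i) := Algebra.IsIntegral.isIntegral _
    have hsub : (minpoly k (r i)).rootSet E ⊆ {r i} := by
      intro z hz
      have hz' := (Polynomial.mem_rootSet.1 hz).2
      obtain ⟨j, rfl⟩ := hmin i z hz'
      by_cases hji : j = i
      · rw [hji]; rfl
      · exact absurd hz' (h j hji)
    have hle : (minpoly k (r i)).natDegree ≤ 1 := by
      rw [← Polynomial.card_rootSet_eq_natDegree (K := E) (hqsep.of_dvd (hdvd i))
        (IsAlgClosed.splits _), ← Set.toFinset_card, ← Finset.card_singleton (r i)]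
      exact Finset.card_le_card fun z hz => by simpa using hsub (Set.mem_toFinset.1 hz)
    exact hi (minpoly.natDegree_eq_one_iff.1 (le_antisymm hle (minpoly.natDegree_pos hint)))
  have hgood : ∀ i, r i ∉ Set.range f → IsGoodRoot A B (r i) := by
    intro i hi
    obtain ⟨j, hji, hj⟩ := hconj i hi
    obtain ⟨e, rfl, rfl⟩ : ∃ e : Equiv.Perm (Fin 3), e 0 = i ∧ e 1 = j := by
      clear hj hi
      revert i j
      decide
    refine isGoodRoot_of_notMem_range (r := r ∘ e) hchar hsA hsB hdetA han (hr.comp e.injective)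
      (fun z => ?_) ?_ (fun z hz => ?_) (hqsep.of_dvd (hdvd _)) hj hi
    · exact (hroot z).trans ⟨fun ⟨l, hl⟩ => ⟨e.symm l, by simpa using hl⟩, fun ⟨l, hl⟩ => ⟨e l, hl⟩⟩
    · rwa [← Equiv.sum_comp e] at hsum
    · obtain ⟨l, hl⟩ := hmin _ z hz
      exact ⟨e.symm l, by simpa using hl⟩
  have hroots : ∀ i, p.IsRoot (r i) := fun i => (hproot _).2 ⟨i, rfl⟩
  refine ⟨?_, fun α hα hαk => ?_⟩
  · obtain ⟨i, j, hij, hi, hj⟩ : ∃ i j, i ≠ j ∧ IsGoodRoot A B (r i) ∧ IsGoodRoot A B (r j) := by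
      by_cases hrat : ∀ i, r i ∈ Set.range f
      · choose c hc using hrat
        have hor : ∀ i j, i ≠ j → IsGoodRoot A B (r i) ∨ IsGoodRoot A B (r j) := by
          intro i j hij
          have := isGoodRoot_or_of_rational hsA hsB hdetA han (r := c)
            (fun i j h => hr (by rw [← hc, ← hc, h]))
            (fun i => (hroot _).2 ⟨i, hc i⟩) hij
          rwa [hc, hc] at this
        rcases hor 0 1 (by decide) with h | h
        · rcases hor 1 2 (by decide) with h' | h'
          · exact ⟨0, 1, by decide, h, h'⟩
          · exact ⟨0, 2, by decide, h, h'⟩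
        · rcases hor 0 2 (by decide) with h' | h'
          · exact ⟨0, 1, by decide, h', h⟩
          · exact ⟨1, 2, by decide, h, h'⟩
      · push Not at hrat
        obtain ⟨i, hi⟩ := hrat
        obtain ⟨j, hji, hj⟩ := hconj i hi
        refine ⟨i, j, hji.symm, hgood i hi, hgood j ?_⟩
        rintro ⟨c, hc⟩
        have hint : IsIntegral k (r i) := Algebra.IsIntegral.isIntegral _
        have h := minpoly.eq_of_irreducible_of_monic (minpoly.irreducible hint) hj
          (minpoly.monic hint)
        rw [← hc, minpoly.eq_X_sub_C] at h
        apply hi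
        apply minpoly.natDegree_eq_one_iff.1
        rw [h, Polynomial.natDegree_X_sub_C]
    exact ⟨r i, r j, hr.ne hij, hroots i, hroots j, hi, hj⟩
  · obtain ⟨i, rfl⟩ := (hproot α).1 hα
    exact hgood i hαk
end
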